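/- Assume GRH. Then for each ε > 0 there are infinitely many primitive integer solutions (X,Y,Z) of X+Y=Z with XYZ ≠ 0 satisfying S(X,Y,Z) < (log H(X,Y,Z))^{8+ε}. -/

import Mathlib

noncomputable section

/-- The Generalized Riemann Hypothesis: all zeros of the Riemann zeta function and of
all Dirichlet `L`-functions in the critical strip lie on the critical line. -/
def GRH : Prop :=
  (∀ s : ℂ, 0 < s.re → s.re < 1 → riemannZeta s = 0 → s.re = 1 / 2) ∧
  (∀ (N : ℕ) [NeZero N] (χ : DirichletCharacter ℂ N) (s : ℂ),
    0 < s.re → s.re < 1 → DirichletCharacter.LFunction χ s = 0 → s.re = 1 / 2)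

/-- Height of a triple: `max(|X|,|Y|,|Z|)`. -/
def height (X Y Z : ℤ) : ℤ := max |X| (max |Y| |Z|)

/-- Smoothness of a triple: the largest prime dividing `X*Y*Z`. -/
def smoothness (X Y Z : ℤ) : ℕ := sSup {p : ℕ | p.Prime ∧ (p : ℤ) ∣ X * Y * Z}

/-- A primitive nondegenerate solution of the abc equation. -/
def IsPrimitiveSolution (X Y Z : ℤ) : Prop :=
  X + Y = Z ∧ X * Y * Z ≠ 0 ∧ Int.gcd X (Int.gcd Y Z) = 1

section Growth
open Complex Set MeasureTheory Filter Topology Asymptotics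

lemma norm_integral_mul_cpow_le {f : ℝ → ℂ} {B : ℝ} (hfb : ∀ t, ‖f t‖ ≤ B)
    {s : ℂ} (hs : 0 < s.re) :
    ‖∫ t in Ioi (1 : ℝ), f t * (t : ℂ) ^ (-(s + 1))‖ ≤ B / s.re := by
  have h1 : ∀ t ∈ Ioi (1:ℝ), ‖f t * (t : ℂ) ^ (-(s + 1))‖ ≤ B * t ^ (-(s.re + 1)) := by
    intro t ht
    have ht0 : (0:ℝ) < t := lt_trans one_pos ht
    rw [norm_mul, Complex.norm_cpow_eq_rpow_re_of_pos ht0]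
    simp only [neg_add_rev, add_re, neg_re, one_re]
    gcongr
    exact hfb t
  have hfi : IntegrableOn (fun t : ℝ => B * t ^ (-(s.re + 1))) (Ioi 1) :=
    (integrableOn_Ioi_rpow_of_lt (by linarith) one_pos).const_mul B
  refine (norm_integral_le_of_norm_le hfi ((ae_restrict_iff' measurableSet_Ioi).2
    (Eventually.of_forall h1))).trans ?_
  rw [integral_const_mul, integral_Ioi_rpow_of_lt (by linarith) one_pos]
  simp [div_eq_mul_inv]

lemma differentiableAt_integral_mul_cpow {f : ℝ → ℂ} {B : ℝ} (hf : Measurable f)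
    (hfb : ∀ t, ‖f t‖ ≤ B) {s : ℂ} (hs : 0 < s.re) :
    DifferentiableAt ℂ (fun s : ℂ => ∫ t in Ioi (1 : ℝ), f t * (t : ℂ) ^ (-(s + 1))) s := by
  set g : ℝ → ℂ := (Ioi (1:ℝ)).indicator f with hg
  have hgm : Measurable g := hf.indicator measurableSet_Ioi
  have hB : 0 ≤ B := (norm_nonneg _).trans (hfb 0)
  have hgb : ∀ t, ‖g t‖ ≤ B := fun t => by
    rw [hg]; by_cases h : t ∈ Ioi (1:ℝ)
    · rw [indicator_of_mem h]; exact hfb t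
    · rw [indicator_of_notMem h]; simpa using hB
  have key : (fun s : ℂ => ∫ t in Ioi (1 : ℝ), f t * (t : ℂ) ^ (-(s + 1)))
      = fun s => mellin g (-s) := by
    funext s
    rw [mellin]
    have : (fun t : ℝ => (t:ℂ) ^ (-s - 1) • g t) =
        (Ioi (1:ℝ)).indicator (fun t => f t * (t : ℂ) ^ (-(s + 1))) := by
      funext t
      by_cases h : t ∈ Ioi (1:ℝ)
      · rw [hg, indicator_of_mem h, indicator_of_mem h, smul_eq_mul, mul_comm]; ring_nf
      · rw [hg, indicator_of_notMem h, indicator_of_notMem h]; simp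
    rw [this, setIntegral_indicator measurableSet_Ioi]
    congr 2
    ext t; simp
  rw [key]
  have hd : DifferentiableAt ℂ (mellin g) (-s) := by
    refine mellin_differentiableAt_of_isBigO_rpow (a := 0) (b := -s.re - 1) ?_ ?_ ?_ ?_ ?_
    · refine LocallyIntegrable.locallyIntegrableOn ?_ _
      exact (locallyIntegrable_const B).mono hgm.aestronglyMeasurable
        (Eventually.of_forall fun t => by
          rw [Real.norm_of_nonneg hB]; exact hgb t)
    · refine IsBigO.of_bound B (Eventually.of_forall fun t => ?_)
      simpa using hgb t
    · simpa using hs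
    · refine IsBigO.of_bound 0 ?_
      filter_upwards [Ioo_mem_nhdsGT (zero_lt_one (α := ℝ))] with t ht
      rw [hg, indicator_of_notMem (by simpa using ht.2.le)]; simp
    · simp
  exact hd.comp s (differentiableAt_id.neg)

lemma eqOn_re_pos_of_eqOn_re_gt_one {F G : ℂ → ℂ} (hF : ∀ s : ℂ, 0 < s.re → DifferentiableAt ℂ F s)
    (hG : ∀ s : ℂ, 0 < s.re → DifferentiableAt ℂ G s) (h : ∀ s : ℂ, 1 < s.re → F s = G s)
    {s : ℂ} (hs : 0 < s.re) : F s = G s := by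
  have hopen : IsOpen {s : ℂ | 0 < s.re} := isOpen_lt continuous_const continuous_re
  have hconv : Convex ℝ {s : ℂ | 0 < s.re} := convex_halfSpace_re_gt 0
  have := AnalyticOnNhd.eqOn_of_preconnected_of_eventuallyEq (𝕜 := ℂ)
    (DifferentiableOn.analyticOnNhd (fun z hz => (hF z hz).differentiableWithinAt) hopen)
    (DifferentiableOn.analyticOnNhd (fun z hz => (hG z hz).differentiableWithinAt) hopen)
    hconv.isPreconnected (z₀ := 2) (by show (0:ℝ) < (2:ℂ).re; simp)
    (by
      have : {s : ℂ | 1 < s.re} ∈ 𝓝 (2:ℂ) :=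
        (isOpen_lt continuous_const continuous_re).mem_nhds (by simp)
      filter_upwards [this] with z hz using h z hz)
  exact this hs

lemma norm_sum_dirichletCharacter_le {q : ℕ} [NeZero q] {χ : DirichletCharacter ℂ q}
    (hχ : χ ≠ 1) (n : ℕ) : ‖∑ k ∈ Finset.Icc 1 n, χ k‖ ≤ q := by
  have hper : ∀ a : ℕ, ∑ k ∈ Finset.range q, χ ((a + k : ℕ) : ZMod q) = 0 := by
    intro a
    have h0 := MulChar.sum_eq_zero_of_ne_one (χ := χ) hχ
    rw [← h0]
    refine Finset.sum_nbij' (fun k => ((a + k : ℕ) : ZMod q)) (fun z => (z - a : ZMod q).val)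
      ?_ ?_ ?_ ?_ ?_
    · simp
    · intro z _; simp [ZMod.val_lt]
    · intro k hk
      have := Finset.mem_range.1 hk
      simp [ZMod.val_cast_of_lt this]
    · intro z _; simp
    · simp
  have hblock : ∀ m a : ℕ, ∑ k ∈ Finset.range (q * m), χ ((a + k : ℕ) : ZMod q) = 0 := by
    intro m
    induction m with
    | zero => simp
    | succ m ih =>
      intro a
      rw [Nat.mul_succ, Finset.sum_range_add, ih, zero_add]
      simpa [add_assoc] using hper (a + q * m)
  have h1 : ∑ k ∈ Finset.Icc 1 n, χ k = ∑ k ∈ Finset.range n, χ ((1 + k : ℕ) : ZMod q) := by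
    rw [← Finset.Ico_add_one_right_eq_Icc, Finset.sum_Ico_eq_sum_range]
    simp
  rw [h1]
  conv_lhs => rw [← Nat.div_add_mod n q]
  rw [Finset.sum_range_add, hblock, zero_add]
  refine (norm_sum_le _ _).trans ?_
  refine (Finset.sum_le_card_nsmul _ _ 1 (fun k _ => DirichletCharacter.norm_le_one _ _)).trans ?_
  simp
  exact (Nat.mod_lt _ (Nat.pos_of_ne_zero (NeZero.ne q))).le

lemma norm_LFunction_le {q : ℕ} [NeZero q] {χ : DirichletCharacter ℂ q} (hχ : χ ≠ 1)
    {s : ℂ} (hs : 0 < s.re) : ‖χ.LFunction s‖ ≤ ‖s‖ * (q / s.re) := by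
  set A : ℝ → ℂ := fun t => ∑ k ∈ Finset.Icc 1 ⌊t⌋₊, χ k with hA
  have hAm : Measurable A :=
    (measurable_from_nat (f := fun n : ℕ => ∑ k ∈ Finset.Icc 1 n, χ (k : ZMod q))).comp
      Nat.measurable_floor
  have hAb : ∀ t, ‖A t‖ ≤ q := fun t => norm_sum_dirichletCharacter_le hχ _
  have h : χ.LFunction s = s * ∫ t in Ioi (1 : ℝ), A t * (t : ℂ) ^ (-(s + 1)) := by
    refine eqOn_re_pos_of_eqOn_re_gt_one (F := χ.LFunction)
      (G := fun s => s * ∫ t in Ioi (1 : ℝ), A t * (t : ℂ) ^ (-(s + 1)))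
      (fun z _ => DirichletCharacter.differentiable_LFunction hχ z)
      (fun z hz => differentiableAt_id.mul (differentiableAt_integral_mul_cpow hAm hAb hz))
      (fun z hz => ?_) hs
    rw [DirichletCharacter.LFunction_eq_LSeries χ hz]
    refine LSeries_eq_mul_integral _ le_rfl (by linarith)
      (DirichletCharacter.LSeriesSummable_of_one_lt_re χ hz) ?_
    refine IsBigO.of_bound q (Eventually.of_forall fun n => ?_)
    simpa using norm_sum_dirichletCharacter_le hχ n
  rw [h, norm_mul]
  gcongr
  exact norm_integral_mul_cpow_le hAb hs

/-- The entire function `(s - 1) ζ(s)`, on the half plane `0 < s.re`. -/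
def zetaMulSubOne (s : ℂ) : ℂ :=
  s - (s - 1) * s * ∫ t in Ioi (1 : ℝ), ((Int.fract t : ℝ) : ℂ) * (t : ℂ) ^ (-(s + 1))

lemma norm_fract_le (t : ℝ) : ‖((Int.fract t : ℝ) : ℂ)‖ ≤ 1 := by
  rw [Complex.norm_real, Real.norm_of_nonneg (Int.fract_nonneg t)]
  exact (Int.fract_lt_one t).le

lemma measurable_fract_ofReal : Measurable fun t : ℝ => ((Int.fract t : ℝ) : ℂ) :=
  Complex.measurable_ofReal.comp measurable_fract

lemma differentiableAt_zetaMulSubOne {s : ℂ} (hs : 0 < s.re) :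
    DifferentiableAt ℂ zetaMulSubOne s := by
  have := differentiableAt_integral_mul_cpow measurable_fract_ofReal norm_fract_le hs
  unfold zetaMulSubOne
  fun_prop

lemma zetaMulSubOne_eq_of_one_lt_re {s : ℂ} (hs : 1 < s.re) :
    zetaMulSubOne s = (s - 1) * riemannZeta s := by
  have hs1 : s - 1 ≠ 0 := fun h => by
    rw [sub_eq_zero] at h; rw [h] at hs; simp at hs
  have h1 : riemannZeta s = s * ∫ t in Ioi (1 : ℝ), ((⌊t⌋₊ : ℝ) : ℂ) * (t : ℂ) ^ (-(s + 1)) := by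
    rw [← LSeries_one_eq_riemannZeta hs]
    rw [LSeries_eq_mul_integral (1 : ℕ → ℂ) zero_le_one hs (LSeriesSummable_one_iff.2 hs)]
    · simp
    · refine IsBigO.of_bound 1 (Eventually.of_forall fun n => ?_)
      simp
  have e : ∀ t ∈ Ioi (1:ℝ), ((⌊t⌋₊ : ℝ) : ℂ) * (t : ℂ) ^ (-(s + 1)) =
      (t : ℂ) ^ (-s) - ((Int.fract t : ℝ) : ℂ) * (t : ℂ) ^ (-(s + 1)) := by
    intro t ht
    have ht0 : (0:ℝ) < t := lt_trans one_pos ht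
    have : (⌊t⌋₊ : ℝ) = t - Int.fract t := by
      rw [Int.self_sub_fract, ← natCast_floor_eq_intCast_floor ht0.le]
    rw [this, ofReal_sub, sub_mul]
    congr 1
    have hz : (t:ℂ) ≠ 0 := by exact_mod_cast ht0.ne'
    rw [show -s = 1 + -(s + 1) by ring, cpow_add _ _ hz, cpow_one]
  have i1 : IntegrableOn (fun t : ℝ => (t : ℂ) ^ (-s)) (Ioi 1) :=
    integrableOn_Ioi_cpow_of_lt (by simpa using hs) one_pos
  have i2 : IntegrableOn (fun t : ℝ => ((Int.fract t : ℝ) : ℂ) * (t : ℂ) ^ (-(s + 1))) (Ioi 1) := by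
    refine Integrable.bdd_mul (c := 1) (integrableOn_Ioi_cpow_of_lt (by simp; linarith) one_pos)
      measurable_fract_ofReal.aestronglyMeasurable (Eventually.of_forall norm_fract_le)
  rw [h1, setIntegral_congr_fun measurableSet_Ioi e, integral_sub i1 i2,
    integral_Ioi_cpow_of_lt (by simpa using hs) one_pos, zetaMulSubOne]
  have hs2 : -s + 1 ≠ 0 := fun h => hs1 (by linear_combination -h)
  simp
  field_simp
  ring

lemma zetaMulSubOne_eq {s : ℂ} (hs : 0 < s.re) (hs1 : s ≠ 1) :
    zetaMulSubOne s = (s - 1) * riemannZeta s := by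
  have h := eqOn_re_pos_of_eqOn_re_gt_one (F := zetaMulSubOne)
    (G := DirichletCharacter.LFunctionTrivChar₁ 1)
    (fun z hz => differentiableAt_zetaMulSubOne hz)
    (fun z _ => DirichletCharacter.differentiable_LFunctionTrivChar₁ 1 z)
    (fun z hz => ?_) hs
  · rw [h, DirichletCharacter.LFunctionTrivChar₁, Function.update_of_ne hs1]
    simp [DirichletCharacter.LFunctionTrivChar]
  · have hz1 : z ≠ 1 := fun h => by rw [h] at hz; simp at hz
    rw [zetaMulSubOne_eq_of_one_lt_re hz, DirichletCharacter.LFunctionTrivChar₁,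
      Function.update_of_ne hz1]
    simp [DirichletCharacter.LFunctionTrivChar]

lemma zetaMulSubOne_one : zetaMulSubOne 1 = 1 := by simp [zetaMulSubOne]

lemma norm_zetaMulSubOne_le {s : ℂ} (hs : 0 < s.re) :
    ‖zetaMulSubOne s‖ ≤ ‖s‖ + ‖s - 1‖ * ‖s‖ * (1 / s.re) := by
  rw [zetaMulSubOne]
  refine (norm_sub_le _ _).trans ?_
  rw [norm_mul, norm_mul]
  gcongr
  exact norm_integral_mul_cpow_le norm_fract_le hs

end Growth

section LogDeriv
open Complex Set MeasureTheory Filter Topology Asymptotics Metric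

lemma norm_iteratedDeriv_logDeriv_le {F : ℂ → ℂ} {c : ℂ} {R r A : ℝ} (hr : 0 < r) (hrR : r < R)
    (hF : DifferentiableOn ℂ F (ball c R)) (hne : ∀ z ∈ ball c R, F z ≠ 0) (hA0 : 0 < A)
    (hA : ∀ z ∈ ball c R, ‖F z‖ ≤ Real.exp A * ‖F c‖) (j : ℕ) :
    ‖iteratedDeriv j (logDeriv F) c‖ ≤ (j + 1).factorial * (2 * A * r / (R - r)) / r ^ (j + 1) := by
  have hR : 0 < R := hr.trans hrR
  have hcb : c ∈ ball c R := mem_ball_self hR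
  have hlog : DifferentiableOn ℂ (logDeriv F) (ball c R) := by
    unfold logDeriv
    exact (hF.deriv isOpen_ball).div hF hne
  obtain ⟨g, hgc, hg⟩ := (hlog.isExactOn_ball).with_val_at c 0
  have hFd : ∀ z ∈ ball c R, HasDerivAt F (deriv F z) z := fun z hz =>
    (hF.differentiableAt (isOpen_ball.mem_nhds hz)).hasDerivAt
  have hconst : ∀ z ∈ ball c R, F z * exp (-g z) = F c := by
    intro z hz
    have hd : ∀ w ∈ ball c R, HasDerivAt (fun w => F w * exp (-g w)) 0 w := by
      intro w hw
      have := (hFd w hw).mul ((hg w hw).neg.cexp)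
      refine this.congr_deriv ?_
      rw [logDeriv_apply]
      have := hne w hw
      field_simp
      ring
    have := (convex_ball c R).is_const_of_fderivWithin_eq_zero (𝕜 := ℂ)
      (f := fun w => F w * exp (-g w))
      (fun w hw => (hd w hw).differentiableAt.differentiableWithinAt)
      (fun w hw => by
        rw [fderivWithin_of_isOpen isOpen_ball hw]
        have := (hd w hw).hasFDerivAt.fderiv
        rw [this]; ext; simp) hz hcb
    simpa [hgc] using this
  have hre : ∀ z ∈ ball c R, (g z).re ≤ A := by
    intro z hz
    have h1 : F z = F c * exp (g z) := by
      rw [← hconst z hz, mul_assoc, ← exp_add]; simp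
    have h2 := hA z hz
    rw [h1, norm_mul, norm_exp, mul_comm] at h2
    have h3 : 0 < ‖F c‖ := norm_pos_iff.2 (hne c hcb)
    exact Real.exp_le_exp.1 (le_of_mul_le_mul_right h2 h3)
  have hgd : DifferentiableOn ℂ g (ball c R) := fun z hz =>
    (hg z hz).differentiableAt.differentiableWithinAt
  have hbc : ∀ z ∈ sphere c r, ‖g z‖ ≤ 2 * A * r / (R - r) := by
    intro z hz
    have hz' : ‖z - c‖ = r := by simpa [dist_eq_norm] using hz
    have := Complex.borelCaratheodory_zero (f := fun w => g (c + w)) (R := R) (M := A)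
      (z := z - c) hA0 ?_ ?_ hR (by simpa [hz'] using hrR) (by simpa using hgc)
    · simpa [hz'] using this
    · intro w hw
      have hw' : c + w ∈ ball c R := by simpa using hw
      exact ((hg _ hw').comp_const_add c w).differentiableAt.differentiableWithinAt
    · intro w hw
      exact hre _ (by simpa using hw)
  have hit : iteratedDeriv j (logDeriv F) c = iteratedDeriv (j + 1) g c := by
    rw [iteratedDeriv_succ']
    refine (Filter.EventuallyEq.iteratedDeriv_eq j ?_)
    filter_upwards [isOpen_ball.mem_nhds hcb] with z hz
    exact (hg z hz).deriv.symm
  rw [hit]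
  refine Complex.norm_iteratedDeriv_le_of_forall_mem_sphere_norm_le (j + 1) hr ?_ hbc
  refine (hgd.mono ?_).diffContOnCl_ball (U := ball c R) (closedBall_subset_ball hrR)
  exact Subset.rfl

end LogDeriv

section CoefficientBounds
open Complex Set MeasureTheory Filter Topology Asymptotics Metric
open scoped ArithmeticFunction

lemma logMul_iterate (f : ℕ → ℂ) (j : ℕ) :
    LSeries.logMul^[j] f = fun n : ℕ => (Complex.log n) ^ j * f n := by
  induction j with
  | zero => simp
  | succ j ih => rw [Function.iterate_succ', Function.comp, ih]; funext n; simp [pow_succ]; ring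

lemma one_quarter_le_norm_LSeries {f : ℕ → ℂ} (h1 : f 1 = 1) (hf : ∀ n, ‖f n‖ ≤ 1) {s : ℂ}
    (hs : 2 ≤ s.re) : 1 / 4 ≤ ‖LSeries f s‖ := by
  have hsum : LSeriesSummable f s :=
    LSeriesSummable_of_bounded_of_one_lt_re (m := 1) (fun n _ => hf n) (by linarith)
  have hterm : ∀ n, ‖LSeries.term f s n‖ ≤ 1 / (n:ℝ) ^ 2 := by
    intro n
    rcases eq_or_ne n 0 with rfl | hn
    · simp
    rw [LSeries.norm_term_eq, if_neg hn]
    have h1n : (1:ℝ) ≤ n := by exact_mod_cast Nat.one_le_iff_ne_zero.2 hn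
    gcongr
    · exact hf n
    · rw [← Real.rpow_natCast]; exact Real.rpow_le_rpow_of_exponent_le h1n (by simpa using hs)
  have hz := hasSum_zeta_two
  have e1 : LSeries f s = 1 + ∑' n, if n = 1 then 0 else LSeries.term f s n := by
    rw [LSeries, hsum.tsum_eq_add_tsum_ite 1]
    congr 1
    rw [LSeries.term_of_ne_zero one_ne_zero]; simp [h1]
  have e2 : Real.pi ^ 2 / 6 = 1 + ∑' n : ℕ, if n = 1 then 0 else 1 / (n:ℝ) ^ 2 := by
    rw [← hz.tsum_eq, hz.summable.tsum_eq_add_tsum_ite 1]; simp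
  have hs2 : Summable (fun n : ℕ => if n = 1 then (0:ℝ) else 1 / (n:ℝ) ^ 2) := by
    refine hz.summable.of_nonneg_of_le (fun n => ?_) (fun n => ?_) <;>
      split_ifs <;> first | exact le_rfl | positivity
  have h3 : ‖∑' n, if n = 1 then 0 else LSeries.term f s n‖ ≤
      ∑' n : ℕ, if n = 1 then 0 else 1 / (n:ℝ) ^ 2 := by
    refine tsum_of_norm_bounded hs2.hasSum (fun n => ?_)
    split_ifs with h
    · simp
    · exact hterm n
  have hpi : Real.pi ^ 2 < 10 := by nlinarith [Real.pi_lt_d2, Real.pi_gt_three]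
  rw [e1]
  have h4 := norm_sub_le_norm_add (1:ℂ) (∑' n, if n = 1 then 0 else LSeries.term f s n)
  rw [norm_one] at h4
  linarith

/-- A bound for the logarithm of the growth of Dirichlet `L`-functions near height `t`. -/
def growthLog (K : ℕ) (q : ℕ) (t : ℝ) : ℝ := 2 * Real.log (12 * q * (2 * K + 3 + |t|))

lemma growthLog_pos {K q : ℕ} {t : ℝ} (hq : 1 ≤ q) : 0 < growthLog K q t := by
  have h1 : (1:ℝ) ≤ q := by exact_mod_cast hq
  have : (1:ℝ) < 12 * q * (2 * K + 3 + |t|) := by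
    have := abs_nonneg t
    have : (0:ℝ) ≤ K := by positivity
    nlinarith
  exact mul_pos two_pos (Real.log_pos this)

lemma exp_growthLog {K q : ℕ} {t : ℝ} (hq : 1 ≤ q) :
    Real.exp (growthLog K q t) = (12 * q * (2 * K + 3 + |t|)) ^ 2 := by
  have h1 : (1:ℝ) ≤ q := by exact_mod_cast hq
  have := abs_nonneg t
  rw [growthLog, two_mul, Real.exp_add, Real.exp_log (by positivity)]; ring

lemma one_lt_re_of_mem_ball {K : ℕ} {t : ℝ} {z : ℂ}
    (hz : z ∈ ball ((1 + K : ℝ) + t * I : ℂ) (K + 1 / 2)) :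
    1 / 2 < z.re ∧ ‖z‖ ≤ 2 * K + 3 + |t| ∧ ‖z - 1‖ ≤ 2 * K + 3 + |t| := by
  have h : ‖z - ((1 + K : ℝ) + t * I)‖ < K + 1 / 2 := by simpa [dist_eq_norm] using hz
  have hre := (abs_re_le_norm (z - ((1 + K : ℝ) + t * I))).trans_lt h
  have h2 : ‖(((1 + K : ℝ):ℂ) + t * I)‖ ≤ 1 + K + |t| := by
    refine (norm_add_le _ _).trans ?_
    rw [norm_mul, norm_I, norm_real, norm_real, Real.norm_eq_abs, Real.norm_eq_abs,
      abs_of_nonneg (by positivity : (0:ℝ) ≤ 1 + K)]; simp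
  have h3 : ‖z‖ ≤ 2 * K + 2 + |t| := by
    have := norm_add_le (z - ((1 + K : ℝ) + t * I)) ((1 + K : ℝ) + t * I)
    rw [sub_add_cancel] at this; linarith
  have h4 := norm_sub_le z 1
  rw [norm_one] at h4
  refine ⟨?_, by linarith, by linarith⟩
  have h1 := abs_lt.1 hre
  simp at h1; linarith [h1.1]

lemma norm_LSeries_twist_logPow_le (hGRH : GRH) {K : ℕ} (hK : 1 ≤ K) {q : ℕ} [NeZero q]
    {χ : DirichletCharacter ℂ q} (hχ : χ ≠ 1) (t : ℝ) {η : ℝ} (hη : 0 < η) (hη1 : η < 1) (j : ℕ) :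
    ‖LSeries (fun n : ℕ => (Complex.log n) ^ j * (χ n * (Λ n : ℂ))) ((1 + K : ℝ) + t * I)‖ ≤
      (j + 1).factorial * (2 * growthLog K q t * (K + 1 / 2 - η) / η) /
        (K + 1 / 2 - η) ^ (j + 1) := by
  set c : ℂ := (1 + K : ℝ) + t * I with hc
  have hK' : (1:ℝ) ≤ K := by exact_mod_cast hK
  have hq : 1 ≤ q := Nat.one_le_iff_ne_zero.2 (NeZero.ne q)
  have hq' : (1:ℝ) ≤ q := by exact_mod_cast hq
  have hcre : c.re = 1 + K := by simp [hc]
  have hc1 : 1 < c.re := by rw [hcre]; linarith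
  have main := norm_iteratedDeriv_logDeriv_le (F := χ.LFunction) (c := c) (R := K + 1 / 2)
    (r := K + 1 / 2 - η) (A := growthLog K q t) (by linarith) (by linarith)
    (fun z _ => (DirichletCharacter.differentiable_LFunction hχ z).differentiableWithinAt)
    ?_ (growthLog_pos hq) ?_ j
  · rw [show (K:ℝ) + 1 / 2 - (K + 1 / 2 - η) = η by ring] at main
    refine le_trans (le_of_eq ?_) main
    have e : logDeriv χ.LFunction =ᶠ[𝓝 c] fun z =>
        - LSeries ((fun n : ℕ => χ n) * fun n : ℕ => (Λ n : ℂ)) z := by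
      have : {z : ℂ | 1 < z.re} ∈ 𝓝 c :=
        (isOpen_lt continuous_const continuous_re).mem_nhds hc1
      filter_upwards [this] with z hz
      rw [DirichletCharacter.LSeries_twist_vonMangoldt_eq χ hz, logDeriv_apply,
        DirichletCharacter.deriv_LFunction_eq_deriv_LSeries χ hz,
        DirichletCharacter.LFunction_eq_LSeries χ hz]
      ring
    have habs : LSeries.abscissaOfAbsConv ((fun n : ℕ => χ n) * fun n : ℕ => (Λ n : ℂ)) < c.re := by
      refine lt_of_le_of_lt (LSeries.abscissaOfAbsConv_le_of_forall_lt_LSeriesSummable (x := 1)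
        fun y hy => DirichletCharacter.LSeriesSummable_twist_vonMangoldt χ (by simpa using hy)) ?_
      exact_mod_cast hc1
    rw [e.iteratedDeriv_eq, iteratedDeriv_fun_neg, norm_neg, LSeries_iteratedDeriv _ habs, norm_mul,
      norm_pow, norm_neg, norm_one, one_pow, one_mul, logMul_iterate]
    simp only [Pi.mul_apply]
  · intro z hz h0
    have hz' := (one_lt_re_of_mem_ball hz).1
    by_cases h1 : 1 ≤ z.re
    · exact DirichletCharacter.LFunction_ne_zero_of_one_le_re χ (Or.inl hχ) h1 h0
    · have := hGRH.2 q χ z (by linarith) (by linarith) h0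
      linarith
  · intro z hz
    obtain ⟨hz1, hz2, -⟩ := one_lt_re_of_mem_ball hz
    have hlow : 1 / 4 ≤ ‖χ.LFunction c‖ := by
      rw [DirichletCharacter.LFunction_eq_LSeries χ hc1]
      exact one_quarter_le_norm_LSeries (by simp) (fun n => χ.norm_le_one _)
        (by rw [hcre]; linarith)
    rw [exp_growthLog hq]
    have h5 := norm_LFunction_le hχ (s := z) (by linarith)
    have h6 : (q:ℝ) / z.re ≤ 2 * q := by
      rw [div_le_iff₀ (by linarith)]; nlinarith
    have hX : (1:ℝ) ≤ 2 * K + 3 + |t| := by have := abs_nonneg t; linarith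
    set X := 2 * (K:ℝ) + 3 + |t|
    calc ‖χ.LFunction z‖ ≤ ‖z‖ * (q / z.re) := h5
      _ ≤ X * (2 * q) := by gcongr
      _ ≤ (12 * q * X) ^ 2 * (1 / 4) := by nlinarith [mul_le_mul hq' hX zero_le_one (by linarith)]
      _ ≤ _ := by gcongr

lemma norm_LSeries_logPow_sub_le (hGRH : GRH) {K : ℕ} (hK : 1 ≤ K) (t : ℝ) {η : ℝ}
    (hη : 0 < η) (hη1 : η < 1) (j : ℕ) :
    ‖LSeries (fun n : ℕ => (Complex.log n) ^ j * (Λ n : ℂ)) ((1 + K : ℝ) + t * I) -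
        j.factorial / (K + t * I) ^ (j + 1)‖ ≤
      (j + 1).factorial * (2 * growthLog K 1 t * (K + 1 / 2 - η) / η) /
        (K + 1 / 2 - η) ^ (j + 1) := by
  set c : ℂ := (1 + K : ℝ) + t * I with hc
  have hK' : (1:ℝ) ≤ K := by exact_mod_cast hK
  have hcre : c.re = 1 + K := by simp [hc]
  have hc1 : 1 < c.re := by rw [hcre]; linarith
  have hcK : c - 1 = K + t * I := by rw [hc]; push_cast; ring
  have hKt : (K + t * I : ℂ) ≠ 0 := fun h => by
    have := congrArg re h; simp at this; omega
  have main := norm_iteratedDeriv_logDeriv_le (F := zetaMulSubOne) (c := c) (R := K + 1 / 2)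
    (r := K + 1 / 2 - η) (A := growthLog K 1 t) (by linarith) (by linarith)
    (fun z hz => (differentiableAt_zetaMulSubOne
      (by linarith [(one_lt_re_of_mem_ball hz).1])).differentiableWithinAt)
    ?_ (growthLog_pos le_rfl) ?_ j
  · rw [show (K:ℝ) + 1 / 2 - (K + 1 / 2 - η) = η by ring] at main
    refine le_trans (le_of_eq ?_) main
    have e : logDeriv zetaMulSubOne =ᶠ[𝓝 c]
        fun z => (z - 1)⁻¹ - LSeries (fun n : ℕ => (Λ n : ℂ)) z := by
      have ho : IsOpen {z : ℂ | 1 < z.re} := isOpen_lt continuous_const continuous_re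
      filter_upwards [ho.mem_nhds hc1] with z hz
      have hz1 : z - 1 ≠ 0 := fun h => by
        rw [sub_eq_zero] at h; rw [h] at hz; simp at hz
      have hd : deriv zetaMulSubOne z = deriv (fun z => (z - 1) * riemannZeta z) z := by
        refine Filter.EventuallyEq.deriv_eq ?_
        filter_upwards [ho.mem_nhds hz] with w hw using zetaMulSubOne_eq_of_one_lt_re hw
      have hzd : DifferentiableAt ℂ riemannZeta z := differentiableAt_riemannZeta (sub_ne_zero.1 hz1)
      rw [logDeriv_apply, hd, zetaMulSubOne_eq_of_one_lt_re hz,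
        ArithmeticFunction.LSeries_vonMangoldt_eq_deriv_riemannZeta_div hz,
        deriv_fun_mul (by fun_prop) hzd]
      have hz0 : riemannZeta z ≠ 0 := riemannZeta_ne_zero_of_one_le_re (le_of_lt hz)
      simp
      field_simp
      ring
    have habs : LSeries.abscissaOfAbsConv (fun n : ℕ => (Λ n : ℂ)) < c.re := by
      refine lt_of_le_of_lt (LSeries.abscissaOfAbsConv_le_of_forall_lt_LSeriesSummable (x := 1)
        fun y hy => ArithmeticFunction.LSeriesSummable_vonMangoldt (by simpa using hy)) ?_
      exact_mod_cast hc1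
    have hc1' : c - 1 ≠ 0 := hcK ▸ hKt
    have hI : ContDiffAt ℂ j (fun z : ℂ => (z - 1)⁻¹) c :=
      (contDiffAt_id.sub contDiffAt_const).inv hc1'
    have hL : ContDiffAt ℂ j (LSeries fun n : ℕ => (Λ n : ℂ)) c :=
      ((LSeries_analyticOnNhd (fun n : ℕ => (Λ n : ℂ))) c habs).contDiffAt
    have hinv : iteratedDeriv j (fun z : ℂ => (z - 1)⁻¹) c =
        (-1) ^ j * (j.factorial / (K + t * I) ^ (j + 1)) := by
      have := congrFun (iteratedDeriv_comp_sub_const j (fun z : ℂ => z⁻¹) 1) c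
      rw [this, iteratedDeriv_eq_iterate, iter_deriv_inv, hcK,
        show (-1 - j : ℤ) = -((j + 1 : ℕ) : ℤ) by push_cast; ring, zpow_neg, zpow_natCast]
      ring
    rw [e.iteratedDeriv_eq, iteratedDeriv_fun_sub hI hL, hinv, LSeries_iteratedDeriv _ habs,
      ← mul_sub, norm_mul, norm_pow, norm_neg, norm_one, one_pow, one_mul, logMul_iterate,
      norm_sub_rev]
  · intro z hz h0
    have hz' := (one_lt_re_of_mem_ball hz).1
    by_cases hz1 : z = 1
    · rw [hz1, zetaMulSubOne_one] at h0; exact one_ne_zero h0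
    rw [zetaMulSubOne_eq (by linarith) hz1] at h0
    have h0 : riemannZeta z = 0 := (mul_eq_zero.1 h0).resolve_left (sub_ne_zero.2 hz1)
    by_cases h1 : 1 ≤ z.re
    · exact riemannZeta_ne_zero_of_one_le_re h1 h0
    · have := hGRH.1 z (by linarith) (by linarith) h0
      linarith
  · intro z hz
    obtain ⟨hz1, hz2, hz3⟩ := one_lt_re_of_mem_ball hz
    have hlow : 1 / 4 ≤ ‖zetaMulSubOne c‖ := by
      rw [zetaMulSubOne_eq_of_one_lt_re hc1, ← LSeries_one_eq_riemannZeta hc1, norm_mul]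
      have h1 := one_quarter_le_norm_LSeries (f := 1) (by simp) (fun n => by simp) (s := c)
        (by rw [hcre]; linarith)
      have h2 : 1 ≤ ‖c - 1‖ := by
        refine le_trans ?_ ((le_abs_self _).trans (abs_re_le_norm _))
        rw [sub_re, hcre]; simpa using hK'
      nlinarith
    rw [exp_growthLog le_rfl]
    have h5 := norm_zetaMulSubOne_le (s := z) (by linarith)
    have h6 : 1 / z.re ≤ 2 := by
      rw [div_le_iff₀ (by linarith)]; nlinarith
    have hX : (1:ℝ) ≤ 2 * K + 3 + |t| := by have := abs_nonneg t; linarith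
    set X := 2 * (K:ℝ) + 3 + |t|
    calc ‖zetaMulSubOne z‖ ≤ ‖z‖ + ‖z - 1‖ * ‖z‖ * (1 / z.re) := h5
      _ ≤ X + X * X * 2 := by gcongr
      _ ≤ (12 * (1:ℕ) * X) ^ 2 * (1 / 4) := by push_cast; nlinarith
      _ ≤ _ := by gcongr

end CoefficientBounds

section PrimeWindow
open Complex Set MeasureTheory Filter Topology Asymptotics
open scoped ArithmeticFunction

/-- The density of the Gamma distribution with shape `j + 1` and rate `K`. -/
def gammaDens (K j : ℕ) (v : ℝ) : ℝ := (K:ℝ) ^ (j + 1) * v ^ j * Real.exp (-(K * v)) / j.factorial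

/-- Von Mangoldt weights localised by a Gamma density on the logarithmic scale. -/
def mangoldtWeight (K j n : ℕ) : ℝ := gammaDens K j (Real.log n) * Λ n / n

lemma gammaDens_nonneg (K j : ℕ) {v : ℝ} (hv : 0 ≤ v) : 0 ≤ gammaDens K j v := by
  unfold gammaDens; positivity

lemma mangoldtWeight_nonneg (K j n : ℕ) : 0 ≤ mangoldtWeight K j n := by
  unfold mangoldtWeight
  have := gammaDens_nonneg K j (Real.log_natCast_nonneg n)
  have := ArithmeticFunction.vonMangoldt_nonneg (n := n)
  positivity

lemma div_add_pow_le_exp {K : ℕ} (hK : 1 ≤ K) {x : ℝ} (hx : -(K / 2 : ℝ) ≤ x) (m : ℕ) :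
    ((K:ℝ) / (K + x)) ^ (K * m) ≤ Real.exp (-(x * m) + 2 * x ^ 2 * m / K) := by
  have hK' : (1:ℝ) ≤ K := by exact_mod_cast hK
  have h0 : 0 < (K:ℝ) + x := by linarith
  have h1 : (K:ℝ) / (K + x) ≤ Real.exp (-(x / K) + 2 * x ^ 2 / K ^ 2) := by
    have hle : Real.log ((K:ℝ) / (K + x)) ≤ (K:ℝ) / (K + x) - 1 :=
      Real.log_le_sub_one_of_pos (by positivity)
    rw [← Real.exp_log (show 0 < (K:ℝ) / (K + x) by positivity)]
    refine Real.exp_le_exp.2 (hle.trans ?_)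
    have h2 : 2 * x ^ 2 / (K:ℝ) ^ 2 - (x ^ 2 / (K * (K + x))) ≥ 0 := by
      rw [ge_iff_le, sub_nonneg, div_le_div_iff₀ (by positivity) (by positivity)]
      nlinarith [mul_nonneg (sq_nonneg x) (show (0:ℝ) ≤ K by linarith),
        mul_nonneg (mul_nonneg (sq_nonneg x) (show (0:ℝ) ≤ K by linarith))
          (show (0:ℝ) ≤ K + 2 * x by linarith)]
    have h3 : (K:ℝ) / (K + x) - 1 = -(x / K) + x ^ 2 / (K * (K + x)) := by
      field_simp; ring
    rw [h3]; linarith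
  calc ((K:ℝ) / (K + x)) ^ (K * m) ≤ Real.exp (-(x / K) + 2 * x ^ 2 / K ^ 2) ^ (K * m) := by
        gcongr
    _ = _ := by
        rw [← Real.exp_nat_mul]; congr 1; push_cast; field_simp

lemma gammaDens_le {K : ℕ} (hK : 1 ≤ K) {x : ℝ} (hx : -(K / 2 : ℝ) ≤ x) (m : ℕ) {v : ℝ}
    (hv : 0 ≤ v) :
    gammaDens K (K * m) v ≤ K * Real.exp (-(x * m) + 2 * x ^ 2 * m / K + x * v) := by
  have hK' : (1:ℝ) ≤ K := by exact_mod_cast hK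
  have h0 : 0 < (K:ℝ) + x := by linarith
  have h1 := Real.pow_div_factorial_le_exp ((K + x) * v) (by positivity) (K * m)
  have h2 := div_add_pow_le_exp hK hx m
  have e : gammaDens K (K * m) v = K * (((K:ℝ) / (K + x)) ^ (K * m) *
      (((K + x) * v) ^ (K * m) / (K * m).factorial) * Real.exp (-(K * v))) := by
    unfold gammaDens
    rw [mul_pow, div_pow, pow_succ]
    field_simp
  rw [e]
  refine mul_le_mul_of_nonneg_left ?_ (by positivity)
  calc _ ≤ Real.exp (-(x * m) + 2 * x ^ 2 * m / K) * Real.exp ((K + x) * v) * Real.exp (-(K * v)) := by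
        gcongr
    _ = _ := by rw [← Real.exp_add, ← Real.exp_add]; ring_nf

lemma gammaDens_le_self {K : ℕ} (hK : 1 ≤ K) (m : ℕ) {v : ℝ} (hv : 0 ≤ v) :
    gammaDens K (K * m) v ≤ K := by
  simpa using gammaDens_le hK (x := 0) (by simp; positivity) m hv

/-- The primes `p` with `a < log p ≤ b`. -/
def primeWindow (a b : ℝ) : Finset ℕ :=
  (Finset.range (⌊Real.exp b⌋₊ + 1)).filter fun p => p.Prime ∧ a < Real.log p ∧ Real.log p ≤ b

lemma mem_primeWindow {a b : ℝ} {p : ℕ} :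
    p ∈ primeWindow a b ↔ p.Prime ∧ a < Real.log p ∧ Real.log p ≤ b := by
  unfold primeWindow
  rw [Finset.mem_filter, Finset.mem_range, and_iff_right_iff_imp]
  rintro ⟨hp, -, hb⟩
  have : (p:ℝ) ≤ Real.exp b := by
    rw [← Real.exp_log (show (0:ℝ) < p by exact_mod_cast hp.pos)]
    exact Real.exp_le_exp.2 hb
  exact Nat.lt_succ_of_le (Nat.le_floor this)

lemma exp_mul_log_natCast {n : ℕ} (hn : n ≠ 0) (x : ℝ) : Real.exp (x * Real.log n) = (n:ℝ) ^ x := by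
  rw [Real.rpow_def_of_pos (by positivity), mul_comm]

lemma summable_vonMangoldt_div_sq : Summable fun n : ℕ => Λ n / (n:ℝ) ^ 2 := by
  have h := (ArithmeticFunction.LSeriesSummable_vonMangoldt (s := 2) (by simp)).norm
  refine h.congr fun n => ?_
  rw [LSeries.norm_term_eq]
  split_ifs with h0
  · simp [h0]
  · simp [abs_of_nonneg ArithmeticFunction.vonMangoldt_nonneg]

lemma eq_minFac_pow_of_isPrimePow {n : ℕ} (h : IsPrimePow n) (hn : ¬ n.Prime) :
    n = n.minFac ^ ((n.factorization n.minFac - 2) + 2) := by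
  have h1 := h.minFac_pow_factorization_eq
  have h2 : 2 ≤ n.factorization n.minFac := by
    by_contra hlt
    have hmp := Nat.minFac_prime h.ne_one
    have h01 : n.factorization n.minFac = 0 ∨ n.factorization n.minFac = 1 := by omega
    rcases h01 with h0 | h0
    · rw [h0, pow_zero] at h1; exact h.ne_one h1.symm
    · rw [h0, pow_one] at h1; rw [h1] at hmp; exact hn hmp
  rw [Nat.sub_add_cancel h2, h1]

lemma summable_log_mul_rpow_neg {x : ℝ} (hx : 1 / 2 < x) :
    Summable fun a : ℕ => Real.log a * (a:ℝ) ^ (-(2 * x)) := by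
  have hε : 0 < (2 * x - 1) / 2 := by linarith
  refine Summable.of_nonneg_of_le (fun a => ?_) (fun a => ?_)
    ((Real.summable_nat_rpow (p := -(2 * x) + (2 * x - 1) / 2)).2 (by linarith) |>.mul_left
      (1 / ((2 * x - 1) / 2)))
  · have := Real.log_natCast_nonneg a; positivity
  · rcases Nat.eq_zero_or_pos a with rfl | ha
    · rw [Nat.cast_zero, Real.log_zero, zero_mul]
      exact mul_nonneg (one_div_nonneg.2 hε.le) (by positivity)
    have ha' : (0:ℝ) < a := by exact_mod_cast ha
    rw [Real.rpow_add ha']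
    have := Real.log_le_rpow_div ha'.le hε
    calc _ ≤ (a:ℝ) ^ ((2 * x - 1) / 2) / ((2 * x - 1) / 2) * (a:ℝ) ^ (-(2 * x)) := by gcongr
      _ = _ := by ring

lemma vonMangoldt_mul_rpow_le_of_isPrimePow {x : ℝ} (hx : 1 / 2 < x) {n : ℕ} (h : IsPrimePow n)
    (hn : ¬ n.Prime) : Λ n * (n:ℝ) ^ (-x) ≤ Real.log n.minFac * (n.minFac:ℝ) ^ (-(2 * x)) *
      ((2:ℝ) ^ (-x)) ^ (n.factorization n.minFac - 2) := by
  have hp := Nat.minFac_prime h.ne_one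
  have h1 := ArithmeticFunction.vonMangoldt_apply (n := n)
  rw [if_pos h] at h1
  have hp0 : (0:ℝ) < n.minFac := by exact_mod_cast hp.pos
  have hp2 : (2:ℝ) ≤ n.minFac := by exact_mod_cast hp.two_le
  have hpow := eq_minFac_pow_of_isPrimePow h hn
  rw [h1]
  generalize n.factorization n.minFac - 2 = k at *
  generalize n.minFac = p at *
  have h2 : (n:ℝ) ^ (-x) = (p:ℝ) ^ (-(2 * x)) * ((p:ℝ) ^ (-x)) ^ k := by
    rw [hpow]
    push_cast
    rw [← Real.rpow_natCast _ (_ + 2), ← Real.rpow_natCast _ k, ← Real.rpow_mul hp0.le,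
      ← Real.rpow_mul hp0.le, ← Real.rpow_add hp0]
    congr 1; push_cast; ring
  rw [h2, mul_assoc]
  have hl : 0 ≤ Real.log (p:ℝ) := Real.log_natCast_nonneg _
  have h3 : (p:ℝ) ^ (-x) ≤ 2 ^ (-x) := Real.rpow_le_rpow_of_nonpos (by norm_num) hp2 (by linarith)
  exact mul_le_mul_of_nonneg_left (mul_le_mul_of_nonneg_left
    (pow_le_pow_left₀ (by positivity) h3 _) (by positivity)) hl

lemma summable_vonMangoldt_nonprime {x : ℝ} (hx : 1 / 2 < x) :
    Summable fun n : ℕ => (if n.Prime then 0 else Λ n) * (n:ℝ) ^ (-x) := by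
  have hgeo : Summable fun k : ℕ => ((2:ℝ) ^ (-x)) ^ k :=
    summable_geometric_of_lt_one (by positivity) (Real.rpow_lt_one_of_one_lt_of_neg (by norm_num)
      (by linarith))
  have hg := (summable_log_mul_rpow_neg hx).mul_of_nonneg hgeo
    (fun a => by have := Real.log_natCast_nonneg a; positivity) (fun k => by positivity)
  let ι : {n : ℕ // IsPrimePow n ∧ ¬ n.Prime} → ℕ × ℕ :=
    fun n => (n.1.minFac, n.1.factorization n.1.minFac - 2)
  have hinj : Function.Injective ι := by
    rintro ⟨a, ha⟩ ⟨b, hb⟩ hab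
    have hab : a.minFac = b.minFac ∧ a.factorization a.minFac - 2 =
        b.factorization b.minFac - 2 := by simpa only [ι, Prod.mk.injEq] using hab
    apply Subtype.ext
    calc a = _ := eq_minFac_pow_of_isPrimePow ha.1 ha.2
      _ = _ := by rw [hab.2, hab.1]
      _ = b := (eq_minFac_pow_of_isPrimePow hb.1 hb.2).symm
  have hsub : Summable ((fun n : ℕ => Λ n * (n:ℝ) ^ (-x)) ∘
      ((↑) : {n : ℕ | IsPrimePow n ∧ ¬ n.Prime} → ℕ)) := by
    refine Summable.of_nonneg_of_le (fun n => ?_) (fun n => ?_) (hg.comp_injective hinj)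
    · have := ArithmeticFunction.vonMangoldt_nonneg (n := n.1)
      exact mul_nonneg this (by positivity)
    · exact vonMangoldt_mul_rpow_le_of_isPrimePow hx n.2.1 n.2.2
  have hind := summable_subtype_iff_indicator.1 hsub
  refine hind.congr fun n => ?_
  by_cases hn : n ∈ {n : ℕ | IsPrimePow n ∧ ¬ n.Prime}
  · rw [indicator_of_mem hn, if_neg hn.2]
  · rw [indicator_of_notMem hn]
    split_ifs with h
    · simp
    · have : ¬ IsPrimePow n := fun h' => hn ⟨h', h⟩
      rw [ArithmeticFunction.vonMangoldt_apply, if_neg this, zero_mul]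

end PrimeWindow

section PrimeWindowSums
open Complex Set MeasureTheory Filter Topology Asymptotics
open scoped ArithmeticFunction

lemma exp_mul_log_vonMangoldt_div {n : ℕ} (hn : n ≠ 0) (x : ℝ) :
    Real.exp (x * Real.log n) * Λ n / n = Λ n * (n:ℝ) ^ (x - 1) := by
  rw [exp_mul_log_natCast hn, Real.rpow_sub_one (by positivity)]; ring

lemma mangoldtWeight_le_of_le {K m n : ℕ} {C x : ℝ} (hn : n ≠ 0)
    (h : gammaDens K (K * m) (Real.log n) ≤ C * Real.exp (x * Real.log n)) :
    mangoldtWeight K (K * m) n ≤ C * (Λ n * (n:ℝ) ^ (x - 1)) := by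
  rw [mangoldtWeight, ← exp_mul_log_vonMangoldt_div hn]
  have := ArithmeticFunction.vonMangoldt_nonneg (n := n)
  calc _ ≤ C * Real.exp (x * Real.log n) * Λ n / n := by gcongr
    _ = _ := by ring

lemma mangoldtWeight_le_outside {K m n : ℕ} {η : ℝ} (hη : 0 < η) (hη1 : η ≤ 1)
    (hK : 64 / η ^ 2 ≤ K) (hn : n ≠ 0)
    (hout : Real.log n ≤ (1 - η) * m ∨ (1 + η) * m ≤ Real.log n) :
    mangoldtWeight K (K * m) n ≤ K * Real.exp (-m) * (Λ n / (n:ℝ) ^ 2) := by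
  have hη2 : η ^ 2 ≤ 1 := by nlinarith
  have h64 : (64:ℝ) ≤ K := by
    refine le_trans ?_ hK
    rw [le_div_iff₀ (by positivity)]; linarith
  have hK1 : 1 ≤ K := by
    have : (1:ℝ) ≤ K := by linarith
    exact_mod_cast this
  have hv := Real.log_natCast_nonneg n
  have hKpos : (0:ℝ) < K := by linarith
  set τ := 4 / η with hτ
  have hτη : τ * η = 4 := by rw [hτ]; field_simp
  have hτ4 : 4 ≤ τ := by rw [hτ, le_div_iff₀ hη]; linarith
  have hτ2 : τ ^ 2 * 4 ≤ K := by
    refine le_trans (le_of_eq ?_) hK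
    rw [hτ]; field_simp; norm_num
  have hm : (0:ℝ) ≤ m := by positivity
  have hq : 2 * τ ^ 2 * m / K ≤ m / 2 := by
    rw [div_le_iff₀ hKpos]; nlinarith
  have key : gammaDens K (K * m) (Real.log n) ≤ K * Real.exp (-m) * Real.exp (-1 * Real.log n) := by
    rw [mul_assoc, ← Real.exp_add]
    rcases hout with h | h
    · refine (gammaDens_le hK1 (x := τ) (by linarith) m hv).trans ?_
      refine mul_le_mul_of_nonneg_left (Real.exp_le_exp.2 ?_) hKpos.le
      have e : (τ + 1) * ((1 - η) * m) = (τ + 1 - 4 - η) * m := by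
        linear_combination (-m : ℝ) * hτη
      have := mul_le_mul_of_nonneg_left h (show 0 ≤ τ + 1 by linarith)
      have := mul_nonneg hη.le hm
      nlinarith
    · refine (gammaDens_le hK1 (x := -τ) (by nlinarith) m hv).trans ?_
      refine mul_le_mul_of_nonneg_left (Real.exp_le_exp.2 ?_) hKpos.le
      rw [neg_sq]
      have e : (τ - 1) * ((1 + η) * m) = (τ - 1 + 4 - η) * m := by
        linear_combination (m : ℝ) * hτη
      have := mul_le_mul_of_nonneg_left h (show 0 ≤ τ - 1 by linarith)
      have := mul_le_mul_of_nonneg_right hη1 hm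
      nlinarith
  have := mangoldtWeight_le_of_le hn key
  rw [show (-1 - 1 : ℝ) = -((2:ℕ):ℝ) by norm_num, Real.rpow_neg (by positivity),
    Real.rpow_natCast, ← div_eq_mul_inv] at this
  exact this

lemma mangoldtWeight_le_half {K m n : ℕ} {ε : ℝ} (hε : 0 < ε) (hε1 : ε ≤ 1 / 2)
    (hK1 : 1 ≤ K) (hK : 1 / (2 * ε) ≤ K) (hn : n ≠ 0) :
    mangoldtWeight K (K * m) n ≤
      K * Real.exp (-(1 / 2 - 2 * ε) * m) * (Λ n * (n:ℝ) ^ (-(1 / 2 + ε))) := by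
  have hv := Real.log_natCast_nonneg n
  have hKpos : (0:ℝ) < K := by exact_mod_cast hK1
  have hm : (0:ℝ) ≤ m := by positivity
  have hε' : 1 ≤ K * (2 * ε) := by rwa [div_le_iff₀ (by positivity)] at hK
  have hq : 2 * (1 / 2 - ε) ^ 2 * m / K ≤ ε * m := by
    rw [div_le_iff₀ hKpos]
    have : 2 * (1 / 2 - ε) ^ 2 ≤ 1 / 2 := by nlinarith
    nlinarith [mul_le_mul_of_nonneg_right this hm, mul_le_mul_of_nonneg_right hε' hm]
  have key : gammaDens K (K * m) (Real.log n) ≤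
      K * Real.exp (-(1 / 2 - 2 * ε) * m) * Real.exp ((1 / 2 - ε) * Real.log n) := by
    rw [mul_assoc, ← Real.exp_add]
    refine (gammaDens_le hK1 (x := 1 / 2 - ε) (by linarith) m hv).trans ?_
    gcongr
    nlinarith
  have := mangoldtWeight_le_of_le hn key
  rwa [show (1 / 2 - ε - 1 : ℝ) = -(1 / 2 + ε) by ring] at this

lemma log_of_mem_primeWindow_compl {K m n : ℕ} {ε η : ℝ} (hη : 0 < η) (hη1 : η ≤ 1)
    (hε : 0 < ε) (hε1 : ε ≤ 1 / 2) (hK : 64 / η ^ 2 ≤ K) (hKε : 1 / (2 * ε) ≤ K)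
    (hn : n ∉ primeWindow ((1 - η) * m) ((1 + η) * m)) :
    mangoldtWeight K (K * m) n ≤ K * Real.exp (-(1 / 2 - 2 * ε) * m) *
      (Λ n / (n:ℝ) ^ 2 + (if n.Prime then 0 else Λ n) * (n:ℝ) ^ (-(1 / 2 + ε))) := by
  have hL := ArithmeticFunction.vonMangoldt_nonneg (n := n)
  rcases eq_or_ne n 0 with rfl | hn0
  · simp [mangoldtWeight]
  have hη2 : η ^ 2 ≤ 1 := by nlinarith
  have hK1 : 1 ≤ K := by
    have : (64:ℝ) ≤ K := by
      refine le_trans ?_ hK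
      rw [le_div_iff₀ (by positivity)]; linarith
    have : (1:ℝ) ≤ K := by linarith
    exact_mod_cast this
  rw [mul_add]
  by_cases hp : n.Prime
  · rw [if_pos hp, zero_mul, mul_zero, add_zero]
    have hout : Real.log n ≤ (1 - η) * m ∨ (1 + η) * m ≤ Real.log n := by
      by_contra hc
      push Not at hc
      exact hn (mem_primeWindow.2 ⟨hp, hc.1, hc.2.le⟩)
    refine (mangoldtWeight_le_outside hη hη1 hK hn0 hout).trans ?_
    gcongr
    nlinarith [show (0:ℝ) ≤ m by positivity]
  · rw [if_neg hp]
    refine (mangoldtWeight_le_half hε hε1 hK1 hKε hn0).trans ?_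
    refine le_add_of_nonneg_left (by positivity)

lemma LSeries_term_eq_mangoldtWeight (K j : ℕ) (f : ℕ → ℂ) (t : ℝ) (n : ℕ) :
    (((K:ℝ) ^ (j + 1) / j.factorial : ℝ) : ℂ) *
      LSeries.term (fun n : ℕ => (Complex.log n) ^ j * (f n * (Λ n : ℂ))) ((1 + K : ℝ) + t * I) n =
      mangoldtWeight K j n * f n * (n:ℂ) ^ (-(t * I)) := by
  rcases eq_or_ne n 0 with rfl | hn
  · simp [mangoldtWeight]
  have hn' : (n:ℂ) ≠ 0 := by exact_mod_cast hn
  have hnpos : (0:ℝ) < n := by positivity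
  rw [LSeries.term_of_ne_zero hn, div_eq_mul_inv _ ((n:ℂ) ^ _), ← cpow_neg, mangoldtWeight,
    gammaDens]
  have e1 : (n:ℂ) ^ (-((1 + K : ℝ) + t * I)) =
      ((Real.exp (-(K * Real.log n)) / n : ℝ) : ℂ) * (n:ℂ) ^ (-(t * I)) := by
    rw [show (-((1 + K : ℝ) + t * I) : ℂ) = ((-(K:ℝ) - 1 : ℝ) : ℂ) + (-(t * I)) by push_cast; ring,
      cpow_add _ _ hn']
    congr 1
    rw [← ofReal_natCast, ← ofReal_cpow hnpos.le, Real.rpow_sub_one hnpos.ne',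
      Real.rpow_def_of_pos hnpos]
    congr 4; ring
  rw [e1, ← natCast_log]
  push_cast
  ring

lemma exists_tail_bound {ε η : ℝ} (hη : 0 < η) (hη1 : η ≤ 1) (hε : 0 < ε) (hε1 : ε ≤ 1 / 2) :
    ∃ C, 0 < C ∧ ∀ K : ℕ, 64 / η ^ 2 ≤ K → 1 / (2 * ε) ≤ K → ∀ (m : ℕ) (f : ℕ → ℂ) (t : ℝ),
      (∀ n, ‖f n‖ ≤ 1) →
      ‖∑ p ∈ primeWindow ((1 - η) * m) ((1 + η) * m),
          mangoldtWeight K (K * m) p * f p * (p:ℂ) ^ (-(t * I)) -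
        (((K:ℝ) ^ (K * m + 1) / (K * m).factorial : ℝ) : ℂ) *
        LSeries (fun n : ℕ => (Complex.log n) ^ (K * m) * (f n * (Λ n : ℂ))) ((1 + K : ℝ) + t * I)‖ ≤
        C * K * Real.exp (-(1 / 2 - 2 * ε) * m) := by
  set b : ℕ → ℝ := fun n =>
    Λ n / (n:ℝ) ^ 2 + (if n.Prime then 0 else Λ n) * (n:ℝ) ^ (-(1 / 2 + ε)) with hb
  have hbs : Summable b :=
    summable_vonMangoldt_div_sq.add (summable_vonMangoldt_nonprime (by linarith))
  have hb0 : ∀ n, 0 ≤ b n := fun n => by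
    have hL := ArithmeticFunction.vonMangoldt_nonneg (n := n)
    have : 0 ≤ (if n.Prime then 0 else Λ n) := by split_ifs <;> simp [hL]
    rw [hb]; positivity
  refine ⟨∑' n, b n + 1, by have : 0 ≤ ∑' n, b n := tsum_nonneg hb0; linarith, ?_⟩
  intro K hK hKε m f t hf
  set P := primeWindow ((1 - η) * m) ((1 + η) * m)
  set g : ℕ → ℂ := fun n => mangoldtWeight K (K * m) n * f n * (n:ℂ) ^ (-(t * I)) with hg
  have hgn : ∀ n, ‖g n‖ ≤ mangoldtWeight K (K * m) n := by
    intro n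
    rw [hg]
    simp only [norm_mul, norm_real, Real.norm_of_nonneg (mangoldtWeight_nonneg _ _ _)]
    rcases eq_or_ne n 0 with rfl | hn
    · simp [mangoldtWeight]
    · rw [← ofReal_natCast, norm_cpow_eq_rpow_re_of_pos (by positivity)]
      have := hf n
      have h0 := mangoldtWeight_nonneg K (K * m) n
      simp
      nlinarith [norm_nonneg (f n)]
  have hgP : ∀ n, n ∉ P → ‖g n‖ ≤ K * Real.exp (-(1 / 2 - 2 * ε) * m) * b n := fun n hn =>
    (hgn n).trans (log_of_mem_primeWindow_compl hη hη1 hε hε1 hK hKε hn)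
  set c : ℝ := K * Real.exp (-(1 / 2 - 2 * ε) * m)
  have hc0 : 0 ≤ c := by positivity
  have hgs : Summable g := by
    refine Summable.of_norm_bounded_eventually (hbs.mul_left c) ?_
    filter_upwards [P.finite_toSet.compl_mem_cofinite] with n hn using hgP n (by simpa using hn)
  have e : (((K:ℝ) ^ (K * m + 1) / (K * m).factorial : ℝ) : ℂ) *
        LSeries (fun n : ℕ => (Complex.log n) ^ (K * m) * (f n * (Λ n : ℂ))) ((1 + K : ℝ) + t * I) =
        ∑' n, g n := by
    rw [LSeries, ← tsum_mul_left]
    exact tsum_congr fun n => LSeries_term_eq_mangoldtWeight _ _ _ _ _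
  rw [e, ← hgs.sum_add_tsum_compl (s := P), norm_sub_rev, add_sub_cancel_left]
  have hbs' : Summable fun n : ((P : Set ℕ)ᶜ : Set ℕ) => c * b n :=
    ((hbs.mul_left c).comp_injective Subtype.val_injective)
  refine (tsum_of_norm_bounded hbs'.hasSum fun n => hgP n.1 fun h => n.2 (Finset.mem_coe.2 h)).trans ?_
  rw [tsum_mul_left]
  have h1 : ∑' n : ((P : Set ℕ)ᶜ : Set ℕ), b n ≤ ∑' n, b n :=
    hbs.tsum_subtype_le _ _ hb0
  calc c * _ ≤ c * ∑' n, b n := by gcongr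
    _ ≤ (∑' n, b n + 1) * c := by nlinarith
    _ = _ := by ring

end PrimeWindowSums

section PrimeWindowCancellation
open Complex Set MeasureTheory Filter Topology Asymptotics
open scoped ArithmeticFunction

lemma one_le_growthLog {K q : ℕ} {t : ℝ} (hq : 1 ≤ q) : 1 ≤ growthLog K q t := by
  have hq' : (1:ℝ) ≤ q := by exact_mod_cast hq
  have h0 : 0 ≤ |t| := abs_nonneg t
  have hK : (0:ℝ) ≤ K := by positivity
  have h1 : Real.exp 1 ≤ 12 * q * (2 * K + 3 + |t|) := by
    have := Real.exp_one_lt_d9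
    nlinarith
  have := Real.log_le_log (Real.exp_pos 1) h1
  rw [Real.log_exp] at this
  unfold growthLog; linarith

lemma weighted_bound_le {K m : ℕ} {ε gl : ℝ} (hK1 : 1 ≤ K) (hε : 0 < ε) (hε1 : ε ≤ 1 / 4)
    (hK : 1 / (2 * ε) ≤ K) (hgl : 0 ≤ gl) :
    (K:ℝ) ^ (K * m + 1) / (K * m).factorial * ((K * m + 1).factorial *
      (2 * gl * (K + 1 / 2 - ε) / ε) / (K + 1 / 2 - ε) ^ (K * m + 1)) ≤
    Real.exp (-(1 / 2 - 2 * ε) * m) * (2 * (K * m + 1) * (K + 1) / ε * gl) := by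
  have hK' : (1:ℝ) ≤ K := by exact_mod_cast hK1
  have hm : (0:ℝ) ≤ m := by positivity
  set x : ℝ := 1 / 2 - ε with hx
  have hr : (K:ℝ) + 1 / 2 - ε = K + x := by rw [hx]; ring
  have hx0 : 0 < x := by rw [hx]; linarith
  rw [hr]
  have e : (K:ℝ) ^ (K * m + 1) / (K * m).factorial * ((K * m + 1).factorial *
      (2 * gl * (K + x) / ε) / (K + x) ^ (K * m + 1)) =
      ((K:ℝ) / (K + x)) ^ (K * m) * (2 * (K * m + 1) * K / ε * gl) := by
    rw [Nat.factorial_succ, pow_succ, pow_succ, div_pow]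
    push_cast
    field_simp
  rw [e]
  have h1 := div_add_pow_le_exp hK1 (x := x) (by linarith) m
  have hε' : 1 ≤ K * (2 * ε) := by rwa [div_le_iff₀ (by positivity)] at hK
  have hq : 2 * x ^ 2 * m / K ≤ ε * m := by
    rw [div_le_iff₀ (by positivity)]
    have : 2 * x ^ 2 ≤ 1 / 2 := by rw [hx]; nlinarith
    nlinarith [mul_le_mul_of_nonneg_right this hm, mul_le_mul_of_nonneg_right hε' hm]
  have h2 : ((K:ℝ) / (K + x)) ^ (K * m) ≤ Real.exp (-(1 / 2 - 2 * ε) * m) := by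
    refine h1.trans (Real.exp_le_exp.2 ?_)
    rw [hx] at hq ⊢; nlinarith
  gcongr
  linarith

lemma eventually_error_le {ε A B : ℝ} (hε : 0 < ε) :
    ∀ᶠ m : ℕ in atTop, A * m + B ≤ Real.exp (ε * m) := by
  have h : (fun m : ℝ => A * m + B) =o[atTop] fun m : ℝ => Real.exp (ε * m) := by
    refine IsLittleO.add ?_ ?_
    · have := (isLittleO_pow_exp_pos_mul_atTop 1 hε).const_mul_left A
      simpa using this
    · refine isLittleO_const_left.2 (Or.inr ?_)
      refine tendsto_norm_atTop_atTop.comp (Real.tendsto_exp_atTop.comp ?_)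
      exact tendsto_id.const_mul_atTop hε
  have := (h.comp_tendsto tendsto_natCast_atTop_atTop).bound one_pos
  filter_upwards [this] with m hm
  simp only [Function.comp, one_mul, Real.norm_eq_abs, abs_of_pos (Real.exp_pos _)] at hm
  exact (le_abs_self _).trans hm

/-- Under GRH, the prime sums twisted by characters have square root cancellation. -/
theorem exists_primeWindow_bounds (hGRH : GRH) {ε η : ℝ} (hε : 0 < ε) (hε1 : ε ≤ 1 / 8)
    (hη : 0 < η) (hη1 : η ≤ 1) :
    ∃ K₀ : ℕ, ∀ K : ℕ, K₀ ≤ K → ∀ᶠ m : ℕ in atTop,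
      |∑ p ∈ primeWindow ((1 - η) * m) ((1 + η) * m), mangoldtWeight K (K * m) p - 1| ≤ 1 / 2 ∧
      (∀ (q : ℕ) [NeZero q] (χ : DirichletCharacter ℂ q), χ ≠ 1 → ∀ t : ℝ,
        ‖∑ p ∈ primeWindow ((1 - η) * m) ((1 + η) * m),
          (mangoldtWeight K (K * m) p : ℂ) * χ p * (p:ℂ) ^ (-(t * I))‖ ≤
          Real.exp (-(1 / 2 - 3 * ε) * m) * growthLog K q t) ∧
      (∀ t : ℝ, (K:ℝ) + 1 ≤ |t| → ‖∑ p ∈ primeWindow ((1 - η) * m) ((1 + η) * m),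
          (mangoldtWeight K (K * m) p : ℂ) * (p:ℂ) ^ (-(t * I))‖ ≤
          Real.exp (-(1 / 2 - 3 * ε) * m) * growthLog K 1 t) := by
  obtain ⟨C, hC, htail⟩ := exists_tail_bound hη hη1 hε (by linarith : ε ≤ 1 / 2)
  refine ⟨max 4 (max ⌈64 / η ^ 2⌉₊ ⌈1 / (2 * ε)⌉₊), fun K hK => ?_⟩
  have hK4 : 4 ≤ K := (le_max_left _ _).trans hK
  have hKη : 64 / η ^ 2 ≤ K :=
    (Nat.le_ceil _).trans (by exact_mod_cast ((le_max_left _ _).trans (le_max_right _ _)).trans hK)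
  have hKε : 1 / (2 * ε) ≤ K :=
    (Nat.le_ceil _).trans (by exact_mod_cast ((le_max_right _ _).trans (le_max_right _ _)).trans hK)
  have hK1 : 1 ≤ K := by omega
  have hKr : (4:ℝ) ≤ K := by exact_mod_cast hK4
  set X : ℕ → ℝ := fun m => Real.exp (-(1 / 2 - 2 * ε) * m) with hX
  have hX0 : ∀ m, 0 ≤ X m := fun m => (Real.exp_pos _).le
  set D : ℕ → ℝ := fun m => C * K + 2 * (K * m + 1) * (K + 1) / ε + 1 with hD
  set W : ℕ → ℝ := fun m => (K:ℝ) ^ (K * m + 1) / (K * m).factorial with hW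
  have hW0 : ∀ m, 0 ≤ W m := fun m => by rw [hW]; positivity
  have hDev : ∀ᶠ m : ℕ in atTop, D m ≤ Real.exp (ε * m) := by
    filter_upwards [eventually_error_le (A := 2 * K * (K + 1) / ε)
      (B := C * K + 2 * (K + 1) / ε + 1) hε] with m hm
    refine le_trans (le_of_eq ?_) hm
    rw [hD]; ring
  have hXD : ∀ m, D m ≤ Real.exp (ε * m) → X m * D m ≤ Real.exp (-(1 / 2 - 3 * ε) * m) := by
    intro m hm
    calc X m * D m ≤ X m * Real.exp (ε * m) := mul_le_mul_of_nonneg_left hm (hX0 m)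
      _ = _ := by rw [hX, ← Real.exp_add]; ring_nf
  have htriv : ∀ (m : ℕ) (t : ℝ), ‖∑ p ∈ primeWindow ((1 - η) * m) ((1 + η) * m),
          (mangoldtWeight K (K * m) p : ℂ) * (p:ℂ) ^ (-(t * I)) -
          ((K:ℂ) / (K + t * I)) ^ (K * m + 1)‖ ≤ X m * (D m - 1) * growthLog K 1 t := by
    intro m t
    have h1 := htail K hKη hKε m (fun _ => 1) t (by simp)
    have h2 := norm_LSeries_logPow_sub_le hGRH hK1 t hε (by linarith) (K * m)
    have h3 := weighted_bound_le (m := m) hK1 hε (by linarith) hKε (gl := growthLog K 1 t)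
      (growthLog_pos le_rfl).le
    simp only [mul_one, one_mul] at h1
    set L := LSeries (fun n : ℕ => (Complex.log n) ^ (K * m) * (Λ n : ℂ)) ((1 + K : ℝ) + t * I)
    have e : ((K:ℂ) / (K + t * I)) ^ (K * m + 1) =
        (W m : ℂ) * ((K * m).factorial / (K + t * I) ^ (K * m + 1)) := by
      have : ((K * m).factorial : ℂ) ≠ 0 := by exact_mod_cast Nat.factorial_ne_zero _
      rw [hW, div_pow]; push_cast; field_simp
    have e2 : ‖(W m : ℂ) * (L - (K * m).factorial / (K + t * I) ^ (K * m + 1))‖ ≤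
        X m * (2 * (K * m + 1) * (K + 1) / ε * growthLog K 1 t) := by
      rw [norm_mul, norm_real, Real.norm_of_nonneg (hW0 m)]
      exact (mul_le_mul_of_nonneg_left h2 (hW0 m)).trans h3
    rw [e]
    have h4 := norm_add_le _ _ |>.trans (add_le_add h1 e2)
    have hg := one_le_growthLog (K := K) (t := t) (le_refl 1)
    calc _ = _ := by congr 1; ring
      _ ≤ _ := h4
      _ ≤ X m * (C * K * growthLog K 1 t) +
          X m * (2 * (K * m + 1) * (K + 1) / ε * growthLog K 1 t) := by
          refine add_le_add_left ?_ _
          rw [mul_comm]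
          exact mul_le_mul_of_nonneg_left (le_mul_of_one_le_right (by positivity) hg) (hX0 m)
      _ = _ := by rw [hD]; ring
  have hexp : ∀ᶠ m : ℕ in atTop, 2 * growthLog K 1 0 ≤ Real.exp ((1 / 8) * m) := by
    filter_upwards [eventually_error_le (A := 0) (B := 2 * growthLog K 1 0)
      (show (0:ℝ) < 1 / 8 by norm_num)] with m hm
    simpa using hm
  filter_upwards [hDev, hexp] with m hm hm2
  have hD1 : X m * (D m - 1) ≤ Real.exp (-(1 / 2 - 3 * ε) * m) := by
    refine le_trans ?_ (hXD m hm)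
    exact mul_le_mul_of_nonneg_left (by linarith) (hX0 m)
  refine ⟨?_, ?_, ?_⟩
  · have h := (htriv m 0).trans (mul_le_mul_of_nonneg_right hD1 (growthLog_pos le_rfl).le)
    have hK0 : (K:ℂ) ≠ 0 := by exact_mod_cast (by omega : K ≠ 0)
    simp only [ofReal_zero, zero_mul, neg_zero, cpow_zero, mul_one, add_zero, div_self hK0,
      one_pow] at h
    rw [← ofReal_sum, ← ofReal_one, ← ofReal_sub, norm_real, Real.norm_eq_abs] at h
    refine h.trans ?_
    have h5 : Real.exp (-(1 / 2 - 3 * ε) * m) * Real.exp ((1 / 8) * m) ≤ 1 := by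
      rw [← Real.exp_add, Real.exp_le_one_iff]
      nlinarith [show (0:ℝ) ≤ m by positivity]
    nlinarith [Real.exp_pos (-(1 / 2 - 3 * ε) * m)]
  · intro q _ χ hχ t
    have hq : 1 ≤ q := NeZero.one_le
    have hg := one_le_growthLog (K := K) (t := t) hq
    have h1 := htail K hKη hKε m (fun n => χ n) t fun n => DirichletCharacter.norm_le_one χ n
    have h2 := norm_LSeries_twist_logPow_le hGRH hK1 hχ t hε (by linarith) (K * m)
    have h3 := weighted_bound_le (m := m) hK1 hε (by linarith) hKε (gl := growthLog K q t)
      (growthLog_pos hq).le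
    set L := LSeries (fun n : ℕ => (Complex.log n) ^ (K * m) * (χ n * (Λ n : ℂ)))
      ((1 + K : ℝ) + t * I)
    have e2 : ‖(W m : ℂ) * L‖ ≤
        X m * (2 * (K * m + 1) * (K + 1) / ε * growthLog K q t) := by
      rw [norm_mul, norm_real, Real.norm_of_nonneg (hW0 m)]
      exact (mul_le_mul_of_nonneg_left h2 (hW0 m)).trans h3
    have h4 := norm_add_le _ _ |>.trans (add_le_add h1 e2)
    rw [sub_add_cancel] at h4
    refine h4.trans ?_
    refine le_trans ?_ (mul_le_mul_of_nonneg_right (hXD m hm) (growthLog_pos hq).le)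
    calc _ ≤ X m * (C * K * growthLog K q t) +
          X m * (2 * (K * m + 1) * (K + 1) / ε * growthLog K q t) := by
          refine add_le_add_left ?_ _
          rw [mul_comm]
          exact mul_le_mul_of_nonneg_left (le_mul_of_one_le_right (by positivity) hg) (hX0 m)
      _ = X m * (D m - 1) * growthLog K q t := by rw [hD]; ring
      _ ≤ _ := by
        refine mul_le_mul_of_nonneg_right ?_ (growthLog_pos hq).le
        exact mul_le_mul_of_nonneg_left (by linarith) (hX0 m)
  · intro t ht
    have hg := one_le_growthLog (K := K) (t := t) (le_refl 1)
    have hmain : ‖((K:ℂ) / (K + t * I)) ^ (K * m + 1)‖ ≤ X m := by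
      rw [norm_pow, norm_div, norm_natCast]
      have h2 : (2:ℝ) * K ^ 2 ≤ ‖(K:ℂ) + t * I‖ ^ 2 := by
        rw [← normSq_eq_norm_sq, normSq_apply]
        simp
        nlinarith [sq_abs t, abs_nonneg t]
      set r := ‖(K:ℂ) + t * I‖
      have hr0 : 0 ≤ r := norm_nonneg _
      have hrK : (K:ℝ) ≤ r := by nlinarith
      have hr : 0 < r := by linarith
      have hle : (K:ℝ) / r ≤ 1 := (div_le_one hr).2 hrK
      have hq0 : 0 ≤ (K:ℝ) / r := by positivity
      have hsq : ((K:ℝ) / r) ^ 2 ≤ Real.exp (-(1/4)) := by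
        have : ((K:ℝ) / r) ^ 2 ≤ 1 / 2 := by
          rw [div_pow, div_le_div_iff₀ (by positivity) (by norm_num)]; linarith
        have := Real.add_one_le_exp (-(1/4):ℝ)
        linarith
      calc ((K:ℝ) / r) ^ (K * m + 1) ≤ ((K:ℝ) / r) ^ (2 * (2 * m)) := by
            refine pow_le_pow_of_le_one hq0 hle ?_
            nlinarith [Nat.mul_le_mul_right m hK4]
        _ = (((K:ℝ) / r) ^ 2) ^ (2 * m) := by rw [pow_mul]
        _ ≤ Real.exp (-(1/4)) ^ (2 * m) := by gcongr
        _ ≤ X m := by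
            rw [← Real.exp_nat_mul]
            refine Real.exp_le_exp.2 ?_
            push_cast
            nlinarith [show (0:ℝ) ≤ m by positivity]
    have h4 := norm_add_le _ _ |>.trans (add_le_add (htriv m t) hmain)
    rw [sub_add_cancel] at h4
    refine h4.trans (le_trans ?_ (mul_le_mul_of_nonneg_right (hXD m hm) (growthLog_pos le_rfl).le))
    nlinarith [mul_le_mul_of_nonneg_left hg (hX0 m)]

end PrimeWindowCancellation

section WindowFourier
open Complex Set MeasureTheory Filter Topology

lemma summable_inv_sq_add_sq_nat {M : ℝ} (hM : 1 ≤ M) :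
    Summable (fun n : ℕ => 1 / (M ^ 2 + (n:ℝ) ^ 2)) ∧
      ∑' n : ℕ, 1 / (M ^ 2 + (n:ℝ) ^ 2) ≤ 4 / M := by
  have key : ∀ n : ℕ, 1 / (M ^ 2 + (n:ℝ) ^ 2) ≤ 4 * (1 / (M + n) - 1 / (M + (n + 1 : ℕ))) := by
    intro n
    have hn : (0:ℝ) ≤ n := by positivity
    have e : 4 * (1 / (M + n) - 1 / (M + (n + 1 : ℕ))) = 4 / ((M + n) * (M + n + 1)) := by
      push_cast; field_simp; ring
    rw [e, div_le_div_iff₀ (by positivity) (by positivity)]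
    nlinarith [sq_nonneg (M - n), mul_nonneg hn hn]
  have hs : ∀ N : ℕ, ∑ n ∈ Finset.range N, 1 / (M ^ 2 + (n:ℝ) ^ 2) ≤ 4 / M := by
    intro N
    refine (Finset.sum_le_sum fun n _ => key n).trans ?_
    rw [← Finset.mul_sum, Finset.sum_range_sub' (fun n : ℕ => 1 / (M + (n:ℝ)))]
    have : 0 ≤ 1 / (M + (N:ℝ)) := by positivity
    simp only [Nat.cast_zero, add_zero]
    have e : 4 / M = 4 * (1 / M) := by ring
    linarith
  exact ⟨summable_of_sum_range_le (fun n => by positivity) hs,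
    Real.tsum_le_of_sum_range_le (fun n => by positivity) hs⟩

lemma summable_inv_sq_add_sq {M : ℝ} (hM : 1 ≤ M) :
    Summable (fun l : ℤ => 1 / (M ^ 2 + (l:ℝ) ^ 2)) ∧
      ∑' l : ℤ, 1 / (M ^ 2 + (l:ℝ) ^ 2) ≤ 8 / M := by
  obtain ⟨h1, h2⟩ := summable_inv_sq_add_sq_nat hM
  set f : ℤ → ℝ := fun l : ℤ => 1 / (M ^ 2 + (l:ℝ) ^ 2) with hf
  have hs1 : Summable (fun n : ℕ => f n) := by simpa [hf] using h1
  have hle : ∀ n : ℕ, f (-((n:ℤ) + 1)) ≤ f n := fun n => by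
    simp only [hf]
    push_cast
    gcongr 1 / ?_
    nlinarith [show (0:ℝ) ≤ n by positivity]
  have hs2 : Summable (fun n : ℕ => f (-((n:ℤ) + 1))) :=
    Summable.of_nonneg_of_le (fun n => by simp only [hf]; positivity) hle hs1
  have hS := HasSum.of_nat_of_neg_add_one hs1.hasSum hs2.hasSum
  refine ⟨hS.summable, ?_⟩
  have e1 : ∑' n : ℕ, f n ≤ 4 / M := by simpa [hf] using h2
  have e2 : ∑' n : ℕ, f (-((n:ℤ) + 1)) ≤ 4 / M := (hs2.tsum_le_tsum hle hs1).trans e1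
  have e : 8 / M = 4 / M + 4 / M := by ring
  rw [hS.tsum_eq]
  linarith

lemma two_mul_le_weighted {x w r : ℝ} (hw : 0 < w) (hr : 0 < r) :
    x ≤ 1 / 2 * (r * (w * x ^ 2) + 1 / (r * w)) := by
  have h : 0 ≤ (r * w * x - 1) ^ 2 / (r * w) := by positivity
  have e : (r * w * x - 1) ^ 2 / (r * w) = r * (w * x ^ 2) + 1 / (r * w) - 2 * x := by
    field_simp
    ring
  linarith

lemma summable_of_sq_bounds {c : ℤ → ℂ} {P Q : ℝ} (hP : HasSum (fun l => ‖c l‖ ^ 2) P)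
    (hQ : HasSum (fun l : ℤ => (l:ℝ) ^ 2 * ‖c l‖ ^ 2) Q) {M r : ℝ} (hM : 1 ≤ M) (hr : 0 < r) :
    Summable (fun l => ‖c l‖) ∧
      ∑' l, ‖c l‖ ≤ 1 / 2 * (r * (M ^ 2 * P + Q) + 8 / (r * M)) := by
  obtain ⟨h1, h2⟩ := summable_inv_sq_add_sq hM
  have hle : ∀ l : ℤ, ‖c l‖ ≤ 1 / 2 * (r * (M ^ 2 * ‖c l‖ ^ 2 + (l:ℝ) ^ 2 * ‖c l‖ ^ 2) +
      1 / r * (1 / (M ^ 2 + (l:ℝ) ^ 2))) := by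
    intro l
    have := two_mul_le_weighted (x := ‖c l‖) (w := M ^ 2 + (l:ℝ) ^ 2) (r := r)
      (by positivity) hr
    refine this.trans (le_of_eq ?_)
    field_simp
  have hS := ((((hP.mul_left (M ^ 2)).add hQ).mul_left r).add
    (h1.hasSum.mul_left (1 / r))).mul_left (1 / 2)
  have hs : Summable (fun l => ‖c l‖) :=
    Summable.of_nonneg_of_le (fun l => norm_nonneg _) hle hS.summable
  refine ⟨hs, ((hs.tsum_le_tsum hle hS.summable).trans (le_of_eq hS.tsum_eq)).trans ?_⟩
  have : 1 / r * ∑' l : ℤ, 1 / (M ^ 2 + (l:ℝ) ^ 2) ≤ 8 / (r * M) := by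
    calc _ ≤ 1 / r * (8 / M) := by gcongr
      _ = _ := by field_simp
  linarith

lemma tsum_tail_le_of_sq_bound {c : ℤ → ℂ} {Q : ℝ} (hc : Summable fun l => ‖c l‖)
    (hQ : HasSum (fun l : ℤ => (l:ℝ) ^ 2 * ‖c l‖ ^ 2) Q) {M r : ℝ} (hM : 1 ≤ M) (hr : 0 < r) :
    ∑' l : ℤ, (if M < |(l:ℝ)| then ‖c l‖ else 0) ≤ 1 / 2 * (r * Q + 16 / (r * M)) := by
  obtain ⟨h1, h2⟩ := summable_inv_sq_add_sq hM
  have hle : ∀ l : ℤ, (if M < |(l:ℝ)| then ‖c l‖ else 0) ≤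
      1 / 2 * (r * ((l:ℝ) ^ 2 * ‖c l‖ ^ 2) + 2 / r * (1 / (M ^ 2 + (l:ℝ) ^ 2))) := by
    intro l
    split_ifs with h
    · have hl : M ^ 2 ≤ (l:ℝ) ^ 2 := by
        rw [← sq_abs (l:ℝ)]; gcongr
      have hl0 : 0 < (l:ℝ) ^ 2 := by nlinarith
      refine (two_mul_le_weighted (x := ‖c l‖) (w := (l:ℝ) ^ 2) (r := r) hl0 hr).trans ?_
      gcongr 1 / 2 * (_ + ?_)
      rw [div_mul_div_comm, div_le_div_iff₀ (by positivity) (by positivity)]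
      nlinarith
    · positivity
  have hS := ((hQ.mul_left r).add (h1.hasSum.mul_left (2 / r))).mul_left (1 / 2)
  have hs : Summable (fun l : ℤ => (if M < |(l:ℝ)| then ‖c l‖ else 0)) := by
    refine Summable.of_nonneg_of_le (fun l => ?_) (fun l => ?_) hc
    · split_ifs <;> positivity
    · split_ifs
      · exact le_rfl
      · positivity
  refine ((hs.tsum_le_tsum hle hS.summable).trans (le_of_eq hS.tsum_eq)).trans ?_
  have : 2 / r * ∑' l : ℤ, 1 / (M ^ 2 + (l:ℝ) ^ 2) ≤ 16 / (r * M) := by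
    calc _ ≤ 2 / r * (8 / M) := by gcongr
      _ = _ := by field_simp; norm_num
  linarith

/-- A smooth bump supported in `[0, 1]` whose half-integer translates add up to one. -/
def bump (x : ℝ) : ℝ := Real.sin (Real.pi * max 0 (min 1 x)) ^ 2

/-- The derivative of `bump`. -/
def bumpDeriv (x : ℝ) : ℝ := Real.pi * Real.sin (2 * Real.pi * max 0 (min 1 x))

lemma continuous_bump : Continuous bump := by unfold bump; fun_prop

lemma continuous_bumpDeriv : Continuous bumpDeriv := by unfold bumpDeriv; fun_prop

lemma bump_nonneg (x : ℝ) : 0 ≤ bump x := by unfold bump; positivity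

lemma bump_le_one (x : ℝ) : bump x ≤ 1 := by unfold bump; exact Real.sin_sq_le_one _

lemma bump_of_nonpos {x : ℝ} (hx : x ≤ 0) : bump x = 0 := by
  unfold bump; rw [max_eq_left ((min_le_right _ _).trans hx)]; simp

lemma bump_of_one_le {x : ℝ} (hx : 1 ≤ x) : bump x = 0 := by
  unfold bump; rw [min_eq_left hx]; simp

lemma bumpDeriv_of_nonpos {x : ℝ} (hx : x ≤ 0) : bumpDeriv x = 0 := by
  unfold bumpDeriv; rw [max_eq_left ((min_le_right _ _).trans hx)]; simp

lemma bumpDeriv_of_one_le {x : ℝ} (hx : 1 ≤ x) : bumpDeriv x = 0 := by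
  unfold bumpDeriv; rw [min_eq_left hx]; simp

lemma bump_of_mem {x : ℝ} (h0 : 0 ≤ x) (h1 : x ≤ 1) : bump x = Real.sin (Real.pi * x) ^ 2 := by
  unfold bump; rw [min_eq_right h1, max_eq_right h0]

lemma bump_add_bump {x : ℝ} (h0 : 0 ≤ x) (h1 : x ≤ 1 / 2) : bump x + bump (x + 1 / 2) = 1 := by
  rw [bump_of_mem h0 (by linarith), bump_of_mem (by linarith) (by linarith),
    show Real.pi * (x + 1 / 2) = Real.pi * x + Real.pi / 2 by ring, Real.sin_add_pi_div_two]
  exact Real.sin_sq_add_cos_sq _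

lemma abs_bumpDeriv_le (x : ℝ) : |bumpDeriv x| ≤ Real.pi := by
  unfold bumpDeriv
  rw [abs_mul, abs_of_pos Real.pi_pos]
  have := Real.abs_sin_le_one (2 * Real.pi * max 0 (min 1 x))
  nlinarith [Real.pi_pos]

lemma hasDerivWithinAt_bump (x : ℝ) : HasDerivWithinAt bump (bumpDeriv x) (Ioi x) x := by
  rcases lt_or_ge x 0 with h | h0
  · rw [bumpDeriv_of_nonpos h.le]
    refine ((hasDerivAt_const x (0:ℝ)).congr_of_eventuallyEq ?_).hasDerivWithinAt
    filter_upwards [gt_mem_nhds h] with y hy using bump_of_nonpos hy.le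
  rcases lt_or_ge x 1 with h1 | h1
  · have hd : HasDerivAt (fun y => Real.sin (Real.pi * y) ^ 2) (bumpDeriv x) x := by
      have := ((((hasDerivAt_id x).const_mul Real.pi).sin).pow 2)
      have e : bumpDeriv x = 2 * Real.sin (Real.pi * x) ^ (2 - 1) *
          (Real.cos (Real.pi * x) * (Real.pi * 1)) := by
        unfold bumpDeriv
        rw [min_eq_right h1.le, max_eq_right h0, mul_assoc 2, Real.sin_two_mul]
        ring
      rw [e]
      exact_mod_cast this
    refine hd.hasDerivWithinAt.congr_of_eventuallyEq ?_ (bump_of_mem h0 h1.le)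
    have : Iio 1 ∈ 𝓝[>] x := mem_nhdsWithin_of_mem_nhds (Iio_mem_nhds h1)
    filter_upwards [this, self_mem_nhdsWithin] with y hy hy2
    exact bump_of_mem (h0.trans (le_of_lt hy2)) (le_of_lt hy)
  · rw [bumpDeriv_of_one_le h1]
    refine (hasDerivWithinAt_const x (Ioi x) (0:ℝ)).congr_of_eventuallyEq ?_ (bump_of_one_le h1)
    filter_upwards [self_mem_nhdsWithin] with y hy using bump_of_one_le (h1.trans (le_of_lt hy))

end WindowFourier

section WindowFourierSeries
open Complex Set MeasureTheory Filter Topology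

/-- The smooth cutoff to `[a, a + 1]` of the oscillating function `v ↦ e(γ eᵛ)`. -/
def windowPhase (a γ v : ℝ) : ℂ :=
  (bump (v - a) : ℂ) * cexp (((2 * Real.pi * γ * Real.exp v : ℝ) : ℂ) * I)

/-- The derivative of `windowPhase a γ`. -/
def windowPhaseDeriv (a γ v : ℝ) : ℂ :=
  ((bumpDeriv (v - a) : ℂ) + (bump (v - a) : ℂ) * (((2 * Real.pi * γ * Real.exp v : ℝ) : ℂ) * I)) *
    cexp (((2 * Real.pi * γ * Real.exp v : ℝ) : ℂ) * I)

lemma continuous_windowPhase (a γ : ℝ) : Continuous (windowPhase a γ) := by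
  have := continuous_bump
  unfold windowPhase; fun_prop

lemma continuous_windowPhaseDeriv (a γ : ℝ) : Continuous (windowPhaseDeriv a γ) := by
  have := continuous_bump
  have := continuous_bumpDeriv
  unfold windowPhaseDeriv; fun_prop

lemma hasDerivWithinAt_windowPhase (a γ v : ℝ) :
    HasDerivWithinAt (windowPhase a γ) (windowPhaseDeriv a γ v) (Ioi v) v := by
  have h1 : HasDerivWithinAt (fun v => bump (v - a)) (bumpDeriv (v - a)) (Ioi v) v := by
    have := (hasDerivWithinAt_bump (v - a)).scomp v ((hasDerivWithinAt_id v (Ioi v)).sub_const a)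
      (fun y hy => sub_lt_sub_right hy a)
    simpa [Function.comp_def] using this
  have h2 : HasDerivAt (fun v => cexp (((2 * Real.pi * γ * Real.exp v : ℝ) : ℂ) * I))
      (cexp (((2 * Real.pi * γ * Real.exp v : ℝ) : ℂ) * I) *
        (((2 * Real.pi * γ * Real.exp v : ℝ) : ℂ) * I)) v := by
    have := (((Real.hasDerivAt_exp v).const_mul (2 * Real.pi * γ)).ofReal_comp.mul_const I).cexp
    simpa using this
  refine ((h1.ofReal_comp).mul h2.hasDerivWithinAt).congr_deriv ?_
  unfold windowPhaseDeriv; ring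

lemma norm_windowPhase (a γ v : ℝ) : ‖windowPhase a γ v‖ = bump (v - a) := by
  unfold windowPhase
  rw [norm_mul, norm_exp_ofReal_mul_I, norm_real, Real.norm_of_nonneg (bump_nonneg _), mul_one]

lemma windowPhase_eq_zero {a γ v : ℝ} (hv : v ≤ a ∨ a + 1 ≤ v) : windowPhase a γ v = 0 := by
  unfold windowPhase
  rcases hv with h | h
  · rw [bump_of_nonpos (by linarith)]; simp
  · rw [bump_of_one_le (by linarith)]; simp

lemma windowPhaseDeriv_eq_zero {a γ v : ℝ} (hv : v ≤ a ∨ a + 1 ≤ v) :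
    windowPhaseDeriv a γ v = 0 := by
  unfold windowPhaseDeriv
  rcases hv with h | h
  · rw [bump_of_nonpos (by linarith), bumpDeriv_of_nonpos (by linarith)]; simp
  · rw [bump_of_one_le (by linarith), bumpDeriv_of_one_le (by linarith)]; simp

lemma norm_windowPhaseDeriv_le (a γ v : ℝ) :
    ‖windowPhaseDeriv a γ v‖ ≤ 20 * (1 + |γ| * Real.exp a) := by
  have hT : 0 ≤ |γ| * Real.exp a := by positivity
  by_cases hv : v ≤ a ∨ a + 1 ≤ v
  · rw [windowPhaseDeriv_eq_zero hv, norm_zero]; positivity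
  push Not at hv
  unfold windowPhaseDeriv
  rw [norm_mul, norm_exp_ofReal_mul_I, mul_one]
  refine (norm_add_le _ _).trans ?_
  rw [norm_mul, norm_mul, norm_I, norm_real, norm_real, norm_real, mul_one, Real.norm_eq_abs,
    Real.norm_eq_abs, Real.norm_eq_abs, abs_of_nonneg (bump_nonneg _), abs_mul, abs_mul, abs_mul,
    Real.abs_exp, abs_of_pos Real.pi_pos, abs_two]
  have h1 := abs_bumpDeriv_le (v - a)
  have h2 := bump_le_one (v - a)
  have h3 : Real.exp v ≤ 2.72 * Real.exp a := by
    have : Real.exp v ≤ Real.exp (1 + a) := Real.exp_le_exp.2 (by linarith)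
    rw [Real.exp_add] at this
    have h4 := Real.exp_one_lt_d9
    nlinarith [Real.exp_pos a]
  have hpi := Real.pi_lt_d2
  have hpi0 := Real.pi_pos
  have h5 : |γ| * Real.exp v ≤ 2.72 * (|γ| * Real.exp a) := by nlinarith [abs_nonneg γ]
  have h6 : 2 * Real.pi * |γ| * Real.exp v ≤ 2 * 3.15 * (2.72 * (|γ| * Real.exp a)) := by
    have : 0 ≤ |γ| * Real.exp v := by positivity
    nlinarith
  have h7 : bump (v - a) * (2 * Real.pi * |γ| * Real.exp v) ≤ 2 * Real.pi * |γ| * Real.exp v :=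
    mul_le_of_le_one_left (by positivity) h2
  linarith

lemma intervalIntegral_eq_of_window {E : Type*} [NormedAddCommGroup E] [NormedSpace ℝ E]
    {f : ℝ → E} {a A D : ℝ} (hA : A ≤ a) (hD : a + 1 ≤ A + D)
    (hf : ∀ v, v ≤ a ∨ a + 1 ≤ v → f v = 0) :
    ∫ v in A..(A + D), f v = ∫ v in a..(a + 1), f v := by
  have h : ∀ v, f v ≠ 0 → a < v ∧ v < a + 1 := fun v hv => by
    by_contra hc
    refine hv (hf v ?_)
    by_contra h2
    push Not at h2
    exact hc h2
  rw [intervalIntegral.integral_eq_integral_of_support_subset,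
    intervalIntegral.integral_eq_integral_of_support_subset]
  · intro v hv
    exact ⟨(h v hv).1, (h v hv).2.le⟩
  · intro v hv
    exact ⟨hA.trans_lt (h v hv).1, (h v hv).2.le.trans hD⟩

lemma hasSum_sq_of_window {f : ℝ → ℂ} (hfc : Continuous f) {a A D B : ℝ} (hD0 : 0 < D) (hA : A ≤ a)
    (hD : a + 1 ≤ A + D) (hf : ∀ v, v ≤ a ∨ a + 1 ≤ v → f v = 0) (hB : ∀ v, ‖f v‖ ≤ B) :
    ∃ P, P ≤ B ^ 2 / D ∧
      HasSum (fun l => ‖fourierCoeffOn (lt_add_of_pos_right A hD0) f l‖ ^ 2) P := by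
  refine ⟨_, ?_, hasSum_sq_fourierCoeffOn _ ?_⟩
  · rw [add_sub_cancel_left, intervalIntegral_eq_of_window hA hD (fun v hv => by simp [hf v hv]),
      smul_eq_mul, div_eq_inv_mul]
    gcongr
    have h : ∫ v in a..(a + 1), ‖f v‖ ^ 2 ≤ ∫ v in a..(a + 1), B ^ 2 := by
      refine intervalIntegral.integral_mono_on (by linarith)
        ((hfc.norm.pow 2).intervalIntegrable _ _) (by simp) fun v _ => ?_
      have := hB v
      gcongr
    simpa using h
  · exact MemLp.of_bound hfc.aestronglyMeasurable B (ae_of_all _ hB)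

lemma norm_fourierCoeffOn_windowPhase_le {a A D γ : ℝ} (hD0 : 0 < D) (hA : A ≤ a)
    (hD : a + 1 ≤ A + D) (l : ℤ) :
    D * ‖fourierCoeffOn (lt_add_of_pos_right A hD0) (windowPhase a γ) l‖ *
      (1 + |γ| * Real.exp a) ≤ 2 + |2 * Real.pi * l / D| := by
  set τ : ℝ := 2 * Real.pi * l / D with hτ
  have e : D * ‖fourierCoeffOn (lt_add_of_pos_right A hD0) (windowPhase a γ) l‖ =
      ‖∫ v in a..(a + 1), cexp (((-(τ * v) : ℝ) : ℂ) * I) * windowPhase a γ v‖ := by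
    rw [fourierCoeffOn_eq_integral, add_sub_cancel_left,
      intervalIntegral_eq_of_window hA hD (fun v hv => by simp [windowPhase_eq_zero hv]),
      norm_smul, Real.norm_of_nonneg (by positivity), ← mul_assoc, mul_one_div_cancel hD0.ne',
      one_mul]
    congr 1
    refine intervalIntegral.integral_congr fun v _ => ?_
    simp only [smul_eq_mul, fourier_coe_apply]
    congr 2
    rw [hτ]; push_cast; field_simp
  rw [e, mul_add, mul_one]
  have h1 : ‖∫ v in a..(a + 1), cexp (((-(τ * v) : ℝ) : ℂ) * I) * windowPhase a γ v‖ ≤ 1 := by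
    have := intervalIntegral.norm_integral_le_of_norm_le_const (a := a) (b := a + 1) (C := 1)
      (f := fun v => cexp (((-(τ * v) : ℝ) : ℂ) * I) * windowPhase a γ v) fun v _ => by
        rw [norm_mul, norm_exp_ofReal_mul_I, norm_windowPhase, one_mul]
        exact bump_le_one _
    simpa using this
  suffices h2 : ‖∫ v in a..(a + 1), cexp (((-(τ * v) : ℝ) : ℂ) * I) * windowPhase a γ v‖ *
      (|γ| * Real.exp a) ≤ 1 + |τ| by linarith
  rcases eq_or_ne γ 0 with rfl | hγ
  · simp; positivity
  set w : ℂ := 2 * Real.pi * γ * I with hw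
  have hw0 : w ≠ 0 := by
    rw [hw]; simp [hγ, Real.pi_ne_zero]
  set S : ℝ → ℂ := fun v => (Real.sin (Real.pi * (v - a)) ^ 2 : ℝ) with hS
  set R : ℝ → ℂ := fun v => cexp ((-(τ * I) - 1) * v) with hR
  set X : ℝ → ℂ := fun v => cexp (((2 * Real.pi * γ * Real.exp v : ℝ) : ℂ) * I) with hX
  set S' : ℝ → ℂ := fun v => (Real.pi * Real.sin (2 * (Real.pi * (v - a))) : ℝ) with hS'
  have dS : ∀ v, HasDerivAt S (S' v) v := fun v => by
    have h := (((((hasDerivAt_id v).sub_const a).const_mul Real.pi).sin).pow 2).ofReal_comp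
    refine h.congr_deriv ?_
    rw [hS']
    simp only [Real.sin_two_mul, id]
    push_cast
    ring
  have dR : ∀ v : ℝ, HasDerivAt R ((-(τ * I) - 1) * R v) v := fun v => by
    have h := ((hasDerivAt_id v).ofReal_comp.const_mul (-(τ * I) - 1 : ℂ)).cexp
    refine h.congr_deriv ?_
    simp [hR]; ring
  have dX : ∀ v : ℝ, HasDerivAt X (X v * (w * Real.exp v)) v := fun v => by
    have := (((Real.hasDerivAt_exp v).const_mul (2 * Real.pi * γ)).ofReal_comp.mul_const I).cexp
    refine this.congr_deriv ?_
    simp only [hX, hw]; push_cast; ring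
  have dU : ∀ v : ℝ, HasDerivAt (fun v => S v * R v * X v)
      ((S' v + S v * (-(τ * I) - 1)) * R v * X v +
        w * (cexp (((-(τ * v) : ℝ) : ℂ) * I) * (S v * X v))) v := by
    intro v
    refine (((dS v).mul (dR v)).mul (dX v)).congr_deriv ?_
    have : R v * Real.exp v = cexp (((-(τ * v) : ℝ) : ℂ) * I) := by
      simp only [hR]
      rw [ofReal_exp, ← Complex.exp_add]
      congr 1; push_cast; ring
    rw [← this]; simp only [Pi.mul_apply]; ring
  have cS : Continuous S := by fun_prop
  have cS' : Continuous S' := by fun_prop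
  have cR : Continuous R := by fun_prop
  have cX : Continuous X := by fun_prop
  have hfi := intervalIntegral.integral_eq_sub_of_hasDerivAt (a := a) (b := a + 1)
    (fun v _ => dU v) (Continuous.intervalIntegrable (by fun_prop) _ _)
  have z0 : S a = 0 := by simp [hS]
  have z1 : S (a + 1) = 0 := by simp [hS]
  rw [z0, z1, intervalIntegral.integral_add (Continuous.intervalIntegrable (by fun_prop) _ _)
    (Continuous.intervalIntegrable (by fun_prop) _ _), intervalIntegral.integral_const_mul] at hfi
  have hwin : ∫ v in a..(a + 1), cexp (((-(τ * v) : ℝ) : ℂ) * I) * windowPhase a γ v =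
      ∫ v in a..(a + 1), cexp (((-(τ * v) : ℝ) : ℂ) * I) * (S v * X v) := by
    refine intervalIntegral.integral_congr fun v hv => ?_
    rw [uIcc_of_le (by linarith)] at hv
    simp only [windowPhase, hS, hX]
    rw [bump_of_mem (by linarith [hv.1]) (by linarith [hv.2])]
  rw [← hwin] at hfi
  set J := ∫ v in a..(a + 1), cexp (((-(τ * v) : ℝ) : ℂ) * I) * windowPhase a γ v
  have hJ : w * J = -∫ v in a..(a + 1), (S' v + S v * (-(τ * I) - 1)) * R v * X v := by
    linear_combination hfi
  have hpi := Real.pi_gt_three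
  have hb : ‖∫ v in a..(a + 1), (S' v + S v * (-(τ * I) - 1)) * R v * X v‖ ≤
      (Real.pi + (|τ| + 1)) * Real.exp (-a) := by
    have := intervalIntegral.norm_integral_le_of_norm_le_const (a := a) (b := a + 1)
      (C := (Real.pi + (|τ| + 1)) * Real.exp (-a))
      (f := fun v => (S' v + S v * (-(τ * I) - 1)) * R v * X v) fun v hv => by
        rw [uIoc_of_le (by linarith)] at hv
        have n1 : ‖S' v‖ ≤ Real.pi := by
          simp only [hS', norm_real, norm_mul, Real.norm_eq_abs, abs_of_pos Real.pi_pos]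
          exact mul_le_of_le_one_right Real.pi_pos.le (Real.abs_sin_le_one _)
        have n2 : ‖S v‖ ≤ 1 := by
          simp only [hS, norm_real, Real.norm_of_nonneg (sq_nonneg (Real.sin (Real.pi * (v - a))))]
          exact Real.sin_sq_le_one _
        have n3 : ‖(-(τ * I) - 1 : ℂ)‖ ≤ |τ| + 1 := by
          refine (norm_sub_le _ _).trans ?_
          simp
        have n4 : ‖R v‖ ≤ Real.exp (-a) := by
          simp only [hR, Complex.norm_exp]
          refine Real.exp_le_exp.2 ?_
          simp; linarith [hv.1]
        have n5 : ‖X v‖ = 1 := norm_exp_ofReal_mul_I _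
        rw [norm_mul, norm_mul, n5, mul_one]
        refine mul_le_mul ?_ n4 (norm_nonneg _) (by positivity)
        refine (norm_add_le _ _).trans (add_le_add n1 ?_)
        rw [norm_mul]
        calc _ ≤ 1 * (|τ| + 1) := mul_le_mul n2 n3 (norm_nonneg _) zero_le_one
          _ = _ := one_mul _
    simpa using this
  have hnw : ‖w‖ = 2 * Real.pi * |γ| := by
    rw [hw]; simp [abs_of_pos Real.pi_pos]
  have hfin : 2 * Real.pi * |γ| * ‖J‖ ≤ (Real.pi + (|τ| + 1)) * Real.exp (-a) := by
    rw [← hnw, ← norm_mul, hJ, norm_neg]; exact hb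
  have h3 := mul_le_mul_of_nonneg_right hfin (Real.exp_pos a).le
  rw [mul_assoc _ (Real.exp (-a)), ← Real.exp_add, neg_add_cancel, Real.exp_zero, mul_one] at h3
  have h4 : 0 ≤ ‖J‖ * (|γ| * Real.exp a) := by positivity
  have h5 : 2 * Real.pi * (‖J‖ * (|γ| * Real.exp a)) ≤ Real.pi + (|τ| + 1) := by
    refine le_trans (le_of_eq ?_) h3; ring
  nlinarith [abs_nonneg τ, Real.pi_pos]

end WindowFourierSeries

section WindowFourierExpansion
open Complex Set MeasureTheory Filter Topology

lemma sum_low_frequencies_le {c : ℤ → ℂ} {D T τ : ℝ} (hD1 : 1 ≤ D) (hT : 0 ≤ T) (hτ : 1 ≤ τ)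
    (hc : ∀ l : ℤ, D * ‖c l‖ * (1 + T) ≤ 2 + |2 * Real.pi * l / D|) :
    ∑' l : ℤ, (if |2 * Real.pi * l / D| < τ then ‖c l‖ else 0) ≤ 6 * τ ^ 2 / (1 + T) := by
  have hD0 : 0 < D := by linarith
  have hpi := Real.pi_gt_three
  set N : ℕ := ⌊τ * D / 6⌋₊ with hN
  have hNle : (N:ℝ) ≤ τ * D / 6 := Nat.floor_le (by positivity)
  have hmem : ∀ l : ℤ, |2 * Real.pi * l / D| < τ → l ∈ Finset.Icc (-(N:ℤ)) N := by
    intro l hl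
    rw [abs_div, abs_mul, abs_of_pos hD0, abs_of_pos (by positivity : 0 < 2 * Real.pi),
      div_lt_iff₀ hD0] at hl
    have h1 : |(l:ℝ)| ≤ τ * D / 6 := by nlinarith [abs_nonneg (l:ℝ)]
    have h2 : l.natAbs ≤ N := Nat.le_floor (by rwa [Nat.cast_natAbs, Int.cast_abs])
    rw [Finset.mem_Icc]; omega
  rw [tsum_eq_sum (s := Finset.Icc (-(N:ℤ)) N) fun l hl => by
    rw [if_neg fun h => hl (hmem l h)]]
  have hb : ∀ l ∈ Finset.Icc (-(N:ℤ)) N,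
      (if |2 * Real.pi * l / D| < τ then ‖c l‖ else 0) ≤ (2 + τ) / (D * (1 + T)) := by
    intro l _
    split_ifs with h
    · rw [le_div_iff₀ (by positivity)]
      have := hc l
      nlinarith
    · positivity
  refine (Finset.sum_le_card_nsmul _ _ _ hb).trans ?_
  rw [Int.card_Icc, nsmul_eq_mul, show ((N:ℤ) + 1 - -(N:ℤ)).toNat = 2 * N + 1 by omega]
  rw [mul_div_assoc', div_le_div_iff₀ (by positivity) (by positivity)]
  have h3 : (((2 * N + 1 : ℕ)) : ℝ) ≤ 2 * (τ * D) := by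
    push_cast; nlinarith
  have h4 : 2 + τ ≤ 3 * τ := by linarith
  calc (((2 * N + 1 : ℕ)) : ℝ) * (2 + τ) * (1 + T) ≤ 2 * (τ * D) * (3 * τ) * (1 + T) := by gcongr
    _ = _ := by ring

/-- Fourier expansion of the windowed oscillation `windowPhase a γ`, with control of the total
mass of the coefficients, of the high frequencies, and of the low frequencies. -/
theorem exists_windowPhase_expansion {a A D γ : ℝ} (hD1 : 1 ≤ D) (hA : A ≤ a)
    (hD : a + 1 ≤ A + D) :
    ∃ c : ℤ → ℂ, Summable (fun l => ‖c l‖) ∧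
      (∀ v, A ≤ v → v < A + D → HasSum (fun l : ℤ =>
        c l * cexp (((2 * Real.pi * l / D * v : ℝ) : ℂ) * I)) (windowPhase a γ v)) ∧
      ∑' l, ‖c l‖ ≤ 11 * √(1 + |γ| * Real.exp a) ∧
      (∀ M : ℝ, 1 ≤ M → ∑' l : ℤ, (if M < |(l:ℝ)| then ‖c l‖ else 0) ≤
        14 * D * (1 + |γ| * Real.exp a) / √M) ∧
      (∀ τ : ℝ, 1 ≤ τ → ∑' l : ℤ, (if |2 * Real.pi * l / D| < τ then ‖c l‖ else 0) ≤
        6 * τ ^ 2 / (1 + |γ| * Real.exp a)) := by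
  have hD0 : 0 < D := by linarith
  have hT : 0 ≤ |γ| * Real.exp a := by positivity
  set T := |γ| * Real.exp a with hTd
  have hab := lt_add_of_pos_right A hD0
  set c : ℤ → ℂ := fourierCoeffOn hab (windowPhase a γ) with hc
  set d : ℤ → ℂ := fourierCoeffOn hab (windowPhaseDeriv a γ) with hd
  obtain ⟨P, hP, hPs⟩ := hasSum_sq_of_window (continuous_windowPhase a γ) hD0 hA hD
    (fun v hv => windowPhase_eq_zero hv) (B := 1)
    (fun v => by rw [norm_windowPhase]; exact bump_le_one _)
  obtain ⟨P', hP', hPs'⟩ := hasSum_sq_of_window (continuous_windowPhaseDeriv a γ) hD0 hA hD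
    (fun v hv => windowPhaseDeriv_eq_zero hv) (norm_windowPhaseDeriv_le a γ)
  have hpi := Real.pi_gt_three
  have hrel : ∀ l : ℤ, (l:ℝ) ^ 2 * ‖c l‖ ^ 2 ≤ D ^ 2 / 36 * ‖d l‖ ^ 2 := by
    intro l
    rcases eq_or_ne l 0 with rfl | hl
    · simp; positivity
    have h := fourierCoeffOn_of_hasDeriv_right hab (f := windowPhase a γ)
      (f' := windowPhaseDeriv a γ) hl (continuous_windowPhase a γ).continuousOn
      (fun x _ => hasDerivWithinAt_windowPhase a γ x)
      ((continuous_windowPhaseDeriv a γ).intervalIntegrable _ _)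
    rw [windowPhase_eq_zero (Or.inl hA), windowPhase_eq_zero (Or.inr hD)] at h
    have hl' : (l:ℂ) ≠ 0 := by exact_mod_cast hl
    have h1 : (2 * Real.pi * I * l) * c l = D * d l := by
      rw [hc, h]
      push_cast
      have hpi' : (Real.pi:ℂ) ≠ 0 := by exact_mod_cast Real.pi_ne_zero
      have hI := I_ne_zero
      rw [hd]
      field_simp
      ring
    have h2 : 2 * Real.pi * |(l:ℝ)| * ‖c l‖ = D * ‖d l‖ := by
      have := congrArg norm h1
      simpa [abs_of_pos Real.pi_pos, abs_of_pos hD0] using this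
    have h3 : 6 * (|(l:ℝ)| * ‖c l‖) ≤ D * ‖d l‖ := by
      rw [← h2]
      have : 0 ≤ |(l:ℝ)| * ‖c l‖ := by positivity
      nlinarith
    have h4 : (6 * (|(l:ℝ)| * ‖c l‖)) ^ 2 ≤ (D * ‖d l‖) ^ 2 := by gcongr
    rw [mul_pow, mul_pow, mul_pow, sq_abs] at h4
    linarith
  have hQs : Summable fun l : ℤ => (l:ℝ) ^ 2 * ‖c l‖ ^ 2 :=
    Summable.of_nonneg_of_le (fun l => by positivity) hrel (hPs'.summable.mul_left _)
  have hQ : ∑' l : ℤ, (l:ℝ) ^ 2 * ‖c l‖ ^ 2 ≤ 12 * D * (1 + T) ^ 2 := by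
    refine (hQs.tsum_le_tsum hrel (hPs'.summable.mul_left _)).trans ?_
    rw [tsum_mul_left, hPs'.tsum_eq]
    calc D ^ 2 / 36 * P' ≤ D ^ 2 / 36 * ((20 * (1 + T)) ^ 2 / D) := by gcongr
      _ = (400 / 36) * (D * (1 + T) ^ 2) := by field_simp; ring
      _ ≤ _ := by nlinarith [show 0 ≤ D * (1 + T) ^ 2 by positivity]
  set s := √(1 + T) with hs
  have hs2 : s ^ 2 = 1 + T := Real.sq_sqrt (by positivity)
  have hs1 : 1 ≤ s := by rw [hs]; exact Real.one_le_sqrt.2 (by linarith)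
  obtain ⟨hcs, hcsum⟩ := summable_of_sq_bounds hPs hQs.hasSum (M := D * s ^ 2)
    (r := 1 / (D * s ^ 3)) (by nlinarith [mul_le_mul hD1 (one_le_pow₀ (n := 2) hs1) zero_le_one hD0.le])
    (by positivity)
  refine ⟨c, hcs, ?_, ?_, ?_, ?_⟩
  · intro v hv hv'
    have : Fact (0 < D) := ⟨hD0⟩
    have hcont : Continuous (AddCircle.liftIco D A (windowPhase a γ)) := by
      refine AddCircle.liftIco_continuous ?_ (continuous_windowPhase a γ).continuousOn
      rw [windowPhase_eq_zero (Or.inl hA), windowPhase_eq_zero (Or.inr hD)]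
    have hcoe : fourierCoeff (AddCircle.liftIco D A (windowPhase a γ)) = c := by
      funext n
      rw [fourierCoeff_liftIco_eq, hc]
    have h := has_pointwise_sum_fourier_series_of_summable
      (f := (⟨_, hcont⟩ : C(AddCircle D, ℂ))) (by
        rw [ContinuousMap.coe_mk, hcoe]; exact hcs.of_norm) (v : AddCircle D)
    rw [ContinuousMap.coe_mk, hcoe, AddCircle.liftIco_coe_apply ⟨hv, hv'⟩] at h
    convert h using 2 with l
    rw [smul_eq_mul, fourier_coe_apply]
    congr 2
    push_cast; ring
  · refine hcsum.trans ?_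
    have e : 1 / 2 * (1 / (D * s ^ 3) * ((D * s ^ 2) ^ 2 * (1 ^ 2 / D) + 12 * D * (1 + T) ^ 2) +
        8 / (1 / (D * s ^ 3) * (D * s ^ 2))) = 21 / 2 * s := by
      rw [← hs2]; field_simp; ring
    have : 1 / 2 * (1 / (D * s ^ 3) * ((D * s ^ 2) ^ 2 * P + ∑' l : ℤ, (l:ℝ) ^ 2 * ‖c l‖ ^ 2) +
        8 / (1 / (D * s ^ 3) * (D * s ^ 2))) ≤ 21 / 2 * s := by
      rw [← e]; gcongr
    linarith
  · intro M hM
    have hM0 : 0 < √M := Real.sqrt_pos.2 (by linarith)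
    have h := tsum_tail_le_of_sq_bound hcs hQs.hasSum hM (r := 1 / (D * (1 + T) * √M))
      (by positivity)
    refine h.trans ?_
    have e : 1 / 2 * (1 / (D * (1 + T) * √M) * (12 * D * (1 + T) ^ 2) +
        16 / (1 / (D * (1 + T) * √M) * M)) = 6 * (1 + T) / √M + 8 * D * (1 + T) / √M := by
      have hMM : M = √M * √M := (Real.mul_self_sqrt (by linarith)).symm
      generalize √M = z at *
      subst hMM
      field_simp
      ring
    calc _ ≤ 1 / 2 * (1 / (D * (1 + T) * √M) * (12 * D * (1 + T) ^ 2) +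
        16 / (1 / (D * (1 + T) * √M) * M)) := by gcongr
      _ = _ := e
      _ ≤ 6 * D * (1 + T) / √M + 8 * D * (1 + T) / √M := by
        gcongr; linarith
      _ = _ := by ring
  · intro τ hτ
    exact sum_low_frequencies_le hD1 hT hτ fun l => norm_fourierCoeffOn_windowPhase_le hD0 hA hD l

end WindowFourierExpansion

section AdditiveCharacters
open Complex Finset
open scoped ArithmeticFunction ArithmeticFunction.Moebius

lemma sum_primitiveRoots_eq_moebius {q : ℕ} (hq : 0 < q) :
    ∑ ζ ∈ primitiveRoots q ℂ, ζ = (ArithmeticFunction.moebius q : ℂ) := by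
  have h : ∀ n > 0, ∑ i ∈ n.divisors, ∑ ζ ∈ primitiveRoots i ℂ, ζ = if n = 1 then (1:ℂ) else 0 := by
    intro n hn
    have : NeZero n := ⟨hn.ne'⟩
    have hprim := Complex.isPrimitiveRoot_exp n hn.ne'
    rw [← Finset.sum_biUnion]
    · rw [← IsPrimitiveRoot.nthRoots_one_eq_biUnion_primitiveRoots]
      have : Polynomial.nthRootsFinset n (1:ℂ) =
          (range n).image fun i => cexp (2 * Real.pi * I / n) ^ i := by
        ext z
        rw [Polynomial.mem_nthRootsFinset hn, mem_image]
        constructor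
        · intro hz
          obtain ⟨i, hi, rfl⟩ := hprim.eq_pow_of_pow_eq_one hz
          exact ⟨i, mem_range.2 hi, rfl⟩
        · rintro ⟨i, -, rfl⟩
          rw [← pow_mul, mul_comm i n, pow_mul, hprim.pow_eq_one, one_pow]
      rw [this, sum_image]
      · split_ifs with h1
        · subst h1; simp
        · exact hprim.geom_sum_eq_zero (by omega)
      · intro i hi j hj hij
        exact hprim.pow_inj (mem_range.1 hi) (mem_range.1 hj) hij
    · intro i _ j _ hij
      exact IsPrimitiveRoot.disjoint hij
  have := (ArithmeticFunction.sum_eq_iff_sum_mul_moebius_eq.1 h q hq).symm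
  rw [this, Nat.sum_divisorsAntidiagonal (f := fun a b =>
    (ArithmeticFunction.moebius a : ℂ) * if b = 1 then (1:ℂ) else 0),
    sum_eq_single q]
  · simp [Nat.div_self hq]
  · intro b hb hbq
    rw [if_neg, mul_zero]
    intro h1
    exact hbq (Nat.eq_of_dvd_of_div_eq_one (Nat.dvd_of_mem_divisors hb) h1)
  · intro h; exact absurd (Nat.mem_divisors_self q hq.ne') h

lemma isPrimitiveRoot_stdAddChar {q : ℕ} [NeZero q] {u : ZMod q} (hu : IsUnit u) :
    IsPrimitiveRoot (ZMod.stdAddChar u) q := by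
  have hv : ZMod.stdAddChar u = cexp (2 * Real.pi * I * (u.val / q)) := by
    conv_lhs => rw [← ZMod.natCast_zmod_val u]
    have := ZMod.stdAddChar_coe (N := q) (u.val : ℤ)
    push_cast at this
    rw [this]; ring_nf
  rw [hv]
  refine Complex.isPrimitiveRoot_exp_of_coprime _ _ (NeZero.ne q) ?_
  have := (ZMod.isUnit_iff_coprime u.val q).1 (by rwa [ZMod.natCast_zmod_val])
  exact this

lemma sum_stdAddChar_units {q : ℕ} [NeZero q] {a : ZMod q} (ha : IsUnit a) :
    ∑ u : (ZMod q)ˣ, ZMod.stdAddChar (a * (u : ZMod q)) = (ArithmeticFunction.moebius q : ℂ) := by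
  rw [← sum_primitiveRoots_eq_moebius (NeZero.pos q)]
  have hinj : Function.Injective
      fun u : (ZMod q)ˣ => (ZMod.stdAddChar (a * (u : ZMod q)) : ℂ) := by
    intro u v h
    have := ZMod.injective_stdAddChar h
    exact Units.ext (ha.mul_left_cancel this)
  have himg : (univ.image fun u : (ZMod q)ˣ => (ZMod.stdAddChar (a * (u : ZMod q)) : ℂ)) =
      primitiveRoots q ℂ := by
    refine eq_of_subset_of_card_le ?_ ?_
    · intro z hz
      obtain ⟨u, -, rfl⟩ := mem_image.1 hz
      exact (mem_primitiveRoots (NeZero.pos q)).2 (isPrimitiveRoot_stdAddChar (ha.mul u.isUnit))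
    · rw [card_image_of_injective _ hinj, Complex.card_primitiveRoots, card_univ,
        ZMod.card_units_eq_totient]
  rw [← himg, sum_image fun _ _ _ _ h => hinj h]

theorem exists_character_expansion {q : ℕ} [NeZero q] {a : ZMod q} (ha : IsUnit a) :
    ∃ c : DirichletCharacter ℂ q → ℂ,
      (∀ n : ZMod q, IsUnit n → ZMod.stdAddChar (a * n) = ∑ χ, c χ * χ n) ∧
      ∑ χ, ‖c χ‖ ≤ √q ∧ c 1 = (ArithmeticFunction.moebius q : ℂ) / q.totient := by
  have hφ : (q.totient : ℂ) ≠ 0 := by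
    exact_mod_cast (Nat.totient_pos.2 (NeZero.pos q)).ne'
  have hφR : (0:ℝ) < q.totient := by
    exact_mod_cast (Nat.totient_pos.2 (NeZero.pos q))
  set c : DirichletCharacter ℂ q → ℂ := fun χ =>
    (q.totient : ℂ)⁻¹ * ∑ u : (ZMod q)ˣ, χ ((u⁻¹ : (ZMod q)ˣ) : ZMod q) *
      ZMod.stdAddChar (a * (u : ZMod q)) with hc
  have horth : ∀ u v : (ZMod q)ˣ, ∑ χ : DirichletCharacter ℂ q,
      χ ((u⁻¹ : (ZMod q)ˣ) : ZMod q) * χ (v : ZMod q) = if u = v then (q.totient : ℂ) else 0 := by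
    intro u v
    have := DirichletCharacter.sum_char_inv_mul_char_eq ℂ u.isUnit (v : ZMod q)
    rw [ZMod.inv_coe_unit] at this
    rw [this]
    simp only [Units.val_inj]
  refine ⟨c, ?_, ?_, ?_⟩
  · rintro n ⟨v, rfl⟩
    simp only [hc, mul_assoc, sum_mul]
    rw [← mul_sum, sum_comm]
    have : ∀ u : (ZMod q)ˣ, ∑ χ : DirichletCharacter ℂ q, χ ((u⁻¹ : (ZMod q)ˣ) : ZMod q) *
        (ZMod.stdAddChar (a * (u : ZMod q)) * χ (v : ZMod q)) =
        if u = v then (q.totient : ℂ) * ZMod.stdAddChar (a * (u : ZMod q)) else 0 := by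
      intro u
      have h2 := horth u v
      calc _ = ZMod.stdAddChar (a * (u : ZMod q)) *
            ∑ χ : DirichletCharacter ℂ q, χ ((u⁻¹ : (ZMod q)ˣ) : ZMod q) * χ (v : ZMod q) := by
            rw [mul_sum]; exact sum_congr rfl fun _ _ => by ring
        _ = _ := by rw [h2]; split_ifs <;> ring
    simp only [this]
    simp [hφ]
  · have hpars : ∑ χ, ‖c χ‖ ^ 2 = 1 := by
      have : ((∑ χ, ‖c χ‖ ^ 2 : ℝ) : ℂ) = 1 := by
        push_cast
        have h1 : ∀ χ : DirichletCharacter ℂ q, (‖c χ‖ : ℂ) ^ 2 =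
            (q.totient : ℂ)⁻¹ ^ 2 * ∑ u : (ZMod q)ˣ, ∑ v : (ZMod q)ˣ,
              (χ ((u⁻¹ : (ZMod q)ˣ) : ZMod q) * χ (v : ZMod q)) *
              (ZMod.stdAddChar (a * (u : ZMod q)) * ZMod.stdAddChar (-(a * (v : ZMod q)))) := by
          intro χ
          rw [← Complex.mul_conj', hc]
          simp only [map_mul, map_sum, map_inv₀, map_natCast]
          rw [mul_mul_mul_comm, sum_mul_sum, sq]
          congr 1
          refine sum_congr rfl fun u _ => sum_congr rfl fun v _ => ?_
          rw [AddChar.map_neg_eq_conj]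
          have : (starRingEnd ℂ) (χ ((v⁻¹ : (ZMod q)ˣ) : ZMod q)) = χ (v : ZMod q) := by
            rw [← RCLike.star_def, MulChar.star_apply', MulChar.inv_apply, Ring.inverse_unit, inv_inv]
          rw [this]; ring
        simp only [h1]
        rw [← mul_sum, sum_comm]
        have h2 : ∀ u : (ZMod q)ˣ, ∑ χ : DirichletCharacter ℂ q, ∑ v : (ZMod q)ˣ,
              (χ ((u⁻¹ : (ZMod q)ˣ) : ZMod q) * χ (v : ZMod q)) *
              (ZMod.stdAddChar (a * (u : ZMod q)) * ZMod.stdAddChar (-(a * (v : ZMod q)))) =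
              q.totient := by
          intro u
          rw [sum_comm]
          simp only [← sum_mul, horth, ite_mul, zero_mul]
          rw [sum_ite_eq, if_pos (mem_univ _), ← AddChar.map_add_eq_mul]
          simp
        simp only [h2, sum_const, card_univ, ZMod.card_units_eq_totient, nsmul_eq_mul]
        field_simp
      exact_mod_cast this
    have hcs := sq_sum_le_card_mul_sum_sq (s := (univ : Finset (DirichletCharacter ℂ q)))
      (f := fun χ => ‖c χ‖)
    rw [hpars, mul_one, card_univ, ← Nat.card_eq_fintype_card,
      DirichletCharacter.card_eq_totient_of_hasEnoughRootsOfUnity ℂ q] at hcs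
    refine Real.le_sqrt_of_sq_le (hcs.trans ?_)
    exact_mod_cast Nat.totient_le q
  · simp only [hc, MulChar.one_apply_coe, one_mul, sum_stdAddChar_units ha]
    rw [div_eq_inv_mul]

end AdditiveCharacters

section TotientBounds
open Finset

lemma rpow_prime_pow_le_totient {p k : ℕ} (hp : p.Prime) (hk : 0 < k) :
    ((p ^ k : ℕ) : ℝ) ^ (17 / 20 : ℝ) ≤
      (if p = 2 ∨ p = 3 then 2 else 1) * ((p ^ k).totient : ℝ) := by
  have hp0 : (0:ℝ) < p := by exact_mod_cast hp.pos
  have hp2 : (2:ℝ) ≤ p := by exact_mod_cast hp.two_le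
  have hφ : ((p ^ k).totient : ℝ) = (p:ℝ) ^ k * (1 - 1 / p) := by
    obtain ⟨j, rfl⟩ := Nat.exists_eq_succ_of_ne_zero hk.ne'
    rw [Nat.totient_prime_pow_succ hp]
    push_cast [hp.one_le]
    rw [Nat.succ_eq_add_one]; field_simp
    ring
  have hpk : (1:ℝ) ≤ (p:ℝ) ^ k := one_le_pow₀ (by linarith)
  rw [hφ]
  push_cast
  split_ifs with h
  · have h1 : ((p:ℝ) ^ k) ^ (17/20:ℝ) ≤ (p:ℝ) ^ k := by
      conv_rhs => rw [← Real.rpow_one ((p:ℝ) ^ k)]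
      exact Real.rpow_le_rpow_of_exponent_le hpk (by norm_num)
    have h2 : 1 / (p:ℝ) ≤ 1 / 2 := one_div_le_one_div_of_le (by norm_num) hp2
    nlinarith
  · push Not at h
    have hp5 : 5 ≤ p := by
      have := hp.two_le
      by_contra hlt
      have : p = 4 := by omega
      subst this
      exact absurd hp (by norm_num)
    have hp5' : (5:ℝ) ≤ p := by exact_mod_cast hp5
    have h5 : (5/4:ℝ) ≤ (p:ℝ) ^ (3/20:ℝ) := by
      have h20 : (5/4:ℝ) ^ (20:ℕ) ≤ (p:ℝ) ^ (3:ℕ) :=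
        le_trans (by norm_num) (pow_le_pow_left₀ (by norm_num) hp5' 3)
      have : (p:ℝ) ^ (3:ℕ) = ((p:ℝ) ^ (3/20:ℝ)) ^ (20:ℕ) := by
        rw [← Real.rpow_natCast, ← Real.rpow_natCast, ← Real.rpow_mul hp0.le]; norm_num
      rw [this] at h20
      exact le_of_pow_le_pow_left₀ (by norm_num) (by positivity) h20
    have hpk2 : (p:ℝ) ^ (3/20:ℝ) ≤ ((p:ℝ) ^ k) ^ (3/20:ℝ) := by
      refine Real.rpow_le_rpow hp0.le ?_ (by norm_num)
      exact le_self_pow₀ (by linarith) hk.ne'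
    have hsplit : ((p:ℝ) ^ k) = ((p:ℝ) ^ k) ^ (17/20:ℝ) * ((p:ℝ) ^ k) ^ (3/20:ℝ) := by
      rw [← Real.rpow_add (by positivity)]; norm_num
    have h4 : 1 / (p:ℝ) ≤ 1 / 5 := one_div_le_one_div_of_le (by norm_num) hp5'
    rw [one_mul]
    have hX : 0 ≤ ((p:ℝ) ^ k) ^ (17/20:ℝ) := by positivity
    calc ((p:ℝ) ^ k) ^ (17/20:ℝ) = ((p:ℝ) ^ k) ^ (17/20:ℝ) * (5/4 * (4/5)) := by ring
      _ ≤ ((p:ℝ) ^ k) ^ (17/20:ℝ) * (((p:ℝ) ^ k) ^ (3/20:ℝ) * (1 - 1/p)) := by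
          gcongr
          · exact h5.trans hpk2
          · linarith
      _ = ((p:ℝ) ^ k) * (1 - 1/p) := by rw [← mul_assoc, ← hsplit]

lemma rpow_le_mul_totient_aux (q : ℕ) (hq : 0 < q) : (q:ℝ) ^ (17 / 20 : ℝ) ≤
    (if 2 ∣ q then 2 else 1) * (if 3 ∣ q then 2 else 1) * (q.totient : ℝ) := by
  induction q using Nat.recOnPosPrimePosCoprime with
  | zero => omega
  | one => norm_num
  | prime_pow p k hp hk =>
    refine (rpow_prime_pow_le_totient hp hk).trans ?_
    gcongr
    have h2 : 2 ∣ p ^ k ↔ p = 2 := by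
      exact ⟨fun h => ((Nat.prime_dvd_prime_iff_eq Nat.prime_two hp).1
        (Nat.prime_two.dvd_of_dvd_pow h)).symm, fun h => h ▸ dvd_pow_self p hk.ne'⟩
    have h3 : 3 ∣ p ^ k ↔ p = 3 := by
      exact ⟨fun h => ((Nat.prime_dvd_prime_iff_eq Nat.prime_three hp).1
        (Nat.prime_three.dvd_of_dvd_pow h)).symm, fun h => h ▸ dvd_pow_self p hk.ne'⟩
    simp only [h2, h3]
    split_ifs <;> first | (exfalso; omega) | norm_num
  | coprime a b ha hb hab iha ihb =>
    have hA := iha (by omega)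
    have hB := ihb (by omega)
    have key : ∀ r : ℕ, r.Prime → (if r ∣ a * b then (2:ℝ) else 1) =
        (if r ∣ a then 2 else 1) * (if r ∣ b then 2 else 1) := by
      intro r hr
      have hnot : ¬ (r ∣ a ∧ r ∣ b) := fun h => by
        have := Nat.dvd_gcd h.1 h.2
        rw [hab] at this
        exact hr.one_lt.ne' (Nat.dvd_one.1 this)
      simp only [hr.dvd_mul]
      by_cases h1 : r ∣ a <;> by_cases h2 : r ∣ b <;> simp_all
    rw [key 2 Nat.prime_two, key 3 Nat.prime_three, Nat.totient_mul hab]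
    push_cast
    rw [Real.mul_rpow (by positivity) (by positivity)]
    calc _ ≤ _ := mul_le_mul hA hB (by positivity) (by positivity)
      _ = _ := by ring

theorem rpow_le_mul_totient {q : ℕ} (hq : 0 < q) :
    (q:ℝ) ^ (17 / 20 : ℝ) ≤ 4 * (q.totient : ℝ) := by
  refine (rpow_le_mul_totient_aux q hq).trans ?_
  gcongr
  split_ifs <;> norm_num

end TotientBounds

section SingularSeries
open Finset
open scoped ArithmeticFunction.Moebius

lemma totient_eq_prod_sub_one {q : ℕ} (hq : Squarefree q) :
    (q.totient : ℝ) = ∏ p ∈ q.primeFactors, ((p:ℝ) - 1) := by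
  have h := Nat.totient_mul_prod_primeFactors q
  rw [Nat.prod_primeFactors_of_squarefree hq, mul_comm q] at h
  have := Nat.eq_of_mul_eq_mul_right (Nat.pos_of_ne_zero hq.ne_zero) h
  rw [this, Nat.cast_prod]
  refine prod_congr rfl fun p hp => ?_
  rw [Nat.cast_pred (Nat.prime_of_mem_primeFactors hp).pos]

lemma sum_inv_sq_le (n : ℕ) : ∑ i ∈ Icc 1 n, 1 / (i:ℝ) ^ 2 ≤ 2 - 1 / (n:ℝ) := by
  induction n with
  | zero => norm_num
  | succ n ih =>
    rw [sum_Icc_succ_top (by omega)]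
    rcases Nat.eq_zero_or_pos n with rfl | hn
    · norm_num
    · have h0 : (0:ℝ) < n := by exact_mod_cast hn
      have : 1 / (((n + 1 : ℕ)):ℝ) ^ 2 ≤ 1 / (n:ℝ) - 1 / ((n + 1 : ℕ):ℝ) := by
        push_cast
        rw [div_sub_div _ _ h0.ne' (by positivity), div_le_div_iff₀ (by positivity) (by positivity)]
        nlinarith
      linarith

lemma sum_inv_sub_one_sq_le (N : ℕ) :
    ∑ p ∈ Icc 1 N with p.Prime ∧ p ≠ 2, 1 / ((p:ℝ) - 1) ^ 2 ≤ 1 / 2 := by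
  have hPi : ((Icc 1 N).filter fun p => p.Prime ∧ p ≠ 2) ⊆ (Icc 1 N).image fun i => 2 * i + 1 := by
    intro p hp
    obtain ⟨h1, h2, h3⟩ := mem_filter.1 hp
    obtain ⟨i, hi⟩ := h2.odd_of_ne_two h3
    have := h2.two_le
    have := (mem_Icc.1 h1).2
    exact mem_image.2 ⟨i, mem_Icc.2 ⟨by omega, by omega⟩, hi.symm⟩
  have h1 := sum_le_sum_of_subset_of_nonneg (f := fun p : ℕ => 1 / ((p:ℝ) - 1) ^ 2) hPi
    fun _ _ _ => by positivity
  have h2 : ∑ p ∈ (Icc 1 N).image (fun i : ℕ => 2 * i + 1), 1 / ((p:ℝ) - 1) ^ 2 =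
      1 / 4 * ∑ i ∈ Icc 1 N, 1 / (i:ℝ) ^ 2 := by
    rw [sum_image fun a _ b _ h => by simpa using h, mul_sum]
    refine sum_congr rfl fun i hi => ?_
    push_cast
    ring
  have h3 : ∑ i ∈ Icc 1 N, 1 / (i:ℝ) ^ 2 ≤ 2 :=
    (sum_inv_sq_le N).trans (sub_le_self _ (by positivity))
  rw [h2] at h1
  linarith

lemma sum_odd_squarefree_le (N : ℕ) :
    ∑ q ∈ Icc 1 N with Squarefree q ∧ Odd q, 1 / (q.totient : ℝ) ^ 2 ≤ Real.exp (1 / 2) := by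
  set P := (Icc 1 N).filter fun p => p.Prime ∧ p ≠ 2 with hP
  calc ∑ q ∈ Icc 1 N with Squarefree q ∧ Odd q, 1 / (q.totient : ℝ) ^ 2
      = ∑ q ∈ Icc 1 N with Squarefree q ∧ Odd q, ∏ p ∈ q.primeFactors, 1 / ((p:ℝ) - 1) ^ 2 := by
        refine sum_congr rfl fun q hq => ?_
        rw [totient_eq_prod_sub_one (mem_filter.1 hq).2.1, prod_div_distrib, prod_const_one, prod_pow]
    _ = ∑ t ∈ ((Icc 1 N).filter fun q => Squarefree q ∧ Odd q).image Nat.primeFactors,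
          ∏ p ∈ t, 1 / ((p:ℝ) - 1) ^ 2 := by
        rw [sum_image]
        intro a ha b hb hab
        rw [← Nat.prod_primeFactors_of_squarefree (mem_filter.1 ha).2.1, hab,
          Nat.prod_primeFactors_of_squarefree (mem_filter.1 hb).2.1]
    _ ≤ ∑ t ∈ P.powerset, ∏ p ∈ t, 1 / ((p:ℝ) - 1) ^ 2 := by
        refine sum_le_sum_of_subset_of_nonneg ?_ fun _ _ _ => prod_nonneg fun _ _ => by positivity
        intro t ht
        obtain ⟨q, hq, rfl⟩ := mem_image.1 ht
        obtain ⟨hq1, hq2, hq3⟩ := mem_filter.1 hq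
        rw [mem_powerset]
        intro p hp
        have hpp := Nat.prime_of_mem_primeFactors hp
        have hpd := Nat.dvd_of_mem_primeFactors hp
        refine mem_filter.2 ⟨mem_Icc.2 ⟨hpp.one_le, ?_⟩, hpp, ?_⟩
        · exact (Nat.le_of_dvd (mem_Icc.1 hq1).1 hpd).trans (mem_Icc.1 hq1).2
        · rintro rfl
          exact (Nat.not_even_iff_odd.2 hq3) (even_iff_two_dvd.2 hpd)
    _ = ∏ p ∈ P, (1 + 1 / ((p:ℝ) - 1) ^ 2) := (prod_one_add P).symm
    _ ≤ Real.exp (∑ p ∈ P, 1 / ((p:ℝ) - 1) ^ 2) := by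
        rw [Real.exp_sum]
        refine prod_le_prod (fun p _ => ?_) fun p _ => ?_
        · positivity
        · rw [add_comm]; exact Real.add_one_le_exp _
    _ ≤ Real.exp (1 / 2) := by
        exact Real.exp_le_exp.2 (sum_inv_sub_one_sq_le N)

lemma exp_half_lt : Real.exp (1 / 2) < 33 / 20 := by
  have h1 := Real.exp_one_lt_d9
  have h2 : Real.exp (1 / 2) ^ 2 = Real.exp 1 := by
    rw [← Real.exp_nat_mul]; norm_num
  nlinarith [Real.exp_pos (1 / 2)]

/-- The tail of the singular series beyond the arcs at `0` and `1/2`. -/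
theorem sum_singular_tail_le (N : ℕ) :
    ∑ q ∈ Icc 3 N, (q.totient : ℝ) *
      (1 / ((q / Nat.gcd 2 q).totient : ℝ) *
        (|(ArithmeticFunction.moebius q : ℝ)| / q.totient) ^ 2) ≤ 13 / 10 := by
  set O := (Icc 1 N).filter fun q => Squarefree q ∧ Odd q with hO
  set O' := O.erase 1 with hO'
  have hsum : ∑ q ∈ O', 1 / (q.totient : ℝ) ^ 2 ≤ 13 / 20 := by
    have h := (sum_odd_squarefree_le N).trans exp_half_lt.le
    by_cases h1 : 1 ∈ O
    · rw [← sum_erase_add _ _ h1] at h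
      norm_num at h
      norm_num at h ⊢
      linarith
    · have : O = ∅ := by
        rcases Nat.eq_zero_or_pos N with rfl | hN
        · simp [hO]
        · exact absurd (mem_filter.2 ⟨mem_Icc.2 ⟨le_rfl, hN⟩, squarefree_one, odd_one⟩) h1
      rw [hO', this]; norm_num
  calc _ ≤ ∑ q ∈ O' ∪ O'.image (fun r => 2 * r), (q.totient : ℝ) *
      (1 / ((q / Nat.gcd 2 q).totient : ℝ) *
        (|(ArithmeticFunction.moebius q : ℝ)| / q.totient) ^ 2) := by
        rw [← sum_filter_ne_zero]
        refine sum_le_sum_of_subset_of_nonneg (fun q hq' => ?_) fun _ _ _ => by positivity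
        obtain ⟨hq, hne⟩ := mem_filter.1 hq'
        obtain ⟨hq3, hqN⟩ := mem_Icc.1 hq
        have hsq : Squarefree q := by
          by_contra h
          exact hne (by rw [ArithmeticFunction.moebius_eq_zero_of_not_squarefree h]; simp)
        rw [mem_union]
        rcases Nat.even_or_odd q with he | ho
        · right
          obtain ⟨r, hr⟩ := he
          have hr2 : q = 2 * r := by omega
          subst hr2
          refine mem_image.2 ⟨r, mem_erase.2 ⟨by omega, mem_filter.2
            ⟨mem_Icc.2 ⟨by omega, by omega⟩, hsq.squarefree_of_dvd (dvd_mul_left r 2), ?_⟩⟩, rfl⟩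
          rw [← Nat.not_even_iff_odd]
          intro he
          obtain ⟨s, hs⟩ := he
          have := hsq 2 ⟨s, by omega⟩
          exact absurd this (by decide)
        · left
          exact mem_erase.2 ⟨by omega, mem_filter.2 ⟨mem_Icc.2 ⟨by omega, hqN⟩, hsq, ho⟩⟩
    _ ≤ ∑ q ∈ O', (q.totient : ℝ) * (1 / ((q / Nat.gcd 2 q).totient : ℝ) *
          (|(ArithmeticFunction.moebius q : ℝ)| / q.totient) ^ 2) +
        ∑ q ∈ O'.image (fun r => 2 * r), (q.totient : ℝ) * (1 / ((q / Nat.gcd 2 q).totient : ℝ) *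
          (|(ArithmeticFunction.moebius q : ℝ)| / q.totient) ^ 2) := by
        rw [← sum_union_inter]
        exact le_add_of_nonneg_right (sum_nonneg fun _ _ => by positivity)
    _ = ∑ q ∈ O', 1 / (q.totient : ℝ) ^ 2 + ∑ q ∈ O', 1 / (q.totient : ℝ) ^ 2 := by
        rw [sum_image fun a _ b _ h => by simpa using h]
        have hφ : ∀ q ∈ O', (0:ℝ) < q.totient := fun q hq => by
          have := (mem_Icc.1 (mem_filter.1 (mem_of_mem_erase hq)).1).1
          exact_mod_cast Nat.totient_pos.2 this
        congr 1 <;> refine sum_congr rfl fun q hq => ?_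
        · obtain ⟨h1, hsq, ho⟩ := mem_filter.1 (mem_of_mem_erase hq)
          have hg : Nat.gcd 2 q = 1 := Nat.coprime_two_left.2 ho
          have hμ : |(ArithmeticFunction.moebius q : ℝ)| = 1 := by
            have := ArithmeticFunction.abs_moebius_eq_one_of_squarefree hsq
            exact_mod_cast this
          have := hφ q hq
          rw [hg, hμ, Nat.div_one]
          field_simp
        · obtain ⟨h1, hsq, ho⟩ := mem_filter.1 (mem_of_mem_erase hq)
          have hc : Nat.Coprime 2 q := Nat.coprime_two_left.2 ho
          have hsq2 : Squarefree (2 * q) := (Nat.squarefree_mul hc).2 ⟨Nat.prime_two.squarefree, hsq⟩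
          have hμ : |(ArithmeticFunction.moebius (2 * q) : ℝ)| = 1 := by
            have := ArithmeticFunction.abs_moebius_eq_one_of_squarefree hsq2
            exact_mod_cast this
          have := hφ q hq
          rw [hμ, Nat.gcd_mul_right_right, Nat.mul_div_cancel_left q two_pos, Nat.totient_mul hc,
            Nat.totient_two, one_mul]
          field_simp
    _ ≤ 13 / 10 := by linarith

end SingularSeries

section PrimeShift
open Complex Finset

/-- The operator `F ↦ ∑ p ∈ P, ω p * F (· * p)`. Its `k`-th power, evaluated at `1`, is the weighted
sum of `F` over products of `k` elements of `P`. -/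
def primeShift (P : Finset ℕ) (ω : ℕ → ℝ) : Module.End ℂ (ℕ → ℂ) where
  toFun F n := ∑ p ∈ P, (ω p : ℂ) * F (n * p)
  map_add' F G := by ext n; simp [mul_add, sum_add_distrib]
  map_smul' c F := by ext n; simp [mul_sum, mul_left_comm]

lemma primeShift_apply (P : Finset ℕ) (ω : ℕ → ℝ) (F : ℕ → ℂ) (n : ℕ) :
    primeShift P ω F n = ∑ p ∈ P, (ω p : ℂ) * F (n * p) := rfl

lemma primeShift_commute (P Q : Finset ℕ) (ω : ℕ → ℝ) :
    Commute (primeShift P ω) (primeShift Q ω) := by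
  refine LinearMap.ext fun F => funext fun n => ?_
  simp only [Module.End.mul_apply, primeShift_apply, mul_sum]
  rw [sum_comm]
  refine sum_congr rfl fun p _ => sum_congr rfl fun r _ => ?_
  rw [mul_right_comm n r p]; ring

lemma primeShift_filter_add (P : Finset ℕ) (ω : ℕ → ℝ) (S : ℕ → Prop) [DecidablePred S] :
    primeShift P ω =
      primeShift (P.filter fun p => ¬ S p) ω + primeShift (P.filter S) ω := by
  refine LinearMap.ext fun F => funext fun n => ?_
  simp only [LinearMap.add_apply, Pi.add_apply, primeShift_apply]
  rw [add_comm, sum_filter_add_sum_filter_not]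

variable {P : Finset ℕ} {ω : ℕ → ℝ}

lemma primeShift_pow_congr {S : ℕ → Set ℕ}
    (hS : ∀ i, ∀ n ∈ S i, ∀ p ∈ P, n * p ∈ S (i + 1)) {F G : ℕ → ℂ} (i : ℕ) :
    ∀ j, (∀ n ∈ S (j + i), F n = G n) →
      ∀ n ∈ S j, (primeShift P ω ^ i) F n = (primeShift P ω ^ i) G n := by
  induction i with
  | zero => intro j h n hn; simpa using h n hn
  | succ i ih =>
    intro j h n hn
    rw [pow_succ', Module.End.mul_apply, Module.End.mul_apply, primeShift_apply, primeShift_apply]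
    refine sum_congr rfl fun p hp => ?_
    rw [ih (j + 1) (by rwa [add_right_comm]) (n * p) (hS j n hn p hp)]

lemma primeShift_pow_shift (F : ℕ → ℂ) (i d : ℕ) : ∀ n,
    (primeShift P ω ^ i) F (d * n) = (primeShift P ω ^ i) (fun m => F (d * m)) n := by
  induction i with
  | zero => intro n; simp
  | succ i ih =>
    intro n
    rw [pow_succ', Module.End.mul_apply, Module.End.mul_apply, primeShift_apply, primeShift_apply]
    refine sum_congr rfl fun p _ => ?_
    rw [mul_assoc, ih]

lemma primeShift_pow_eigen {F f : ℕ → ℂ} (hP : ∀ p ∈ P, 0 < p)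
    (hF : ∀ n, 0 < n → ∀ p ∈ P, F (n * p) = F n * f p) (i : ℕ) : ∀ n, 0 < n →
    (primeShift P ω ^ i) F n = F n * (∑ p ∈ P, (ω p : ℂ) * f p) ^ i := by
  induction i with
  | zero => intro n _; simp
  | succ i ih =>
    intro n hn
    rw [pow_succ', Module.End.mul_apply, primeShift_apply]
    calc _ = ∑ p ∈ P, (F n * (∑ p ∈ P, (ω p : ℂ) * f p) ^ i) * ((ω p : ℂ) * f p) := by
          refine sum_congr rfl fun p hp => ?_
          rw [ih _ (Nat.mul_pos hn (hP p hp)), hF n hn p hp]; ring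
      _ = _ := by rw [← mul_sum, pow_succ]; ring

lemma norm_primeShift_pow_le (hω : ∀ p ∈ P, 0 ≤ ω p) (hP : ∀ p ∈ P, 0 < p) {H : ℕ → ℂ} {C β : ℝ}
    (hH : ∀ n, 0 < n → ‖H n‖ ≤ C * (n:ℝ) ^ β) (j : ℕ) : ∀ n, 0 < n →
    ‖(primeShift P ω ^ j) H n‖ ≤ C * (∑ p ∈ P, ω p * (p:ℝ) ^ β) ^ j * (n:ℝ) ^ β := by
  induction j with
  | zero => intro n hn; simpa using hH n hn
  | succ j ih =>
    intro n hn
    rw [pow_succ', Module.End.mul_apply, primeShift_apply]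
    calc _ ≤ ∑ p ∈ P, ‖(ω p : ℂ) * (primeShift P ω ^ j) H (n * p)‖ := norm_sum_le _ _
      _ ≤ ∑ p ∈ P, C * (∑ p ∈ P, ω p * (p:ℝ) ^ β) ^ j * (n:ℝ) ^ β * (ω p * (p:ℝ) ^ β) := by
          refine sum_le_sum fun p hp => ?_
          rw [norm_mul, norm_real, Real.norm_of_nonneg (hω p hp)]
          have := mul_le_mul_of_nonneg_left (ih _ (Nat.mul_pos hn (hP p hp))) (hω p hp)
          push_cast at this
          rw [Real.mul_rpow (by positivity) (by positivity)] at this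
          linarith
      _ = _ := by rw [← mul_sum]; ring

lemma norm_primeShift_pow_le_const (hω : ∀ p ∈ P, 0 ≤ ω p) (hP : ∀ p ∈ P, 0 < p) {H : ℕ → ℂ}
    {C : ℝ} (hH : ∀ n, 0 < n → ‖H n‖ ≤ C) (j n : ℕ) (hn : 0 < n) :
    ‖(primeShift P ω ^ j) H n‖ ≤ C * (∑ p ∈ P, ω p) ^ j := by
  have := norm_primeShift_pow_le hω hP (β := 0) (C := C) (by simpa using hH) j n hn
  simpa using this

/-- `e(x) = exp(2πix)`. -/
def phase (x : ℝ) : ℂ := cexp (((2 * Real.pi * x : ℝ) : ℂ) * I)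

lemma norm_phase (x : ℝ) : ‖phase x‖ = 1 := norm_exp_ofReal_mul_I _

lemma phase_add (x y : ℝ) : phase (x + y) = phase x * phase y := by
  rw [phase, phase, phase, ← Complex.exp_add]; push_cast; ring_nf

lemma phase_intCast (n : ℤ) : phase n = 1 := by
  rw [phase, Complex.exp_eq_one_iff]; exact ⟨n, by push_cast; ring⟩

lemma stdAddChar_intCast_eq_phase {q : ℕ} [NeZero q] (j : ℤ) :
    ZMod.stdAddChar (j : ZMod q) = phase (j / q) := by
  rw [ZMod.stdAddChar_coe, phase]; push_cast; ring_nf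

/-- The function `n ↦ e(an/q) n^{it}`. -/
def rationalTwist (q : ℕ) (a : ℤ) (t : ℝ) (n : ℕ) : ℂ :=
  phase (a * n / q) * (n : ℂ) ^ ((t : ℂ) * I)

lemma norm_natCast_cpow_mul_I {n : ℕ} (hn : 0 < n) (t : ℝ) : ‖(n : ℂ) ^ ((t : ℂ) * I)‖ = 1 := by
  rw [norm_natCast_cpow_of_pos hn]; simp

lemma norm_rationalTwist (q : ℕ) (a : ℤ) (t : ℝ) {n : ℕ} (hn : 0 < n) :
    ‖rationalTwist q a t n‖ = 1 := by
  rw [rationalTwist, norm_mul, norm_phase, norm_natCast_cpow_mul_I hn, one_mul]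

theorem norm_primeShift_pow_rationalTwist_sub_le {q : ℕ} (hq : 0 < q) {a : ℤ} (ha : IsCoprime a q)
    {t B : ℝ} (hPq : ∀ p ∈ P, Nat.Coprime p q) (hP : ∀ p ∈ P, 0 < p)
    (hB : ∀ r : ℕ, r ∣ q → ∀ χ : DirichletCharacter ℂ r, χ ≠ 1 →
      ‖∑ p ∈ P, (ω p : ℂ) * (χ p * (p : ℂ) ^ ((t : ℂ) * I))‖ ≤ B) (hB0 : 0 ≤ B)
    (i : ℕ) {d : ℕ} (hd : 0 < d) :
    ‖(primeShift P ω ^ i) (rationalTwist q a t) d -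
      (d : ℂ) ^ ((t : ℂ) * I) * ((ArithmeticFunction.moebius (q / d.gcd q) : ℂ) /
        (q / d.gcd q).totient) * (∑ p ∈ P, (ω p : ℂ) * (p : ℂ) ^ ((t : ℂ) * I)) ^ i‖ ≤
      √q * B ^ i := by
  set g := d.gcd q with hg
  set r := q / g with hr
  have hg0 : 0 < g := Nat.gcd_pos_of_pos_left _ hd
  have hgq : g ∣ q := Nat.gcd_dvd_right d q
  have hqr : q = r * g := (Nat.div_mul_cancel hgq).symm
  have hrq : r ∣ q := ⟨g, hqr⟩
  have hr0 : 0 < r := Nat.pos_of_dvd_of_pos hrq hq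
  have : NeZero r := ⟨hr0.ne'⟩
  obtain ⟨d', hd'⟩ : g ∣ d := Nat.gcd_dvd_left d q
  have hcop : Nat.Coprime d' r := by
    have := Nat.coprime_div_gcd_div_gcd (m := d) (n := q) hg0
    rwa [← hg, ← hr, show d / g = d' by rw [hd', Nat.mul_div_cancel_left _ hg0]] at this
  have hunit : IsUnit ((a * d' : ℤ) : ZMod r) := by
    rw [ZMod.coe_int_isUnit_iff_isCoprime]
    refine IsCoprime.mul_right ?_ ?_
    · exact (ha.of_isCoprime_of_dvd_right (by exact_mod_cast hrq)).symm
    · exact (Nat.isCoprime_iff_coprime.2 hcop).symm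
  obtain ⟨c, hc, hcsum, hc1⟩ := exists_character_expansion hunit
  set G : DirichletCharacter ℂ r → ℕ → ℂ := fun χ n => χ n * (n : ℂ) ^ ((t : ℂ) * I) with hG
  have hshift : (primeShift P ω ^ i) (rationalTwist q a t) d =
      (d : ℂ) ^ ((t : ℂ) * I) * ∑ χ, c χ * (∑ p ∈ P, (ω p : ℂ) * G χ p) ^ i := by
    have h1 := primeShift_pow_shift (P := P) (ω := ω) (rationalTwist q a t) i d 1
    rw [mul_one] at h1
    have h2 := primeShift_pow_congr (P := P) (ω := ω) (S := fun _ => {n | 0 < n ∧ Nat.Coprime n q})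
      (fun i n hn p hp => ⟨Nat.mul_pos hn.1 (hP p hp), hn.2.mul_left (hPq p hp)⟩)
      (F := fun m => rationalTwist q a t (d * m))
      (G := (d : ℂ) ^ ((t : ℂ) * I) • ∑ χ, c χ • G χ) i 0 ?_ 1 ⟨one_pos, Nat.coprime_one_left q⟩
    · rw [h1, h2, map_smul, map_sum]
      simp only [map_smul, Pi.smul_apply, Finset.sum_apply, smul_eq_mul]
      congr 1
      refine sum_congr rfl fun χ _ => ?_
      rw [primeShift_pow_eigen (f := G χ) hP _ i 1 one_pos]
      · simp [hG]
      · intro n hn p hp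
        simp only [hG]
        push_cast
        rw [map_mul, natCast_mul_natCast_cpow]; ring
    · rintro n ⟨hn, hnq⟩
      have hnr : IsUnit (n : ZMod r) := (ZMod.isUnit_iff_coprime n r).2 (hnq.coprime_dvd_right hrq)
      have := hc n hnr
      simp only [Pi.smul_apply, Finset.sum_apply, smul_eq_mul, rationalTwist, hG]
      push_cast
      rw [natCast_mul_natCast_cpow]
      have hph : phase (a * ((d:ℝ) * n) / q) = ∑ χ, c χ * χ (n : ZMod r) := by
        rw [← this, show ((a * d' : ℤ) : ZMod r) * (n : ZMod r) = ((a * d' * n : ℤ) : ZMod r) by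
          push_cast; rfl, stdAddChar_intCast_eq_phase]
        congr 1
        rw [hd', hqr]
        have : (r:ℝ) ≠ 0 := by exact_mod_cast hr0.ne'
        have : (g:ℝ) ≠ 0 := by exact_mod_cast hg0.ne'
        push_cast
        field_simp
      rw [hph, sum_mul, mul_sum]
      exact sum_congr rfl fun χ _ => by ring
  have hmain : (∑ p ∈ P, (ω p : ℂ) * G 1 p) = ∑ p ∈ P, (ω p : ℂ) * (p : ℂ) ^ ((t : ℂ) * I) := by
    refine sum_congr rfl fun p hp => ?_
    simp only [hG]
    rw [MulChar.one_apply ((ZMod.isUnit_iff_coprime p r).2 ((hPq p hp).coprime_dvd_right hrq)),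
      one_mul]
  rw [hshift, ← add_sum_erase _ _ (mem_univ (1 : DirichletCharacter ℂ r)), hmain, hc1, mul_add,
    ← mul_assoc, add_sub_cancel_left, norm_mul, norm_natCast_cpow_mul_I hd, one_mul]
  calc _ ≤ ∑ χ ∈ univ.erase (1 : DirichletCharacter ℂ r),
        ‖c χ * (∑ p ∈ P, (ω p : ℂ) * G χ p) ^ i‖ := norm_sum_le _ _
    _ ≤ ∑ χ ∈ univ.erase (1 : DirichletCharacter ℂ r), ‖c χ‖ * B ^ i := by
        refine sum_le_sum fun χ hχ => ?_
        rw [norm_mul, norm_pow]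
        gcongr
        exact hB r hrq χ (ne_of_mem_erase hχ)
    _ ≤ ∑ χ, ‖c χ‖ * B ^ i :=
        sum_le_sum_of_subset_of_nonneg (erase_subset _ _) fun _ _ _ => by positivity
    _ ≤ √q * B ^ i := by
        rw [← sum_mul]
        gcongr
        refine hcsum.trans (Real.sqrt_le_sqrt ?_)
        exact_mod_cast Nat.le_of_dvd hq hrq

end PrimeShift

section TwistBounds
open Complex Finset

variable {P : Finset ℕ} {ω : ℕ → ℝ}

lemma inv_totient_div_gcd_le {q d : ℕ} (hq : 0 < q) (hd : 0 < d) :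
    ‖(ArithmeticFunction.moebius (q / d.gcd q) : ℂ) / (q / d.gcd q).totient‖ ≤
      4 * (q : ℝ) ^ (-(17 / 20) : ℝ) * (d : ℝ) ^ (17 / 20 : ℝ) := by
  set r := q / d.gcd q with hr
  have hgq : d.gcd q ∣ q := Nat.gcd_dvd_right d q
  have hg0 : 0 < d.gcd q := Nat.gcd_pos_of_pos_left _ hd
  have hqr : q = r * d.gcd q := (Nat.div_mul_cancel hgq).symm
  have hr0 : 0 < r := Nat.pos_of_ne_zero fun h => by rw [h, zero_mul] at hqr; omega
  have hle : (q:ℝ) ≤ r * d := by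
    have : q ≤ r * d := by
      conv_lhs => rw [hqr]
      exact Nat.mul_le_mul_left _ (Nat.gcd_le_left _ hd)
    exact_mod_cast this
  have hφ := rpow_le_mul_totient hr0
  have hφ0 : (0:ℝ) < r.totient := by exact_mod_cast Nat.totient_pos.2 hr0
  have hq0 : (0:ℝ) < q := by exact_mod_cast hq
  have hd0 : (0:ℝ) < d := by exact_mod_cast hd
  have h1 : (q:ℝ) ^ (17/20:ℝ) ≤ (r:ℝ) ^ (17/20:ℝ) * (d:ℝ) ^ (17/20:ℝ) := by
    rw [← Real.mul_rpow (by positivity) (by positivity)]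
    exact Real.rpow_le_rpow hq0.le hle (by norm_num)
  have hμ : ‖(ArithmeticFunction.moebius r : ℂ)‖ ≤ 1 := by
    rw [Complex.norm_intCast]
    exact_mod_cast ArithmeticFunction.abs_moebius_le_one
  rw [norm_div, Complex.norm_natCast, Real.rpow_neg hq0.le]
  have hqp : (0:ℝ) < (q:ℝ) ^ (17/20:ℝ) := by positivity
  have hdp : (0:ℝ) < (d:ℝ) ^ (17/20:ℝ) := by positivity
  calc _ ≤ 1 / (r.totient : ℝ) := by gcongr
    _ ≤ _ := by
      rw [div_le_iff₀ hφ0, show 4 * ((q:ℝ) ^ (17/20:ℝ))⁻¹ * (d:ℝ) ^ (17/20:ℝ) * (r.totient : ℝ) =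
        (4 * r.totient * (d:ℝ) ^ (17/20:ℝ)) / (q:ℝ) ^ (17/20:ℝ) by field_simp, one_le_div hqp]
      nlinarith

/-- Expansion of a twisted sum over products according to the factors dividing the modulus. -/
lemma primeShift_pow_eq_sum (q k : ℕ) (F : ℕ → ℂ) (n : ℕ) :
    (primeShift P ω ^ k) F n = ∑ j ∈ range (k + 1), (k.choose j : ℂ) *
      (primeShift (P.filter fun p => p ∣ q) ω ^ j)
        ((primeShift (P.filter fun p => ¬ p ∣ q) ω ^ (k - j)) F) n := by
  rw [primeShift_filter_add P ω fun p => p ∣ q, add_comm,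
    (primeShift_commute _ _ _).add_pow, LinearMap.sum_apply, Finset.sum_apply]
  refine sum_congr rfl fun j _ => ?_
  rw [← Nat.cast_commute, ← nsmul_eq_mul, LinearMap.smul_apply, Pi.smul_apply, nsmul_eq_mul,
    Module.End.mul_apply]

variable {q : ℕ} {a : ℤ} {t B : ℝ}

lemma norm_primeShift_pow_le_of_split {F : ℕ → ℂ} (q : ℕ) {C1 C2 b1 b2 L1 L2 β : ℝ}
    (hω : ∀ p ∈ P, 0 ≤ ω p) (hP : ∀ p ∈ P, 0 < p)
    (h : ∀ i, ∃ H : ℕ → ℂ, (∀ d, 0 < d →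
        ‖(primeShift (P.filter fun p => ¬ p ∣ q) ω ^ i) F d - H d‖ ≤ C1 * L1 ^ i) ∧
      ∀ d, 0 < d → ‖H d‖ ≤ C2 * L2 ^ i * (d:ℝ) ^ β)
    (hb1 : ∑ p ∈ P with p ∣ q, ω p = b1) (hb2 : ∑ p ∈ P with p ∣ q, ω p * (p:ℝ) ^ β = b2)
    (k : ℕ) :
    ‖(primeShift P ω ^ k) F 1‖ ≤ C1 * (L1 + b1) ^ k + C2 * (L2 + b2) ^ k := by
  have hω' : ∀ p ∈ P.filter fun p => p ∣ q, 0 ≤ ω p := fun p hp => hω p (mem_filter.1 hp).1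
  have hP' : ∀ p ∈ P.filter fun p => p ∣ q, 0 < p := fun p hp => hP p (mem_filter.1 hp).1
  rw [primeShift_pow_eq_sum q, add_comm L1, add_comm L2, add_pow, add_pow, mul_sum, mul_sum,
    ← sum_add_distrib]
  refine norm_sum_le_of_le _ fun j _ => ?_
  obtain ⟨H, hH1, hH2⟩ := h (k - j)
  set G := (primeShift (P.filter fun p => ¬ p ∣ q) ω ^ (k - j)) F with hG
  have h1 := norm_primeShift_pow_le_const hω' hP' (H := G - H) hH1 j 1 one_pos
  have h2 := norm_primeShift_pow_le hω' hP' hH2 j 1 one_pos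
  rw [hb1] at h1
  rw [hb2, Nat.cast_one, Real.one_rpow, mul_one] at h2
  have h3 : (primeShift (P.filter fun p => p ∣ q) ω ^ j) G 1 =
      (primeShift (P.filter fun p => p ∣ q) ω ^ j) (G - H) 1 +
      (primeShift (P.filter fun p => p ∣ q) ω ^ j) H 1 := by
    rw [map_sub, Pi.sub_apply, sub_add_cancel]
  rw [norm_mul, Complex.norm_natCast, h3]
  calc _ ≤ (k.choose j : ℝ) * (C1 * L1 ^ (k - j) * b1 ^ j + C2 * L2 ^ (k - j) * b2 ^ j) := by
        gcongr
        exact (norm_add_le _ _).trans (add_le_add h1 h2)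
    _ = _ := by ring

lemma norm_main_term_le (hω : ∀ p ∈ P, 0 ≤ ω p) (hP : ∀ p ∈ P, 0 < p) (t : ℝ) :
    ‖∑ p ∈ P, (ω p : ℂ) * (p : ℂ) ^ ((t : ℂ) * I)‖ ≤ ∑ p ∈ P, ω p := by
  refine norm_sum_le_of_le _ fun p hp => ?_
  rw [norm_mul, norm_natCast_cpow_mul_I (hP p hp), norm_real, Real.norm_of_nonneg (hω p hp), mul_one]

theorem norm_primeShift_pow_rationalTwist_le (hq : 0 < q) (ha : IsCoprime a q)
    (hω : ∀ p ∈ P, 0 ≤ ω p) (hP : ∀ p ∈ P, p.Prime)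
    (hB : ∀ r : ℕ, r ∣ q → ∀ χ : DirichletCharacter ℂ r, χ ≠ 1 →
      ‖∑ p ∈ P with ¬ p ∣ q, (ω p : ℂ) * (χ p * (p : ℂ) ^ ((t : ℂ) * I))‖ ≤ B) (hB0 : 0 ≤ B)
    (k : ℕ) :
    ‖(primeShift P ω ^ k) (rationalTwist q a t) 1‖ ≤
      √q * (B + ∑ p ∈ P with p ∣ q, ω p) ^ k + 4 * (q : ℝ) ^ (-(17 / 20) : ℝ) *
        (∑ p ∈ P, ω p + ∑ p ∈ P with p ∣ q, ω p * (p:ℝ) ^ (17 / 20 : ℝ)) ^ k := by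
  have hP0 : ∀ p ∈ P, 0 < p := fun p hp => (hP p hp).pos
  refine norm_primeShift_pow_le_of_split q hω hP0 (fun i => ⟨fun d => (d : ℂ) ^ ((t : ℂ) * I) *
    ((ArithmeticFunction.moebius (q / d.gcd q) : ℂ) / (q / d.gcd q).totient) *
    (∑ p ∈ P with ¬ p ∣ q, (ω p : ℂ) * (p : ℂ) ^ ((t : ℂ) * I)) ^ i, fun d hd => ?_,
    fun d hd => ?_⟩) rfl rfl k
  · refine norm_primeShift_pow_rationalTwist_sub_le hq ha (fun p hp => ?_) (fun p hp => ?_) hB hB0 i hd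
    · exact ((hP p (mem_filter.1 hp).1).coprime_iff_not_dvd).2 (mem_filter.1 hp).2
    · exact hP0 p (mem_filter.1 hp).1
  · rw [norm_mul, norm_mul, norm_natCast_cpow_mul_I hd, one_mul, norm_pow, mul_right_comm]
    gcongr
    · exact inv_totient_div_gcd_le hq hd
    · refine (norm_main_term_le (fun p hp => hω p (mem_filter.1 hp).1)
        (fun p hp => hP0 p (mem_filter.1 hp).1) t).trans ?_
      exact sum_le_sum_of_subset_of_nonneg (filter_subset _ _) fun p hp _ => hω p hp

theorem norm_primeShift_pow_rationalTwist_le' (hq : 0 < q) (ha : IsCoprime a q)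
    (hω : ∀ p ∈ P, 0 ≤ ω p) (hP : ∀ p ∈ P, p.Prime)
    (hB : ∀ r : ℕ, r ∣ q → ∀ χ : DirichletCharacter ℂ r, χ ≠ 1 →
      ‖∑ p ∈ P with ¬ p ∣ q, (ω p : ℂ) * (χ p * (p : ℂ) ^ ((t : ℂ) * I))‖ ≤ B) (hB0 : 0 ≤ B)
    (ht : ‖∑ p ∈ P with ¬ p ∣ q, (ω p : ℂ) * (p : ℂ) ^ ((t : ℂ) * I)‖ ≤ B)
    (k : ℕ) :
    ‖(primeShift P ω ^ k) (rationalTwist q a t) 1‖ ≤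
      2 * √q * (B + ∑ p ∈ P with p ∣ q, ω p) ^ k := by
  have hP0 : ∀ p ∈ P, 0 < p := fun p hp => (hP p hp).pos
  have hq1 : (1:ℝ) ≤ √q := by
    rw [Real.one_le_sqrt]; exact_mod_cast hq
  have := norm_primeShift_pow_le_of_split (P := P) (ω := ω) (F := rationalTwist q a t)
    (C1 := √q) (C2 := √q)
    (L1 := B) (L2 := B) (β := 0) (b1 := ∑ p ∈ P with p ∣ q, ω p)
    (b2 := ∑ p ∈ P with p ∣ q, ω p) q hω hP0 (fun i => ⟨fun d => (d : ℂ) ^ ((t : ℂ) * I) *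
    ((ArithmeticFunction.moebius (q / d.gcd q) : ℂ) / (q / d.gcd q).totient) *
    (∑ p ∈ P with ¬ p ∣ q, (ω p : ℂ) * (p : ℂ) ^ ((t : ℂ) * I)) ^ i, fun d hd => ?_,
    fun d hd => ?_⟩) rfl (by simp) k
  · linarith
  · refine norm_primeShift_pow_rationalTwist_sub_le hq ha (fun p hp => ?_) (fun p hp => ?_) hB hB0 i hd
    · exact ((hP p (mem_filter.1 hp).1).coprime_iff_not_dvd).2 (mem_filter.1 hp).2
    · exact hP0 p (mem_filter.1 hp).1
  · rw [norm_mul, norm_mul, norm_natCast_cpow_mul_I hd, one_mul, norm_pow, Real.rpow_zero, mul_one]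
    gcongr
    refine le_trans ?_ hq1
    rw [norm_div, Complex.norm_natCast]
    have hμ : ‖(ArithmeticFunction.moebius (q / d.gcd q) : ℂ)‖ ≤ 1 := by
      rw [Complex.norm_intCast]
      exact_mod_cast ArithmeticFunction.abs_moebius_le_one
    refine div_le_one_of_le₀ (hμ.trans ?_) (Nat.cast_nonneg _)
    have : 0 < q / d.gcd q := Nat.div_pos (Nat.gcd_le_right _ hq) (Nat.gcd_pos_of_pos_left _ hd)
    exact_mod_cast Nat.totient_pos.2 this

theorem norm_primeShift_pow_rationalTwist_sub_le_of_not_dvd (hq : 0 < q) (ha : IsCoprime a q)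
    (hP : ∀ p ∈ P, p.Prime) (hPq : ∀ p ∈ P, ¬ p ∣ q)
    (hB : ∀ r : ℕ, r ∣ q → ∀ χ : DirichletCharacter ℂ r, χ ≠ 1 →
      ‖∑ p ∈ P, (ω p : ℂ) * (χ p * (p : ℂ) ^ ((t : ℂ) * I))‖ ≤ B) (hB0 : 0 ≤ B)
    (k : ℕ) :
    ‖(primeShift P ω ^ k) (rationalTwist q a t) 1 - (ArithmeticFunction.moebius q : ℂ) / q.totient *
      (primeShift P ω ^ k) (rationalTwist 1 0 t) 1‖ ≤ √q * B ^ k := by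
  have h := norm_primeShift_pow_rationalTwist_sub_le (P := P) (ω := ω) hq ha
    (fun p hp => ((hP p hp).coprime_iff_not_dvd).2 (hPq p hp)) (fun p hp => (hP p hp).pos) hB hB0 k
    one_pos
  have h1 : (primeShift P ω ^ k) (rationalTwist 1 0 t) 1 =
      (∑ p ∈ P, (ω p : ℂ) * (p : ℂ) ^ ((t : ℂ) * I)) ^ k := by
    rw [primeShift_pow_eigen (f := fun p => (p : ℂ) ^ ((t : ℂ) * I))
      (fun p hp => (hP p hp).pos) _ k 1 one_pos]
    · simp [rationalTwist, phase]
    · intro n hn p hp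
      simp only [rationalTwist, phase]
      push_cast
      rw [natCast_mul_natCast_cpow]; simp
  rw [h1]
  simpa using h

end TwistBounds

section ProductWeights
open Complex Finset

/-- The products of `k` elements of `P`. -/
def kProducts (P : Finset ℕ) : ℕ → Finset ℕ
  | 0 => {1}
  | k + 1 => image₂ (· * ·) (kProducts P k) P

/-- The total weight of the representations of `n` as an ordered product of `k` elements of `P`. -/
def productWeight (P : Finset ℕ) (ω : ℕ → ℝ) : ℕ → ℕ → ℝ
  | 0, n => if n = 1 then 1 else 0
  | k + 1, n => ∑ p ∈ P with p ∣ n, ω p * productWeight P ω k (n / p)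

variable {P : Finset ℕ} {ω : ℕ → ℝ}

lemma productWeight_nonneg (hω : ∀ p ∈ P, 0 ≤ ω p) (k : ℕ) : ∀ n, 0 ≤ productWeight P ω k n := by
  induction k with
  | zero => intro n; rw [productWeight]; split_ifs <;> norm_num
  | succ k ih =>
    intro n
    exact sum_nonneg fun p hp => mul_nonneg (hω p (mem_filter.1 hp).1) (ih _)

lemma productWeight_eq_zero (k : ℕ) :
    ∀ n, n ∉ kProducts P k → productWeight P ω k n = 0 := by
  induction k with
  | zero => intro n hn; rw [productWeight, if_neg]; simpa [kProducts] using hn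
  | succ k ih =>
    intro n hn
    refine sum_eq_zero fun p hp => ?_
    obtain ⟨hp1, hp2⟩ := mem_filter.1 hp
    rw [ih, mul_zero]
    intro hmem
    exact hn (mem_image₂.2 ⟨n / p, hmem, p, hp1, Nat.div_mul_cancel hp2⟩)

lemma primeShift_pow_apply_one (hP : ∀ p ∈ P, 0 < p) (k : ℕ) : ∀ F : ℕ → ℂ,
    (primeShift P ω ^ k) F 1 = ∑ n ∈ kProducts P k, (productWeight P ω k n : ℂ) * F n := by
  induction k with
  | zero => intro F; simp [kProducts, productWeight]
  | succ k ih =>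
    intro F
    rw [pow_succ, Module.End.mul_apply, ih]
    simp only [primeShift_apply, productWeight, sum_filter, ofReal_sum, mul_sum, sum_mul]
    rw [sum_comm, sum_comm (s := kProducts P (k + 1))]
    refine sum_congr rfl fun p hp => ?_
    have hinj : Set.InjOn (fun m : ℕ => m * p) (kProducts P k) := fun m _ m' _ h =>
      Nat.eq_of_mul_eq_mul_right (hP p hp) h
    have hsub : (kProducts P k).image (fun m => m * p) ⊆ kProducts P (k + 1) := by
      intro n hn
      obtain ⟨m, hm, rfl⟩ := mem_image.1 hn
      exact mem_image₂.2 ⟨m, hm, p, hp, rfl⟩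
    rw [← sum_subset hsub, sum_image hinj]
    · refine sum_congr rfl fun m _ => ?_
      rw [if_pos (dvd_mul_left p m), Nat.mul_div_cancel _ (hP p hp)]
      push_cast; ring
    · intro n _ hn
      split_ifs with hd
      · rw [productWeight_eq_zero k (n / p), mul_zero, ofReal_zero, zero_mul]
        intro hmem
        exact hn (mem_image.2 ⟨n / p, hmem, Nat.div_mul_cancel hd⟩)
      · simp

lemma sum_productWeight (hP : ∀ p ∈ P, 0 < p) (k : ℕ) :
    ∑ n ∈ kProducts P k, productWeight P ω k n = (∑ p ∈ P, ω p) ^ k := by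
  have h := primeShift_pow_apply_one (ω := ω) hP k fun _ => 1
  rw [primeShift_pow_eigen (f := fun _ => 1) hP (by simp) k 1 one_pos] at h
  simp only [mul_one, one_mul] at h
  exact_mod_cast h.symm

lemma kProducts_induction {R : ℕ → ℕ → Prop} (h1 : R 0 1)
    (hmul : ∀ k n p, n ∈ kProducts P k → p ∈ P → R k n → R (k + 1) (n * p)) (k : ℕ) :
    ∀ n ∈ kProducts P k, R k n := by
  induction k with
  | zero => intro n hn; rw [kProducts, mem_singleton] at hn; rwa [hn]
  | succ k ih =>
    intro n hn
    obtain ⟨m, hm, p, hp, rfl⟩ := mem_image₂.1 hn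
    exact hmul k m p hm hp (ih m hm)

lemma pos_of_mem_kProducts (hP : ∀ p ∈ P, 0 < p) {k n : ℕ} (hn : n ∈ kProducts P k) : 0 < n :=
  kProducts_induction (R := fun _ n => 0 < n) one_pos
    (fun _ _ p _ hp h => Nat.mul_pos h (hP p hp)) k n hn

lemma coprime_of_mem_kProducts {k n r : ℕ} (hP : ∀ p ∈ P, Nat.Coprime p r)
    (hn : n ∈ kProducts P k) : Nat.Coprime n r :=
  kProducts_induction (R := fun _ n => Nat.Coprime n r) (Nat.coprime_one_left r)
    (fun _ _ p _ hp h => h.mul_left (hP p hp)) k n hn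

lemma log_mem_of_mem_kProducts (hP : ∀ p ∈ P, 0 < p) {c d : ℝ}
    (hlog : ∀ p ∈ P, c ≤ Real.log p ∧ Real.log p ≤ d) {k n : ℕ} (hn : n ∈ kProducts P k) :
    k * c ≤ Real.log n ∧ Real.log n ≤ k * d := by
  refine kProducts_induction (R := fun k n => k * c ≤ Real.log n ∧ Real.log n ≤ k * d)
    (by simp) (fun k n p hn hp h => ?_) k n hn
  have hn0 : (n:ℝ) ≠ 0 := by exact_mod_cast (pos_of_mem_kProducts hP hn).ne'
  have hp0 : (p:ℝ) ≠ 0 := by exact_mod_cast (hP p hp).ne'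
  push_cast
  rw [Real.log_mul hn0 hp0]
  have := hlog p hp
  constructor <;> nlinarith

lemma dvd_mem_of_mem_kProducts (hP : ∀ p ∈ P, p.Prime) {k n : ℕ} (hn : n ∈ kProducts P k) :
    ∀ p : ℕ, p.Prime → p ∣ n → p ∈ P :=
  kProducts_induction (R := fun _ n => ∀ p : ℕ, p.Prime → p ∣ n → p ∈ P)
    (fun p hp h => absurd (Nat.dvd_one.1 h) hp.one_lt.ne')
    (fun _ _ r _ hr h p hp hd => by
      rcases hp.dvd_mul.1 hd with h' | h'
      · exact h p hp h'
      · rwa [(Nat.prime_dvd_prime_iff_eq hp (hP r hr)).1 h']) k n hn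

lemma card_dvd_le_of_mem_kProducts (hP : ∀ p ∈ P, p.Prime) {k n : ℕ} (hn : n ∈ kProducts P k) :
    (P.filter fun p => p ∣ n).card ≤ k := by
  have hP0 : ∀ p ∈ P, 0 < p := fun p hp => (hP p hp).pos
  have hΩ : ArithmeticFunction.cardFactors n = k :=
    kProducts_induction (R := fun k n => ArithmeticFunction.cardFactors n = k) (by simp)
      (fun k n p hn hp h => by
        rw [ArithmeticFunction.cardFactors_mul (pos_of_mem_kProducts hP0 hn).ne' (hP p hp).ne_zero, h,
          ArithmeticFunction.cardFactors_apply_prime (hP p hp)]) k n hn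
  calc _ ≤ n.primeFactors.card := card_le_card fun p hp => by
        obtain ⟨h1, h2⟩ := mem_filter.1 hp
        exact Nat.mem_primeFactors.2 ⟨hP p h1, h2, (pos_of_mem_kProducts hP0 hn).ne'⟩
    _ ≤ k := by
        rw [← hΩ, ArithmeticFunction.cardFactors_apply, Nat.primeFactors, List.card_toFinset]
        exact (List.dedup_sublist _).length_le

lemma mul_productWeight_le (hω : ∀ p ∈ P, 0 ≤ ω p) (hP : ∀ p ∈ P, p.Prime) {M : ℝ} (hM : 0 ≤ M)
    (hωM : ∀ p ∈ P, p * ω p ≤ M) (k : ℕ) :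
    ∀ n : ℕ, n * productWeight P ω k n ≤ k.factorial * M ^ k := by
  induction k with
  | zero => intro n; rw [productWeight]; split_ifs with h <;> simp [h]
  | succ k ih =>
    intro n
    by_cases hn : n ∈ kProducts P (k + 1)
    · rw [productWeight, mul_sum]
      calc _ ≤ ∑ p ∈ P with p ∣ n, M * (k.factorial * M ^ k) := by
            refine sum_le_sum fun p hp => ?_
            obtain ⟨h1, h2⟩ := mem_filter.1 hp
            have h3 : (n:ℝ) = p * ((n / p : ℕ):ℝ) := by
              rw [← Nat.cast_mul, Nat.mul_div_cancel' h2]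
            rw [h3]
            calc _ = (p * ω p) * (((n / p : ℕ):ℝ) * productWeight P ω k (n / p)) := by ring
              _ ≤ _ := mul_le_mul (hωM p h1) (ih _)
                  (mul_nonneg (Nat.cast_nonneg _) (productWeight_nonneg hω k _)) hM
        _ ≤ ((k + 1 : ℕ):ℝ) * (M * (k.factorial * M ^ k)) := by
            rw [sum_const, nsmul_eq_mul]
            gcongr
            exact card_dvd_le_of_mem_kProducts hP hn
        _ = _ := by rw [Nat.factorial_succ]; push_cast; ring
    · rw [productWeight_eq_zero _ _ hn, mul_zero]; positivity

end ProductWeights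

section WindowSum
open Complex Finset

/-- The exponential sum over products of `k` elements of `P` with logarithm in `[a, a + 1]`. -/
def windowSum (P : Finset ℕ) (ω : ℕ → ℝ) (k : ℕ) (a α : ℝ) : ℂ :=
  ∑ n ∈ kProducts P k, (productWeight P ω k n * bump (Real.log n - a) : ℝ) * phase (α * n)

variable {P : Finset ℕ} {ω : ℕ → ℝ} {k : ℕ}

lemma norm_tsum_le_of_split {c X : ℤ → ℂ} (hc : Summable fun l => ‖c l‖) (p r : ℤ → Prop)
    [DecidablePred p] [DecidablePred r] {U V S : ℝ}
    (h : ∀ l, ‖X l‖ ≤ U + (if p l then V else 0) + (if r l then S else 0)) :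
    ‖∑' l, c l * X l‖ ≤ U * ∑' l, ‖c l‖ + V * ∑' l, (if p l then ‖c l‖ else 0) +
      S * ∑' l, (if r l then ‖c l‖ else 0) := by
  have hs : ∀ (s : ℤ → Prop) [DecidablePred s], Summable fun l => if s l then ‖c l‖ else 0 := by
    intro s _
    refine hc.of_nonneg_of_le (fun l => ?_) fun l => ?_
    · split_ifs <;> positivity
    · split_ifs
      · exact le_rfl
      · positivity
  refine tsum_of_norm_bounded (g := fun l => U * ‖c l‖ + V * (if p l then ‖c l‖ else 0) +
      S * (if r l then ‖c l‖ else 0)) ?_ fun l => ?_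
  · exact ((hc.hasSum.mul_left U).add ((hs p).hasSum.mul_left V)).add ((hs r).hasSum.mul_left S)
  · rw [norm_mul]
    have := mul_le_mul_of_nonneg_left (h l) (norm_nonneg (c l))
    split_ifs at this ⊢ <;> linarith

lemma exists_windowSum_expansion (hP : ∀ p ∈ P, 0 < p) {a A D γ c d : ℝ}
    (hlog : ∀ p ∈ P, c ≤ Real.log p ∧ Real.log p ≤ d) (hAc : A ≤ k * c) (hdD : k * d < A + D)
    (hD1 : 1 ≤ D) (hA : A ≤ a) (hD : a + 1 ≤ A + D) :
    ∃ c : ℤ → ℂ, Summable (fun l => ‖c l‖) ∧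
      (∀ (q : ℕ) (r : ℤ), windowSum P ω k a (r / q + γ) =
        ∑' l : ℤ, c l * (primeShift P ω ^ k) (rationalTwist q r (2 * Real.pi * l / D)) 1) ∧
      ∑' l, ‖c l‖ ≤ 11 * √(1 + |γ| * Real.exp a) ∧
      (∀ M : ℝ, 1 ≤ M → ∑' l : ℤ, (if M < |(l:ℝ)| then ‖c l‖ else 0) ≤
        14 * D * (1 + |γ| * Real.exp a) / √M) ∧
      (∀ τ : ℝ, 1 ≤ τ → ∑' l : ℤ, (if |2 * Real.pi * l / D| < τ then ‖c l‖ else 0) ≤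
        6 * τ ^ 2 / (1 + |γ| * Real.exp a)) := by
  obtain ⟨C, hC1, hC2, hC3, hC4, hC5⟩ := exists_windowPhase_expansion (γ := γ) hD1 hA hD
  refine ⟨C, hC1, fun q r => ?_, hC3, hC4, hC5⟩
  have key : ∀ n ∈ kProducts P k, HasSum (fun l : ℤ => C l * ((productWeight P ω k n : ℂ) *
      rationalTwist q r (2 * Real.pi * l / D) n))
      ((productWeight P ω k n * bump (Real.log n - a) : ℝ) * phase ((r / q + γ) * n)) := by
    intro n hn
    have hn0 : (0:ℝ) < n := by exact_mod_cast pos_of_mem_kProducts hP hn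
    obtain ⟨h1, h2⟩ := log_mem_of_mem_kProducts hP hlog hn
    have := (hC2 (Real.log n) (hAc.trans h1) (h2.trans_lt hdD)).mul_left
      ((productWeight P ω k n : ℂ) * phase (r * n / q))
    have e1 : (fun l : ℤ => C l * ((productWeight P ω k n : ℂ) *
        rationalTwist q r (2 * Real.pi * l / D) n)) = fun l : ℤ => (productWeight P ω k n : ℂ) *
        phase (r * n / q) * (C l * cexp (((2 * Real.pi * l / D * Real.log n : ℝ) : ℂ) * I)) := by
      ext l
      simp only [rationalTwist]
      rw [cpow_def_of_ne_zero (by exact_mod_cast hn0.ne'), ← ofReal_natCast, ← ofReal_log hn0.le]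
      have : ((2 * Real.pi * l / D * Real.log n : ℝ) : ℂ) * I =
          (Real.log n : ℂ) * (((2 * Real.pi * l / D : ℝ) : ℂ) * I) := by push_cast; ring
      rw [this]; ring
    have e2 : ((productWeight P ω k n * bump (Real.log n - a) : ℝ) : ℂ) *
        phase ((r / q + γ) * n) = (productWeight P ω k n : ℂ) * phase (r * n / q) *
        windowPhase a γ (Real.log n) := by
      simp only [windowPhase, Real.exp_log hn0]
      rw [add_mul, phase_add, show (r / q * n : ℝ) = r * n / q by ring]
      simp only [phase]
      push_cast; ring_nf
    rw [e1, e2]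
    exact this
  rw [windowSum, ← (hasSum_sum key).tsum_eq]
  refine tsum_congr fun l => ?_
  rw [primeShift_pow_apply_one hP, mul_sum]

/-- Bounds available for the prime sums attached to a modulus `q`. -/
structure TwistBound (P : Finset ℕ) (ω : ℕ → ℝ) (q : ℕ) (τ R B : ℝ) : Prop where
  nonneg : 0 ≤ B
  character : ∀ r : ℕ, r ∣ q → ∀ χ : DirichletCharacter ℂ r, χ ≠ 1 → ∀ t : ℝ, |t| ≤ R →
    ‖∑ p ∈ P with ¬ p ∣ q, (ω p : ℂ) * (χ p * (p : ℂ) ^ ((t : ℂ) * I))‖ ≤ B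
  principal : ∀ t : ℝ, τ ≤ |t| → |t| ≤ R →
    ‖∑ p ∈ P with ¬ p ∣ q, (ω p : ℂ) * (p : ℂ) ^ ((t : ℂ) * I)‖ ≤ B

lemma abs_two_pi_mul_div_le {l D M : ℝ} (hD1 : 1 ≤ D) (hl : |l| ≤ M) :
    |2 * Real.pi * l / D| ≤ 7 * M := by
  rw [abs_div, abs_mul, abs_of_pos Real.two_pi_pos, abs_of_pos (by linarith : 0 < D)]
  have := Real.pi_lt_d2
  have h0 := abs_nonneg l
  refine (div_le_self (by positivity) hD1).trans ?_
  nlinarith [Real.pi_pos]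

theorem norm_windowSum_le (hω : ∀ p ∈ P, 0 ≤ ω p) (hP : ∀ p ∈ P, p.Prime) {a A D γ c d : ℝ}
    (hlog : ∀ p ∈ P, c ≤ Real.log p ∧ Real.log p ≤ d) (hAc : A ≤ k * c) (hdD : k * d < A + D)
    (hD1 : 1 ≤ D) (hA : A ≤ a) (hD : a + 1 ≤ A + D) {τ M B : ℝ} (hτ : 1 ≤ τ) (hM : 1 ≤ M)
    {q : ℕ} {r : ℤ} (hq : 0 < q) (hr : IsCoprime r q) (hB : TwistBound P ω q τ (7 * M) B) :
    ‖windowSum P ω k a (r / q + γ)‖ ≤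
      2 * √q * (B + ∑ p ∈ P with p ∣ q, ω p) ^ k * (11 * √(1 + |γ| * Real.exp a)) +
      4 * (q : ℝ) ^ (-(17 / 20) : ℝ) *
        (∑ p ∈ P, ω p + ∑ p ∈ P with p ∣ q, ω p * (p:ℝ) ^ (17 / 20 : ℝ)) ^ k *
        (6 * τ ^ 2 / (1 + |γ| * Real.exp a)) +
      (∑ p ∈ P, ω p) ^ k * (14 * D * (1 + |γ| * Real.exp a) / √M) := by
  have hP0 : ∀ p ∈ P, 0 < p := fun p hp => (hP p hp).pos
  have hS : 0 ≤ ∑ p ∈ P, ω p := sum_nonneg hω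
  have hb : 0 ≤ ∑ p ∈ P with p ∣ q, ω p := sum_nonneg fun p hp => hω p (mem_filter.1 hp).1
  have hb2 : 0 ≤ ∑ p ∈ P with p ∣ q, ω p * (p:ℝ) ^ (17 / 20 : ℝ) := sum_nonneg fun p hp =>
    mul_nonneg (hω p (mem_filter.1 hp).1) (by positivity)
  have hBn := hB.nonneg
  obtain ⟨C, hC1, hC2, hC3, hC4, hC5⟩ := exists_windowSum_expansion (k := k) (ω := ω) (γ := γ)
    hP0 hlog hAc hdD hD1 hA hD
  rw [hC2]
  refine (norm_tsum_le_of_split hC1 (fun l : ℤ => |2 * Real.pi * l / D| < τ)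
    (fun l : ℤ => M < |(l:ℝ)|) (U := 2 * √q * (B + ∑ p ∈ P with p ∣ q, ω p) ^ k)
    (V := 4 * (q : ℝ) ^ (-(17 / 20) : ℝ) *
      (∑ p ∈ P, ω p + ∑ p ∈ P with p ∣ q, ω p * (p:ℝ) ^ (17 / 20 : ℝ)) ^ k)
    (S := (∑ p ∈ P, ω p) ^ k) fun l => ?_).trans ?_
  · by_cases hl : M < |(l:ℝ)|
    · rw [if_pos hl]
      have := norm_primeShift_pow_le_const hω hP0 (H := rationalTwist q r (2 * Real.pi * l / D))
        (C := 1) (fun n hn => (norm_rationalTwist _ _ _ hn).le) k 1 one_pos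
      rw [one_mul] at this
      refine this.trans (le_add_of_nonneg_left (add_nonneg (by positivity) ?_))
      split_ifs <;> positivity
    · have hR := abs_two_pi_mul_div_le hD1 (not_lt.1 hl)
      rw [if_neg hl, add_zero]
      split_ifs with ht
      · refine (norm_primeShift_pow_rationalTwist_le hq hr hω hP
          (fun r' hr' χ hχ => hB.character r' hr' χ hχ _ hR) hBn k).trans ?_
        gcongr
        linarith [Real.sqrt_nonneg (q:ℝ)]
      · rw [add_zero]
        exact norm_primeShift_pow_rationalTwist_le' hq hr hω hP
          (fun r' hr' χ hχ => hB.character r' hr' χ hχ _ hR) hBn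
          (hB.principal _ (not_lt.1 ht) hR) k
  · gcongr
    · exact hC5 τ hτ
    · exact hC4 M hM

theorem norm_windowSum_sub_le (hω : ∀ p ∈ P, 0 ≤ ω p) (hP : ∀ p ∈ P, p.Prime) {a A D γ c d : ℝ}
    (hlog : ∀ p ∈ P, c ≤ Real.log p ∧ Real.log p ≤ d) (hAc : A ≤ k * c) (hdD : k * d < A + D)
    (hD1 : 1 ≤ D) (hA : A ≤ a) (hD : a + 1 ≤ A + D) {τ M B : ℝ} (hM : 1 ≤ M)
    {q : ℕ} {r : ℤ} (hq : 0 < q) (hr : IsCoprime r q) (hPq : ∀ p ∈ P, ¬ p ∣ q)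
    (hB : TwistBound P ω q τ (7 * M) B) :
    ‖windowSum P ω k a (r / q + γ) -
        (ArithmeticFunction.moebius q : ℂ) / q.totient * windowSum P ω k a γ‖ ≤
      √q * B ^ k * (11 * √(1 + |γ| * Real.exp a)) +
      2 * (∑ p ∈ P, ω p) ^ k * (14 * D * (1 + |γ| * Real.exp a) / √M) := by
  have hP0 : ∀ p ∈ P, 0 < p := fun p hp => (hP p hp).pos
  have hS : 0 ≤ ∑ p ∈ P, ω p := sum_nonneg hω
  have hBn := hB.nonneg
  obtain ⟨C, hC1, hC2, hC3, hC4, -⟩ := exists_windowSum_expansion (k := k) (ω := ω) (γ := γ)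
    hP0 hlog hAc hdD hD1 hA hD
  have hfil : P.filter (fun p => ¬ p ∣ q) = P := filter_true_of_mem hPq
  set m : ℂ := (ArithmeticFunction.moebius q : ℂ) / q.totient with hm
  have hm1 : ‖m‖ ≤ 1 := by
    rw [hm, norm_div, Complex.norm_natCast]
    have hμ : ‖(ArithmeticFunction.moebius q : ℂ)‖ ≤ 1 := by
      rw [Complex.norm_intCast]
      exact_mod_cast ArithmeticFunction.abs_moebius_le_one
    refine div_le_one_of_le₀ (hμ.trans ?_) (Nat.cast_nonneg _)
    exact_mod_cast Nat.totient_pos.2 hq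
  have hbound : ∀ (q : ℕ) (r : ℤ) (l : ℤ),
      ‖(primeShift P ω ^ k) (rationalTwist q r (2 * Real.pi * l / D)) 1‖ ≤ (∑ p ∈ P, ω p) ^ k := by
    intro q r l
    have := norm_primeShift_pow_le_const hω hP0 (H := rationalTwist q r (2 * Real.pi * l / D))
      (C := 1) (fun n hn => (norm_rationalTwist _ _ _ hn).le) k 1 one_pos
    rwa [one_mul] at this
  have hsum : ∀ (q : ℕ) (r : ℤ), Summable fun l : ℤ => C l *
      (primeShift P ω ^ k) (rationalTwist q r (2 * Real.pi * l / D)) 1 := by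
    intro q r
    refine (hC1.mul_right ((∑ p ∈ P, ω p) ^ k)).of_norm_bounded fun l => ?_
    rw [norm_mul]
    gcongr
    exact hbound q r l
  have hγ : windowSum P ω k a γ = ∑' l : ℤ, C l *
      (primeShift P ω ^ k) (rationalTwist 1 0 (2 * Real.pi * l / D)) 1 := by
    rw [← hC2]; simp
  rw [hC2, hγ, ← tsum_mul_left, ← (hsum q r).tsum_sub ((hsum 1 0).mul_left m)]
  have hre : ∀ l : ℤ, C l * (primeShift P ω ^ k) (rationalTwist q r (2 * Real.pi * l / D)) 1 -
      m * (C l * (primeShift P ω ^ k) (rationalTwist 1 0 (2 * Real.pi * l / D)) 1) =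
      C l * ((primeShift P ω ^ k) (rationalTwist q r (2 * Real.pi * l / D)) 1 -
        m * (primeShift P ω ^ k) (rationalTwist 1 0 (2 * Real.pi * l / D)) 1) := fun l => by ring
  simp only [hre]
  refine (norm_tsum_le_of_split hC1 (fun _ => False)
    (fun l : ℤ => M < |(l:ℝ)|) (U := √q * B ^ k) (V := 0)
    (S := 2 * (∑ p ∈ P, ω p) ^ k) fun l => ?_).trans ?_
  · by_cases hl : M < |(l:ℝ)|
    · rw [if_pos hl]
      refine le_trans ?_ (le_add_of_nonneg_left (by simp; positivity))
      refine (norm_sub_le _ _).trans ?_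
      rw [norm_mul]
      have h1 := hbound q r l
      have h2 := hbound 1 0 l
      have h3 := mul_le_mul hm1 h2 (norm_nonneg _) zero_le_one
      linarith
    · have hR := abs_two_pi_mul_div_le hD1 (not_lt.1 hl)
      rw [if_neg hl]
      simp only [if_false, add_zero]
      refine norm_primeShift_pow_rationalTwist_sub_le_of_not_dvd hq hr hP hPq
        (fun r' hr' χ hχ => ?_) hBn k
      have := hB.character r' hr' χ hχ _ hR
      rwa [hfil] at this
  · rw [zero_mul, add_zero]
    gcongr
    exact hC4 M hM

end WindowSum

section TrigSum
open Complex Finset MeasureTheory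

/-- The exponential sum with weights `g` supported on `s`. -/
def trigSum (s : Finset ℕ) (g : ℕ → ℝ) (α : ℝ) : ℂ :=
  ∑ n ∈ s, (g n : ℂ) * phase (α * n)

variable {s s₁ s₂ : Finset ℕ} {g g₁ g₂ : ℕ → ℝ}

lemma continuous_phase : Continuous phase := by
  unfold phase
  fun_prop

lemma continuous_trigSum : Continuous (trigSum s g) := by
  unfold trigSum
  have := continuous_phase
  fun_prop

lemma norm_trigSum_le (hg : ∀ n ∈ s, 0 ≤ g n) (α : ℝ) : ‖trigSum s g α‖ ≤ ∑ n ∈ s, g n := by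
  refine (norm_sum_le _ _).trans (sum_le_sum fun n hn => ?_)
  rw [norm_mul, norm_phase, mul_one, norm_real, Real.norm_of_nonneg (hg n hn)]

lemma trigSum_add_intCast (α : ℝ) (m : ℤ) : trigSum s g (α + m) = trigSum s g α := by
  refine sum_congr rfl fun n _ => ?_
  rw [add_mul, phase_add, show (m * n : ℝ) = ((m * n : ℤ) : ℝ) by push_cast; ring,
    phase_intCast, mul_one]

lemma phase_natCast_div_two {n : ℕ} (hn : Odd n) : phase (1 / 2 * n) = -1 := by
  obtain ⟨m, rfl⟩ := hn
  rw [show (1 / 2 * ((2 * m + 1 : ℕ) : ℝ)) = ((m : ℤ) : ℝ) + 1 / 2 by push_cast; ring, phase_add,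
    phase_intCast, one_mul, phase]
  rw [show (((2 * Real.pi * (1 / 2) : ℝ) : ℂ) * I) = Real.pi * I by push_cast; ring, exp_pi_mul_I]

lemma norm_trigSum_half_add (hodd : ∀ n ∈ s, Odd n) (γ : ℝ) :
    ‖trigSum s g (1 / 2 + γ)‖ = ‖trigSum s g γ‖ := by
  rw [← norm_neg (trigSum s g γ)]
  congr 1
  rw [trigSum, trigSum, ← sum_neg_distrib]
  refine sum_congr rfl fun n hn => ?_
  rw [add_mul, phase_add, phase_natCast_div_two (hodd n hn)]
  ring

lemma one_sub_le_re_phase (x : ℝ) : 1 - 20 * x ^ 2 ≤ (phase x).re := by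
  rw [phase, exp_ofReal_mul_I_re]
  have h1 := Real.one_sub_sq_div_two_le_cos (x := 2 * Real.pi * x)
  have h2 : Real.pi ^ 2 ≤ 10 := by nlinarith [Real.pi_lt_d2, Real.pi_pos]
  nlinarith [sq_nonneg x]

lemma le_re_trigSum (hg : ∀ n ∈ s, 0 ≤ g n) {α κ : ℝ}
    (h : ∀ n ∈ s, g n ≠ 0 → 20 * (α * n) ^ 2 ≤ κ) :
    (1 - κ) * ∑ n ∈ s, g n ≤ (trigSum s g α).re := by
  rw [trigSum, re_sum, mul_sum]
  refine sum_le_sum fun n hn => ?_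
  rw [re_ofReal_mul]
  by_cases h0 : g n = 0
  · simp [h0]
  · rw [mul_comm]
    exact mul_le_mul_of_nonneg_left (by linarith [h n hn h0, one_sub_le_re_phase (α * n)])
      (hg n hn)

lemma integral_phase_intCast (c : ℝ) (m : ℤ) :
    ∫ α in c..c + 1, phase (α * m) = if m = 0 then 1 else 0 := by
  split_ifs with h
  · simp [h, phase]
  · have hne : (2 * Real.pi * m : ℝ) * I ≠ 0 := by
      have := Real.pi_ne_zero
      simp [h, this]
    have : ∀ α : ℝ, phase (α * m) = cexp (((2 * Real.pi * m : ℝ) * I) * α) := fun α => by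
      rw [phase]; congr 1; push_cast; ring
    simp_rw [this]
    rw [integral_exp_mul_complex hne, ← this, ← this, add_mul, phase_add, one_mul, phase_intCast]
    simp

lemma conj_phase (x : ℝ) : (starRingEnd ℂ) (phase x) = phase (-x) := by
  rw [phase, phase, ← exp_conj, map_mul, conj_ofReal, conj_I]
  congr 1; push_cast; ring

/-- If `2 a + b = c` has no solutions, the circle-method integral vanishes. -/
lemma integral_trigSum_eq_zero (c : ℝ)
    (h : ∀ n₁ ∈ s₁, ∀ n₂ ∈ s₂, ∀ n₃ ∈ s₂, 2 * n₁ + n₂ ≠ n₃) :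
    ∫ α in c..c + 1, trigSum s₁ g₁ (2 * α) *
      (trigSum s₂ g₂ α * (starRingEnd ℂ) (trigSum s₂ g₂ α)) = 0 := by
  have hp := continuous_phase
  have : ∀ α : ℝ, trigSum s₁ g₁ (2 * α) *
      (trigSum s₂ g₂ α * (starRingEnd ℂ) (trigSum s₂ g₂ α)) =
      ∑ n₁ ∈ s₁, ∑ n₂ ∈ s₂, ∑ n₃ ∈ s₂, ((g₁ n₁ * g₂ n₂ * g₂ n₃ : ℝ) : ℂ) *
        phase (α * ((2 * n₁ + n₂ - n₃ : ℤ) : ℝ)) := by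
    intro α
    simp only [trigSum, map_sum, sum_mul_sum]
    refine sum_congr rfl fun n₁ _ => ?_
    refine sum_congr rfl fun n₂ _ => ?_
    rw [mul_sum]
    refine sum_congr rfl fun n₃ _ => ?_
    rw [map_mul, conj_ofReal, conj_phase,
      show α * ((2 * n₁ + n₂ - n₃ : ℤ) : ℝ) = 2 * α * n₁ + (α * n₂ + -(α * n₃)) by push_cast; ring,
      phase_add, phase_add]
    push_cast; ring
  simp_rw [this]
  rw [intervalIntegral.integral_finsetSum fun _ _ => Continuous.intervalIntegrable (by fun_prop) _ _]
  refine sum_eq_zero fun n₁ h₁ => ?_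
  rw [intervalIntegral.integral_finsetSum fun _ _ => Continuous.intervalIntegrable (by fun_prop) _ _]
  refine sum_eq_zero fun n₂ h₂ => ?_
  rw [intervalIntegral.integral_finsetSum fun _ _ => Continuous.intervalIntegrable (by fun_prop) _ _]
  refine sum_eq_zero fun n₃ h₃ => ?_
  rw [intervalIntegral.integral_const_mul, integral_phase_intCast, if_neg, mul_zero]
  have := h n₁ h₁ n₂ h₂ n₃ h₃
  omega

lemma integral_norm_trigSum_sq (c : ℝ) (j : ℕ) (hj : 0 < j) :
    ∫ α in c..c + 1, ‖trigSum s g (j * α)‖ ^ 2 = ∑ n ∈ s, g n ^ 2 := by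
  have hp := continuous_phase
  have : ∀ α : ℝ, ((‖trigSum s g (j * α)‖ ^ 2 : ℝ) : ℂ) =
      ∑ n₂ ∈ s, ∑ n₃ ∈ s, ((g n₂ * g n₃ : ℝ) : ℂ) *
        phase (α * ((j * (n₂ - n₃) : ℤ) : ℝ)) := by
    intro α
    rw [← normSq_eq_norm_sq, ← mul_conj]
    simp only [trigSum, map_sum, sum_mul_sum]
    refine sum_congr rfl fun n₂ _ => ?_
    refine sum_congr rfl fun n₃ _ => ?_
    rw [map_mul, conj_ofReal, conj_phase,
      show α * ((j * (n₂ - n₃) : ℤ) : ℝ) = (j * α * n₂ + -(j * α * n₃)) by push_cast; ring,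
      phase_add]
    push_cast; ring
  apply ofReal_injective
  rw [← intervalIntegral.integral_ofReal]
  simp_rw [this]
  rw [intervalIntegral.integral_finsetSum fun _ _ => Continuous.intervalIntegrable (by fun_prop) _ _,
    ofReal_sum]
  refine sum_congr rfl fun n₂ h₂ => ?_
  rw [intervalIntegral.integral_finsetSum fun _ _ => Continuous.intervalIntegrable (by fun_prop) _ _,
    sum_eq_single_of_mem n₂ h₂]
  · rw [intervalIntegral.integral_const_mul, integral_phase_intCast]
    simp [sq]
  · intro n₃ _ hne
    rw [intervalIntegral.integral_const_mul, integral_phase_intCast, if_neg, mul_zero]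
    have : (n₂ : ℤ) - n₃ ≠ 0 := by omega
    positivity

end TrigSum

section ArcBounds
open Complex Finset

/-- Bounds for an exponential sum near rationals with denominator at most `Q`, together with an
approximation near rationals with denominator at most `q₀`. -/
structure ArcBound (E : ℝ → ℂ) (Q q₀ : ℕ) (x Γ δ V : ℝ) : Prop where
  bound : ∀ (q : ℕ) (a : ℤ) (γ : ℝ), 1 ≤ q → q ≤ Q → IsCoprime a (q : ℤ) →
    |γ| ≤ 2 / (q * Q) → ‖E (a / q + γ)‖ ≤ δ + V * (q : ℝ) ^ (-(4 / 5) : ℝ) / (1 + x * |γ|)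
  approx : ∀ (q : ℕ) (a : ℤ) (γ : ℝ), 1 ≤ q → q ≤ q₀ → IsCoprime a (q : ℤ) → |γ| ≤ 2 * Γ →
    ‖E (a / q + γ) - (ArithmeticFunction.moebius q : ℂ) / q.totient * E γ‖ ≤ δ

lemma exists_double_fraction {q : ℕ} (hq : 1 ≤ q) {a : ℤ} (ha : IsCoprime a (q : ℤ)) :
    ∃ a' : ℤ, IsCoprime a' ((q / Nat.gcd 2 q : ℕ) : ℤ) ∧
      2 * ((a : ℝ) / q) = a' / ((q / Nat.gcd 2 q : ℕ) : ℝ) := by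
  rcases Nat.even_or_odd' q with ⟨m, rfl | rfl⟩
  · have h2 : 2 * m / Nat.gcd 2 (2 * m) = m := by
      rw [Nat.gcd_mul_right_right]; omega
    rw [h2]
    have hm : (m : ℝ) ≠ 0 := by
      have : m ≠ 0 := by omega
      exact_mod_cast this
    refine ⟨a, ?_, by push_cast; field_simp⟩
    push_cast at ha
    exact ha.of_mul_right_right
  · have h2 : (2 * m + 1) / Nat.gcd 2 (2 * m + 1) = 2 * m + 1 := by
      have : Nat.gcd 2 (2 * m + 1) = 1 :=
        Nat.coprime_two_left.2 ⟨m, rfl⟩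
      rw [this, Nat.div_one]
    rw [h2]
    refine ⟨2 * a, ?_, by push_cast; ring⟩
    refine IsCoprime.mul_left ?_ ha
    exact ⟨-m, 1, by push_cast; ring⟩

lemma le_two_mul_div_gcd (q : ℕ) : q ≤ 2 * (q / Nat.gcd 2 q) := by
  have h1 : Nat.gcd 2 q ≤ 2 := Nat.gcd_le_left _ (by norm_num)
  have h2 := Nat.div_mul_cancel (Nat.gcd_dvd_right 2 q)
  nlinarith [Nat.zero_le (q / Nat.gcd 2 q)]

lemma minor_arc_arith {e₁ e₂ δ₁ δ₂ V₁ V₂ κ T : ℝ} {q Q₂ : ℕ} (hq : 1 ≤ q) (he₁ : 0 ≤ e₁)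
    (he₂ : 0 ≤ e₂) (hT : 0 ≤ T) (hV₁ : 0 ≤ V₁) (hV₂ : 0 ≤ V₂) (hδ₁ : 0 ≤ δ₁) (hδ₂ : 0 ≤ δ₂)
    (h₁ : e₁ ≤ δ₁ + 2 * V₁ * (q : ℝ) ^ (-(4 / 5) : ℝ))
    (h₂ : e₂ ≤ δ₂ + V₂ * (q : ℝ) ^ (-(4 / 5) : ℝ) / (1 + T))
    (hQ₂ : V₂ ≤ δ₂ * (Q₂ : ℝ) ^ (4 / 5 : ℝ))
    (hκ : (q : ℝ) ^ (-(39 / 100) : ℝ) * (1 + T) ^ (-(1 / 2) : ℝ) ≤ κ) :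
    e₁ * e₂ ^ 2 ≤ 2 * δ₂ * (e₁ * e₂) + (if q ≤ Q₂ then
      4 * V₂ ^ 2 * (δ₁ * (Q₂ : ℝ) ^ (41 / 100 : ℝ) + 2 * V₁ * κ) *
        ((q : ℝ) ^ (-(201 / 100) : ℝ) * (1 + T) ^ (-(3 / 2) : ℝ)) else 0) := by
  have hq0 : (0:ℝ) < q := by exact_mod_cast hq
  have h1T : 1 ≤ 1 + T := by linarith
  have hT0 : 0 < 1 + T := by linarith
  have hκ0 : 0 ≤ κ := le_trans (by positivity) hκ
  by_cases he : e₂ ≤ 2 * δ₂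
  · have : e₁ * e₂ ^ 2 ≤ 2 * δ₂ * (e₁ * e₂) := by
      have := mul_le_mul_of_nonneg_left he (mul_nonneg he₁ he₂)
      linarith
    refine this.trans (le_add_of_nonneg_right ?_)
    split_ifs <;> positivity
  set v := V₂ * (q : ℝ) ^ (-(4 / 5) : ℝ) / (1 + T) with hv
  have hev : e₂ ≤ 2 * v := by linarith
  have hδv : δ₂ < v := by linarith
  have hqQ : q ≤ Q₂ := by
    by_contra! hlt
    have h3 : v ≤ V₂ * (q : ℝ) ^ (-(4 / 5) : ℝ) := div_le_self (by positivity) h1T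
    have h4 : (Q₂ : ℝ) ^ (4 / 5 : ℝ) ≤ (q : ℝ) ^ (4 / 5 : ℝ) :=
      Real.rpow_le_rpow (by positivity) (by exact_mod_cast hlt.le) (by norm_num)
    have h5 : V₂ * (q : ℝ) ^ (-(4 / 5) : ℝ) ≤ δ₂ := by
      rw [Real.rpow_neg hq0.le, ← div_eq_mul_inv, div_le_iff₀ (by positivity)]
      exact hQ₂.trans (mul_le_mul_of_nonneg_left h4 hδ₂)
    linarith
  rw [if_pos hqQ]
  have h4 : e₁ * e₂ ^ 2 ≤ (δ₁ + 2 * V₁ * (q : ℝ) ^ (-(4 / 5) : ℝ)) * (2 * v) ^ 2 := by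
    gcongr
  refine h4.trans (le_trans ?_ (le_add_of_nonneg_left (by positivity)))
  have hv2 : (2 * v) ^ 2 = 4 * V₂ ^ 2 * ((q : ℝ) ^ (-(8 / 5) : ℝ) * (1 + T) ^ (-2 : ℝ)) := by
    rw [hv, mul_pow, div_pow, mul_pow, ← Real.rpow_natCast ((q:ℝ) ^ _), ← Real.rpow_mul hq0.le,
      Real.rpow_neg hT0.le, Real.rpow_two]
    norm_num
    ring
  have hA : (q : ℝ) ^ (-(8 / 5) : ℝ) * (1 + T) ^ (-2 : ℝ) ≤
      (Q₂ : ℝ) ^ (41 / 100 : ℝ) * ((q : ℝ) ^ (-(201 / 100) : ℝ) * (1 + T) ^ (-(3 / 2) : ℝ)) := by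
    have e : (q : ℝ) ^ (-(8 / 5) : ℝ) = (q : ℝ) ^ (41 / 100 : ℝ) * (q : ℝ) ^ (-(201 / 100) : ℝ) := by
      rw [← Real.rpow_add hq0]; norm_num
    rw [e, mul_assoc]
    have := Real.rpow_le_rpow_of_exponent_le h1T (show (-2 : ℝ) ≤ -(3 / 2) by norm_num)
    gcongr
  have hB : (q : ℝ) ^ (-(4 / 5) : ℝ) * ((q : ℝ) ^ (-(8 / 5) : ℝ) * (1 + T) ^ (-2 : ℝ)) ≤
      κ * ((q : ℝ) ^ (-(201 / 100) : ℝ) * (1 + T) ^ (-(3 / 2) : ℝ)) := by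
    refine le_trans (le_of_eq ?_) (mul_le_mul_of_nonneg_right hκ (by positivity))
    have e1 : (q : ℝ) ^ (-(4 / 5) : ℝ) * (q : ℝ) ^ (-(8 / 5) : ℝ) =
        (q : ℝ) ^ (-(39 / 100) : ℝ) * (q : ℝ) ^ (-(201 / 100) : ℝ) := by
      rw [← Real.rpow_add hq0, ← Real.rpow_add hq0]; norm_num
    have e2 : (1 + T) ^ (-2 : ℝ) = (1 + T) ^ (-(1 / 2) : ℝ) * (1 + T) ^ (-(3 / 2) : ℝ) := by
      rw [← Real.rpow_add hT0]; norm_num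
    rw [← mul_assoc, e1, e2]; ring
  rw [hv2]
  have hA' := mul_le_mul_of_nonneg_left hA (show 0 ≤ 4 * V₂ ^ 2 * δ₁ by positivity)
  have hB' := mul_le_mul_of_nonneg_left hB (show 0 ≤ 8 * V₂ ^ 2 * V₁ by positivity)
  linarith

variable {E₁ E₂ : ℝ → ℂ} {Q q₀ Q₂ : ℕ} {x x₁ Γ δ₁ δ₂ V₁ V₂ κ N₁ N₂ : ℝ}

lemma ArcBound.norm_double_le (hE : ArcBound E₁ Q q₀ x Γ δ₁ V₁) (hx : 0 ≤ x) (hV₁ : 0 ≤ V₁)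
    {q : ℕ} {a : ℤ} {γ : ℝ} (hq : 1 ≤ q) (hqQ : q ≤ Q) (ha : IsCoprime a (q : ℤ))
    (hγ : |γ| ≤ 1 / (q * Q)) :
    ‖E₁ (2 * (a / q + γ))‖ ≤ δ₁ + 2 * V₁ * (q : ℝ) ^ (-(4 / 5) : ℝ) := by
  obtain ⟨a', ha', he⟩ := exists_double_fraction hq ha
  set q' := q / Nat.gcd 2 q with hq'
  have hle : q' ≤ q := Nat.div_le_self _ _
  have hle2 : q ≤ 2 * q' := le_two_mul_div_gcd q
  have hq'1 : 1 ≤ q' := by omega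
  have hq0 : (0:ℝ) < q := by exact_mod_cast hq
  have hQ0 : (0:ℝ) < Q := by exact_mod_cast hq.trans hqQ
  have hq'0 : (0:ℝ) < q' := by exact_mod_cast hq'1
  have h2γ : |2 * γ| ≤ 2 / (q' * Q) := by
    rw [abs_mul, abs_two]
    calc 2 * |γ| ≤ 2 * (1 / (q * Q)) := by gcongr
      _ = 2 / (q * Q) := by ring
      _ ≤ 2 / (q' * Q) := by gcongr
  have := hE.bound q' a' (2 * γ) hq'1 (hle.trans hqQ) ha' h2γ
  rw [mul_add, he]
  refine this.trans ?_
  gcongr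
  refine (div_le_self (by positivity) (by nlinarith [abs_nonneg (2 * γ)])).trans ?_
  rw [mul_comm (2:ℝ), mul_assoc]
  refine mul_le_mul_of_nonneg_left ?_ hV₁
  have h1 : (q' : ℝ) ^ (-(4 / 5) : ℝ) ≤ ((q : ℝ) / 2) ^ (-(4 / 5) : ℝ) := by
    refine Real.rpow_le_rpow_of_nonpos (by positivity) ?_ (by norm_num)
    rw [div_le_iff₀ two_pos]
    have : (q : ℝ) ≤ ((2 * q' : ℕ) : ℝ) := by exact_mod_cast hle2
    push_cast at this; linarith
  refine h1.trans ?_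
  rw [Real.div_rpow hq0.le two_pos.le, Real.rpow_neg two_pos.le, div_inv_eq_mul, mul_comm]
  refine mul_le_mul_of_nonneg_right ?_ (by positivity)
  calc (2:ℝ) ^ (4 / 5 : ℝ) ≤ 2 ^ (1 : ℝ) :=
        Real.rpow_le_rpow_of_exponent_le (by norm_num) (by norm_num)
    _ = 2 := Real.rpow_one 2

lemma ArcBound.minor_le (hE₁ : ArcBound E₁ Q q₀ x₁ Γ δ₁ V₁) (hE₂ : ArcBound E₂ Q q₀ x Γ δ₂ V₂)
    (hx₁ : 0 ≤ x₁) (hx : 0 ≤ x) (hΓ : 0 ≤ Γ) (hV₁ : 0 ≤ V₁) (hV₂ : 0 ≤ V₂) (hδ₁ : 0 ≤ δ₁) (hδ₂ : 0 ≤ δ₂)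
    (hq₀ : 1 ≤ q₀) (hQ₂ : V₂ ≤ δ₂ * (Q₂ : ℝ) ^ (4 / 5 : ℝ))
    (hκ₁ : (q₀ : ℝ) ^ (-(39 / 100) : ℝ) ≤ κ) (hκ₂ : (1 + x * Γ) ^ (-(1 / 2) : ℝ) ≤ κ)
    {q : ℕ} {a : ℤ} {γ : ℝ} (hq : 1 ≤ q) (hqQ : q ≤ Q) (ha : IsCoprime a (q : ℤ))
    (hγ : |γ| ≤ 1 / (q * Q)) (hminor : q₀ < q ∨ Γ ≤ |γ|) :
    ‖E₁ (2 * (a / q + γ))‖ * ‖E₂ (a / q + γ)‖ ^ 2 ≤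
      2 * δ₂ * (‖E₁ (2 * (a / q + γ))‖ * ‖E₂ (a / q + γ)‖) + (if q ≤ Q₂ then
      4 * V₂ ^ 2 * (δ₁ * (Q₂ : ℝ) ^ (41 / 100 : ℝ) + 2 * V₁ * κ) *
        ((q : ℝ) ^ (-(201 / 100) : ℝ) * (1 + x * |γ|) ^ (-(3 / 2) : ℝ)) else 0) := by
  have hq1 : (1:ℝ) ≤ q := by exact_mod_cast hq
  have hq0 : (0:ℝ) < q := by linarith
  have hT : 0 ≤ x * |γ| := by positivity
  refine minor_arc_arith hq (norm_nonneg _) (norm_nonneg _) hT hV₁ hV₂ hδ₁ hδ₂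
    (hE₁.norm_double_le hx₁ hV₁ hq hqQ ha hγ) (hE₂.bound q a γ hq hqQ ha (hγ.trans ?_)) hQ₂ ?_
  · gcongr; norm_num
  · rcases hminor with h | h
    · refine le_trans ?_ hκ₁
      calc (q : ℝ) ^ (-(39 / 100) : ℝ) * (1 + x * |γ|) ^ (-(1 / 2) : ℝ)
          ≤ (q : ℝ) ^ (-(39 / 100) : ℝ) * 1 := by
            refine mul_le_mul_of_nonneg_left ?_ (by positivity)
            exact Real.rpow_le_one_of_one_le_of_nonpos (by linarith) (by norm_num)
        _ ≤ _ := by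
            rw [mul_one]
            refine Real.rpow_le_rpow_of_nonpos (by exact_mod_cast hq₀) ?_ (by norm_num)
            exact_mod_cast h.le
    · refine le_trans ?_ hκ₂
      calc (q : ℝ) ^ (-(39 / 100) : ℝ) * (1 + x * |γ|) ^ (-(1 / 2) : ℝ)
          ≤ 1 * (1 + x * |γ|) ^ (-(1 / 2) : ℝ) := by
            refine mul_le_mul_of_nonneg_right ?_ (by positivity)
            exact Real.rpow_le_one_of_one_le_of_nonpos hq1 (by norm_num)
        _ ≤ _ := by
            rw [one_mul]
            refine Real.rpow_le_rpow_of_nonpos (by positivity) ?_ (by norm_num)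
            gcongr

lemma ArcBound.norm_approx_le (hE : ArcBound E₁ Q q₀ x Γ δ₁ V₁) {q : ℕ} {a : ℤ} {γ : ℝ}
    (hq : 1 ≤ q) (hqq : q ≤ q₀) (ha : IsCoprime a (q : ℤ)) (hγ : |γ| ≤ 2 * Γ) :
    ‖E₁ (a / q + γ)‖ ≤
      |(ArithmeticFunction.moebius q : ℝ)| / q.totient * ‖E₁ γ‖ + δ₁ := by
  have h := hE.approx q a γ hq hqq ha hγ
  have h2 : ‖(ArithmeticFunction.moebius q : ℂ) / q.totient * E₁ γ‖ =
      |(ArithmeticFunction.moebius q : ℝ)| / q.totient * ‖E₁ γ‖ := by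
    rw [norm_mul, norm_div, norm_natCast, norm_intCast]
  rw [← h2]
  have := norm_sub_norm_le (E₁ (a / q + γ))
    ((ArithmeticFunction.moebius q : ℂ) / q.totient * E₁ γ)
  linarith

lemma ArcBound.major_le (hE₁ : ArcBound E₁ Q q₀ x₁ Γ δ₁ V₁) (hE₂ : ArcBound E₂ Q q₀ x Γ δ₂ V₂)
    (hN₁ : ∀ α, ‖E₁ α‖ ≤ N₁) (hN₂ : ∀ α, ‖E₂ α‖ ≤ N₂) (hδ₁ : 0 ≤ δ₁) (hδ₂ : 0 ≤ δ₂)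
    (hδN : δ₂ ≤ N₂) {q : ℕ} {a : ℤ} {γ : ℝ} (hq : 1 ≤ q) (hqq : q ≤ q₀)
    (ha : IsCoprime a (q : ℤ)) (hγ : |γ| ≤ Γ) :
    ‖E₁ (2 * (a / q + γ))‖ * ‖E₂ (a / q + γ)‖ ^ 2 ≤
      N₁ * (1 / ((q / Nat.gcd 2 q).totient : ℝ) *
        (|(ArithmeticFunction.moebius q : ℝ)| / q.totient) ^ 2) * ‖E₂ γ‖ ^ 2 +
      (3 * N₁ * N₂ * δ₂ + 4 * δ₁ * N₂ ^ 2) := by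
  have hN₁0 : 0 ≤ N₁ := (norm_nonneg _).trans (hN₁ 0)
  have hN₂0 : 0 ≤ N₂ := (norm_nonneg _).trans (hN₂ 0)
  have hΓ : 0 ≤ Γ := (abs_nonneg _).trans hγ
  obtain ⟨a', ha', he⟩ := exists_double_fraction hq ha
  set q' := q / Nat.gcd 2 q with hq'
  have hle : q' ≤ q := Nat.div_le_self _ _
  have hle2 : q ≤ 2 * q' := le_two_mul_div_gcd q
  have hq'1 : 1 ≤ q' := by omega
  have hmu : ∀ n : ℕ, |(ArithmeticFunction.moebius n : ℝ)| ≤ 1 := fun n => by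
    exact_mod_cast ArithmeticFunction.abs_moebius_le_one
  have hφ : ∀ n : ℕ, 1 ≤ n → (1:ℝ) ≤ n.totient := fun n hn => by
    exact_mod_cast Nat.totient_pos.2 hn
  have h1 : ‖E₁ (2 * (a / q + γ))‖ ≤ N₁ * (1 / (q'.totient : ℝ)) + δ₁ := by
    rw [mul_add, he]
    refine (hE₁.norm_approx_le hq'1 (hle.trans hqq) ha'
      (by rw [abs_mul, abs_two]; linarith)).trans ?_
    rw [mul_comm N₁]
    have := hφ q' hq'1
    gcongr
    · exact hmu _
    · exact hN₁ _
  have h2 := hE₂.norm_approx_le hq hqq ha (hγ.trans (by linarith))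
  set m := |(ArithmeticFunction.moebius q : ℝ)| / q.totient
  set f := 1 / (q'.totient : ℝ) with hf
  have hm0 : 0 ≤ m := by positivity
  have hm1 : m ≤ 1 := div_le_one_of_le₀ ((hmu q).trans (hφ q hq)) (by positivity)
  have hf0 : 0 ≤ f := by positivity
  have hf1 : f ≤ 1 := by
    rw [hf]; exact div_le_one_of_le₀ (hφ q' hq'1) (by positivity)
  have hγN := hN₂ γ
  set e := ‖E₂ γ‖
  have he0 : 0 ≤ e := norm_nonneg _
  calc ‖E₁ (2 * (a / q + γ))‖ * ‖E₂ (a / q + γ)‖ ^ 2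
      ≤ (N₁ * f + δ₁) * (m * e + δ₂) ^ 2 := by gcongr
    _ = N₁ * (f * m ^ 2) * e ^ 2 + (N₁ * f * (2 * (m * e) * δ₂ + δ₂ * δ₂) +
          δ₁ * (m * e + δ₂) ^ 2) := by ring
    _ ≤ N₁ * (f * m ^ 2) * e ^ 2 + (N₁ * 1 * (2 * (1 * N₂) * δ₂ + N₂ * δ₂) +
          δ₁ * (1 * N₂ + N₂) ^ 2) := by gcongr
    _ = _ := by ring

end ArcBounds

section CircleMethod
open Complex Finset MeasureTheory

lemma exists_reduced_fraction {α Γ : ℝ} {Q : ℕ} (hQ : 1 ≤ Q) (hΓ : 0 ≤ Γ) (hΓQ : Γ * Q ≤ 1 / 4)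
    (h₁ : -Γ ≤ α) (h₂ : α ≤ 1 - Γ) :
    ∃ q a : ℕ, 1 ≤ q ∧ q ≤ Q ∧ a ≤ q ∧ Nat.Coprime q a ∧ |α - a / q| ≤ 1 / (q * Q) := by
  obtain ⟨r, hr, hrQ⟩ := Real.exists_rat_abs_sub_le_and_den_le α (n := Q) (by omega)
  have hd : (0:ℝ) < r.den := by exact_mod_cast r.den_pos
  have hQ1 : (1:ℝ) ≤ Q := by exact_mod_cast hQ
  have hdQ : (r.den : ℝ) ≤ Q := by exact_mod_cast hrQ
  have hrr : (r : ℝ) = r.num / r.den := Rat.cast_def r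
  have hr2 : |α * r.den - r.num| ≤ 1 / 2 := by
    have e : α * r.den - r.num = (α - r) * r.den := by rw [hrr]; field_simp
    rw [e, abs_mul, abs_of_pos hd]
    calc |α - r| * r.den ≤ 1 / ((Q + 1) * r.den) * r.den := by gcongr
      _ = 1 / (Q + 1) := by field_simp
      _ ≤ 1 / 2 := by gcongr; linarith
  rw [abs_le] at hr2
  have hΓd : Γ * r.den ≤ 1 / 4 := le_trans (by gcongr) hΓQ
  have hΓd0 : 0 ≤ Γ * r.den := by positivity
  have h₁' := mul_le_mul_of_nonneg_right h₁ hd.le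
  have h₂' := mul_le_mul_of_nonneg_right h₂ hd.le
  have hn0 : 0 ≤ r.num := by
    have : (-1:ℝ) < r.num := by linarith
    have : -1 < r.num := by exact_mod_cast this
    omega
  have hn1 : r.num ≤ r.den := by
    have : (r.num : ℝ) < r.den + 1 := by linarith
    have : r.num < r.den + 1 := by exact_mod_cast this
    omega
  obtain ⟨a, ha⟩ := Int.eq_ofNat_of_zero_le hn0
  refine ⟨r.den, a, r.den_pos, hrQ, by omega, ?_, ?_⟩
  · have := r.reduced
    rw [ha, Int.natAbs_natCast] at this
    exact this.symm
  · have e : ((a : ℝ) / r.den) = r := by rw [hrr, ha]; simp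
    rw [e]
    refine hr.trans ?_
    rw [mul_comm (r.den : ℝ)]
    gcongr
    linarith

/-- The part of the majorant coming from denominators between `3` and `q₀`. -/
def majorSum (q₀ : ℕ) (N R : ℝ) (k k' : ℝ → ℝ) (α : ℝ) : ℝ :=
  ∑ q ∈ Icc 3 q₀, ∑ a ∈ range q with q.Coprime a,
    (N * (1 / ((q / Nat.gcd 2 q).totient : ℝ) *
      (|(ArithmeticFunction.moebius q : ℝ)| / q.totient) ^ 2) * k (α - a / q) +
      R * k' (α - a / q))

/-- The part of the majorant coming from the remaining arcs. -/
def minorSum (Q₂ : ℕ) (k : ℝ → ℝ) (α : ℝ) : ℝ :=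
  ∑ q ∈ Icc 1 Q₂, ∑ a ∈ range (q + 1), (q : ℝ) ^ (-(201 / 100) : ℝ) * k (α - a / q)

lemma majorSum_nonneg {q₀ : ℕ} {N R : ℝ} {k k' : ℝ → ℝ} (hN : 0 ≤ N) (hR : 0 ≤ R)
    (hk : ∀ β, 0 ≤ k β) (hk' : ∀ β, 0 ≤ k' β) (α : ℝ) : 0 ≤ majorSum q₀ N R k k' α := by
  refine sum_nonneg fun q _ => sum_nonneg fun a _ => ?_
  have := hk (α - a / q)
  have := hk' (α - a / q)
  positivity

lemma minorSum_nonneg {Q₂ : ℕ} {k : ℝ → ℝ} (hk : ∀ β, 0 ≤ k β) (α : ℝ) :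
    0 ≤ minorSum Q₂ k α :=
  sum_nonneg fun q _ => sum_nonneg fun a _ => mul_nonneg (by positivity) (hk _)

lemma le_majorSum {q₀ : ℕ} {N R : ℝ} {k k' : ℝ → ℝ} (hN : 0 ≤ N) (hR : 0 ≤ R)
    (hk : ∀ β, 0 ≤ k β) (hk' : ∀ β, 0 ≤ k' β) (α : ℝ) {q a : ℕ} (hq : 3 ≤ q) (hqq : q ≤ q₀)
    (ha : a < q) (hc : q.Coprime a) :
    N * (1 / ((q / Nat.gcd 2 q).totient : ℝ) *
      (|(ArithmeticFunction.moebius q : ℝ)| / q.totient) ^ 2) * k (α - a / q) +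
      R * k' (α - a / q) ≤ majorSum q₀ N R k k' α := by
  have hnn : ∀ q a : ℕ, 0 ≤ N * (1 / ((q / Nat.gcd 2 q).totient : ℝ) *
      (|(ArithmeticFunction.moebius q : ℝ)| / q.totient) ^ 2) * k (α - a / q) +
      R * k' (α - a / q) := fun q a => by
    have := hk (α - a / q)
    have := hk' (α - a / q)
    positivity
  refine le_trans ?_ (single_le_sum (f := fun q : ℕ => ∑ a ∈ range q with q.Coprime a,
    (N * (1 / ((q / Nat.gcd 2 q).totient : ℝ) *
      (|(ArithmeticFunction.moebius q : ℝ)| / q.totient) ^ 2) * k (α - a / q) +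
      R * k' (α - a / q))) (fun q _ => sum_nonneg fun a _ => hnn q a) (mem_Icc.2 ⟨hq, hqq⟩))
  exact single_le_sum (f := fun a : ℕ => N * (1 / ((q / Nat.gcd 2 q).totient : ℝ) *
      (|(ArithmeticFunction.moebius q : ℝ)| / q.totient) ^ 2) * k (α - a / q) +
      R * k' (α - a / q)) (fun a _ => hnn q a) (mem_filter.2 ⟨mem_range.2 ha, hc⟩)

lemma le_minorSum {Q₂ : ℕ} {k : ℝ → ℝ} (hk : ∀ β, 0 ≤ k β) (α : ℝ) {q a : ℕ} (hq : 1 ≤ q)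
    (hqq : q ≤ Q₂) (ha : a ≤ q) :
    (q : ℝ) ^ (-(201 / 100) : ℝ) * k (α - a / q) ≤ minorSum Q₂ k α := by
  have hnn : ∀ q a : ℕ, 0 ≤ (q : ℝ) ^ (-(201 / 100) : ℝ) * k (α - a / q) := fun q a =>
    mul_nonneg (by positivity) (hk _)
  refine le_trans ?_ (single_le_sum (f := fun q : ℕ => ∑ a ∈ range (q + 1),
    (q : ℝ) ^ (-(201 / 100) : ℝ) * k (α - a / q)) (fun q _ => sum_nonneg fun a _ => hnn q a)
    (mem_Icc.2 ⟨hq, hqq⟩))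
  exact single_le_sum (f := fun a : ℕ => (q : ℝ) ^ (-(201 / 100) : ℝ) * k (α - a / q))
    (fun a _ => hnn q a) (mem_range.2 (by omega))

variable {E₁ E₂ : ℝ → ℂ} {Q q₀ Q₂ : ℕ} {x x₁ Γ δ₁ δ₂ V₁ V₂ κ N₁ N₂ : ℝ}

/-- Pointwise lower bound for the circle-method integrand. -/
lemma ArcBound.le_integrand (hE₁ : ArcBound E₁ Q q₀ x₁ Γ δ₁ V₁)
    (hE₂ : ArcBound E₂ Q q₀ x Γ δ₂ V₂) (hN₁ : ∀ α, ‖E₁ α‖ ≤ N₁) (hN₂ : ∀ α, ‖E₂ α‖ ≤ N₂)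
    (hδN : δ₂ ≤ N₂) (hx₁ : 0 ≤ x₁) (hx : 0 ≤ x) (hΓ : 0 ≤ Γ) (hV₁ : 0 ≤ V₁) (hV₂ : 0 ≤ V₂)
    (hδ₁ : 0 ≤ δ₁)
    (hδ₂ : 0 ≤ δ₂) (hQ : 1 ≤ Q) (hq₀ : 1 ≤ q₀) (hQ₂ : V₂ ≤ δ₂ * (Q₂ : ℝ) ^ (4 / 5 : ℝ))
    (hκ₁ : (q₀ : ℝ) ^ (-(39 / 100) : ℝ) ≤ κ) (hκ₂ : (1 + x * Γ) ^ (-(1 / 2) : ℝ) ≤ κ)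
    (hΓQ : Γ * Q ≤ 1 / 8)
    (hmain : ∀ γ, |γ| ≤ Γ → 9 / 10 * N₁ ≤ (E₁ (2 * γ)).re)
    (hper : ∀ γ, E₁ (1 + γ) = E₁ γ) (hhalf : ∀ γ, ‖E₂ (1 / 2 + γ)‖ = ‖E₂ γ‖)
    {k k' d : ℝ → ℝ} (hk : k = (Set.Icc (-Γ) Γ).indicator fun β => ‖E₂ β‖ ^ 2)
    (hk' : k' = (Set.Icc (-Γ) Γ).indicator fun _ => 1)
    (hd : d = fun β => (1 + x * |β|) ^ (-(3 / 2) : ℝ))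
    {α : ℝ} (h₁ : -Γ ≤ α) (h₂ : α ≤ 1 - Γ) :
    9 / 10 * N₁ * (k α + k (α - 1 / 2)) -
      (majorSum q₀ N₁ (3 * N₁ * N₂ * δ₂ + 4 * δ₁ * N₂ ^ 2) k k' α +
        δ₂ * (‖E₁ (2 * α)‖ ^ 2 + ‖E₂ α‖ ^ 2) +
        4 * V₂ ^ 2 * (δ₁ * (Q₂ : ℝ) ^ (41 / 100 : ℝ) + 2 * V₁ * κ) * minorSum Q₂ d α) ≤
      (E₁ (2 * α) * (E₂ α * (starRingEnd ℂ) (E₂ α))).re := by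
  have hN₁0 : 0 ≤ N₁ := (norm_nonneg _).trans (hN₁ 0)
  have hN₂0 : 0 ≤ N₂ := (norm_nonneg _).trans (hN₂ 0)
  have hκ0 : 0 ≤ κ := le_trans (by positivity) hκ₁
  have hkn : ∀ β, 0 ≤ k β := fun β => by
    rw [hk]; exact Set.indicator_nonneg (fun _ _ => by positivity) _
  have hkn' : ∀ β, 0 ≤ k' β := fun β => by
    rw [hk']; exact Set.indicator_nonneg (fun _ _ => by positivity) _
  have hdn : ∀ β, 0 ≤ d β := fun β => by rw [hd]; positivity
  have hkin : ∀ β, |β| ≤ Γ → k β = ‖E₂ β‖ ^ 2 := fun β hβ => by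
    rw [hk, Set.indicator_of_mem (by rw [Set.mem_Icc]; exact abs_le.1 hβ)]
  have hkin' : ∀ β, |β| ≤ Γ → k' β = 1 := fun β hβ => by
    rw [hk', Set.indicator_of_mem (by rw [Set.mem_Icc]; exact abs_le.1 hβ)]
  have hkout : ∀ β, ¬ |β| ≤ Γ → k β = 0 := fun β hβ => by
    rw [hk, Set.indicator_of_notMem (by rw [Set.mem_Icc]; exact fun h => hβ (abs_le.2 h))]
  have hR : 0 ≤ 3 * N₁ * N₂ * δ₂ + 4 * δ₁ * N₂ ^ 2 := by positivity
  have hM := majorSum_nonneg (q₀ := q₀) hN₁0 hR hkn hkn' α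
  have hm := minorSum_nonneg (Q₂ := Q₂) hdn α
  have hL : 0 ≤ 4 * V₂ ^ 2 * (δ₁ * (Q₂ : ℝ) ^ (41 / 100 : ℝ) + 2 * V₁ * κ) := by positivity
  have hLm := mul_nonneg hL hm
  have hδE : 0 ≤ δ₂ * (‖E₁ (2 * α)‖ ^ 2 + ‖E₂ α‖ ^ 2) := by positivity
  have hre : (E₁ (2 * α) * (E₂ α * (starRingEnd ℂ) (E₂ α))).re =
      (E₁ (2 * α)).re * ‖E₂ α‖ ^ 2 := by
    rw [mul_conj, normSq_eq_norm_sq, re_mul_ofReal]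
  have hQ1 : (1:ℝ) ≤ Q := by exact_mod_cast hQ
  have hΓ8 : Γ ≤ 1 / 8 := by nlinarith
  rw [hre]
  by_cases c0 : |α| ≤ Γ
  · have c1 : ¬ |α - 1 / 2| ≤ Γ := fun h => by
      rw [abs_le] at c0 h; linarith
    rw [hkin α c0, hkout _ c1]
    have := mul_le_mul_of_nonneg_right (hmain α c0) (sq_nonneg ‖E₂ α‖)
    linarith
  by_cases c1 : |α - 1 / 2| ≤ Γ
  · rw [hkin _ c1, hkout _ c0]
    have e1 : E₁ (2 * α) = E₁ (2 * (α - 1 / 2)) := by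
      rw [← hper (2 * (α - 1 / 2))]; congr 1; ring
    have e2 : ‖E₂ α‖ = ‖E₂ (α - 1 / 2)‖ := by
      rw [← hhalf (α - 1 / 2)]; congr 2; ring
    have := mul_le_mul_of_nonneg_right (hmain _ c1) (sq_nonneg ‖E₂ (α - 1 / 2)‖)
    rw [← e1, ← e2] at this
    rw [← e2]
    linarith
  rw [hkout _ c0, hkout _ c1]
  have hre2 : -(‖E₁ (2 * α)‖ * ‖E₂ α‖ ^ 2) ≤ (E₁ (2 * α)).re * ‖E₂ α‖ ^ 2 := by
    have := mul_le_mul_of_nonneg_right (abs_le.1 (abs_re_le_norm (E₁ (2 * α)))).1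
      (sq_nonneg ‖E₂ α‖)
    linarith
  suffices h : ‖E₁ (2 * α)‖ * ‖E₂ α‖ ^ 2 ≤
      majorSum q₀ N₁ (3 * N₁ * N₂ * δ₂ + 4 * δ₁ * N₂ ^ 2) k k' α +
        δ₂ * (‖E₁ (2 * α)‖ ^ 2 + ‖E₂ α‖ ^ 2) +
        4 * V₂ ^ 2 * (δ₁ * (Q₂ : ℝ) ^ (41 / 100 : ℝ) + 2 * V₁ * κ) * minorSum Q₂ d α by
    linarith
  obtain ⟨q, a, hq1, hqQ, haq, hqa, hαq⟩ := exists_reduced_fraction hQ hΓ (by linarith) h₁ h₂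
  have hcop : IsCoprime (a : ℤ) (q : ℤ) := Nat.isCoprime_iff_coprime.2 hqa.symm
  obtain ⟨γ, hγ⟩ : ∃ γ, γ = α - a / q := ⟨_, rfl⟩
  rw [← hγ] at hαq
  have hα : α = ((a : ℤ) : ℝ) / q + γ := by rw [hγ]; push_cast; ring
  by_cases hcase : q₀ < q ∨ Γ ≤ |γ|
  · have h := hE₁.minor_le hE₂ hx₁ hx hΓ hV₁ hV₂ hδ₁ hδ₂ hq₀ hQ₂ hκ₁ hκ₂ hq1 hqQ hcop hαq hcase
    rw [← hα] at h
    have h2 : 2 * δ₂ * (‖E₁ (2 * α)‖ * ‖E₂ α‖) ≤ δ₂ * (‖E₁ (2 * α)‖ ^ 2 + ‖E₂ α‖ ^ 2) := by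
      have := mul_le_mul_of_nonneg_left (two_mul_le_add_sq ‖E₁ (2 * α)‖ ‖E₂ α‖) hδ₂
      linarith
    split_ifs at h with hqQ2
    · have h3 := mul_le_mul_of_nonneg_left (le_minorSum hdn α hq1 hqQ2 haq) hL
      rw [← hγ] at h3
      have h4 : d γ = (1 + x * |γ|) ^ (-(3 / 2) : ℝ) := by rw [hd]
      rw [h4] at h3
      linarith
    · linarith
  · push Not at hcase
    obtain ⟨hqq, hγΓ⟩ := hcase
    have hq3 : 3 ≤ q := by
      by_contra! hlt
      interval_cases q
      · interval_cases a
        · apply c0; rw [hα]; simpa using hγΓ.le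
        · have : α = 1 + γ := by rw [hα]; simp
          rw [abs_lt] at hγΓ; linarith
      · interval_cases a
        · simp at hqa
        · apply c1; rw [hα]; simpa using hγΓ.le
        · simp at hqa
    have haq' : a < q := by
      refine lt_of_le_of_ne haq ?_
      rintro rfl
      rw [Nat.coprime_self] at hqa
      omega
    have h := hE₁.major_le hE₂ hN₁ hN₂ hδ₁ hδ₂ hδN hq1 hqq hcop hγΓ.le
    have h3 := le_majorSum hN₁0 hR hkn hkn' α hq3 hqq haq' hqa
    rw [← hγ, hkin _ hγΓ.le, hkin' _ hγΓ.le] at h3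
    rw [← hα] at h
    linarith

end CircleMethod

section CircleMethodIntegral
open Complex Finset MeasureTheory

lemma intervalIntegral_sub_right_le {h : ℝ → ℝ} (hi : Integrable h) (hn : ∀ β, 0 ≤ h β)
    {a b : ℝ} (hab : a ≤ b) (c : ℝ) :
    IntervalIntegrable (fun α => h (α - c)) volume a b ∧ ∫ α in a..b, h (α - c) ≤ ∫ β, h β := by
  have hs : Integrable fun α => h (α - c) := hi.comp_sub_right c
  refine ⟨hs.intervalIntegrable, ?_⟩
  rw [intervalIntegral.integral_of_le hab, ← integral_sub_right_eq_self h c]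
  exact setIntegral_le_integral hs (Filter.Eventually.of_forall fun _ => hn _)

lemma intervalIntegrable_finsetSum {ι : Type*} {s : Finset ι} {f : ι → ℝ → ℝ} {a b : ℝ}
    (h : ∀ i ∈ s, IntervalIntegrable (f i) volume a b) :
    IntervalIntegrable (fun α => ∑ i ∈ s, f i α) volume a b := by
  have := IntervalIntegrable.sum s h
  simpa only [Finset.sum_fn] using this

lemma majorSum_integral_le {q₀ : ℕ} {N R : ℝ} {k k' : ℝ → ℝ} (hN : 0 ≤ N) (hR : 0 ≤ R)
    (hk : ∀ β, 0 ≤ k β) (hk' : ∀ β, 0 ≤ k' β) (hi : Integrable k) (hi' : Integrable k')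
    {a b : ℝ} (hab : a ≤ b) :
    IntervalIntegrable (majorSum q₀ N R k k') volume a b ∧
    ∫ α in a..b, majorSum q₀ N R k k' α ≤
      13 / 10 * N * (∫ β, k β) + q₀ ^ 2 * R * ∫ β, k' β := by
  have H := fun c => intervalIntegral_sub_right_le hi hk hab c
  have H' := fun c => intervalIntegral_sub_right_le hi' hk' hab c
  have hJ : 0 ≤ ∫ β, k β := integral_nonneg hk
  have hJ' : 0 ≤ ∫ β, k' β := integral_nonneg hk'
  have hfi : ∀ C c : ℝ, IntervalIntegrable (fun α => C * k (α - c) + R * k' (α - c)) volume a b :=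
    fun C c => ((H c).1.const_mul C).add ((H' c).1.const_mul R)
  unfold majorSum
  constructor
  · exact intervalIntegrable_finsetSum fun q _ => intervalIntegrable_finsetSum fun a _ => hfi _ _
  rw [intervalIntegral.integral_finsetSum fun q _ =>
    intervalIntegrable_finsetSum fun a _ => hfi _ _]
  have hstep : ∀ q ∈ Icc 3 q₀, ∫ α in a..b, ∑ a ∈ range q with q.Coprime a,
      (N * (1 / ((q / Nat.gcd 2 q).totient : ℝ) *
        (|(ArithmeticFunction.moebius q : ℝ)| / q.totient) ^ 2) * k (α - a / q) +
        R * k' (α - a / q)) ≤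
      N * (∫ β, k β) * ((q.totient : ℝ) * (1 / ((q / Nat.gcd 2 q).totient : ℝ) *
        (|(ArithmeticFunction.moebius q : ℝ)| / q.totient) ^ 2)) + q₀ * R * ∫ β, k' β := by
    intro q hq
    rw [intervalIntegral.integral_finsetSum fun a _ => hfi _ _]
    have hterm : ∀ r ∈ (range q).filter (q.Coprime ·), ∫ α in a..b,
        (N * (1 / ((q / Nat.gcd 2 q).totient : ℝ) *
        (|(ArithmeticFunction.moebius q : ℝ)| / q.totient) ^ 2) * k (α - r / q) +
        R * k' (α - r / q)) ≤ N * (1 / ((q / Nat.gcd 2 q).totient : ℝ) *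
        (|(ArithmeticFunction.moebius q : ℝ)| / q.totient) ^ 2) * (∫ β, k β) +
        R * ∫ β, k' β := by
      intro r _
      rw [intervalIntegral.integral_add ((H _).1.const_mul _) ((H' _).1.const_mul _),
        intervalIntegral.integral_const_mul, intervalIntegral.integral_const_mul]
      exact add_le_add (mul_le_mul_of_nonneg_left (H _).2 (by positivity))
        (mul_le_mul_of_nonneg_left (H' _).2 hR)
    refine (sum_le_sum hterm).trans ?_
    rw [sum_const, nsmul_eq_mul, ← Nat.totient]
    have h1 : (q.totient : ℝ) ≤ q₀ := by
      exact_mod_cast (Nat.totient_le q).trans (mem_Icc.1 hq).2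
    have h2 := mul_le_mul_of_nonneg_right h1 (mul_nonneg hR hJ')
    linarith
  refine (sum_le_sum hstep).trans ?_
  rw [sum_add_distrib, ← mul_sum, sum_const, nsmul_eq_mul, Nat.card_Icc]
  have h1 := mul_le_mul_of_nonneg_left (sum_singular_tail_le q₀) (mul_nonneg hN hJ)
  have h2 : ((q₀ + 1 - 3 : ℕ) : ℝ) ≤ q₀ := by exact_mod_cast (by omega : q₀ + 1 - 3 ≤ q₀)
  have h3 := mul_le_mul_of_nonneg_right h2 (show 0 ≤ q₀ * R * ∫ β, k' β by positivity)
  linarith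

lemma minorSum_integral_le {Q₂ : ℕ} {k : ℝ → ℝ} (hk : ∀ β, 0 ≤ k β) (hi : Integrable k)
    {a b : ℝ} (hab : a ≤ b) :
    IntervalIntegrable (minorSum Q₂ k) volume a b ∧
    ∫ α in a..b, minorSum Q₂ k α ≤
      2 * (∑' n : ℕ, (n : ℝ) ^ (-(101 / 100) : ℝ)) * ∫ β, k β := by
  have H := fun c => intervalIntegral_sub_right_le hi hk hab c
  have hJ : 0 ≤ ∫ β, k β := integral_nonneg hk
  unfold minorSum
  constructor
  · exact intervalIntegrable_finsetSum fun q _ => intervalIntegrable_finsetSum fun a _ =>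
      (H _).1.const_mul _
  rw [intervalIntegral.integral_finsetSum fun q _ =>
    intervalIntegrable_finsetSum fun a _ => (H _).1.const_mul _]
  have hstep : ∀ q ∈ Icc 1 Q₂, ∫ α in a..b, ∑ a ∈ range (q + 1),
      (q : ℝ) ^ (-(201 / 100) : ℝ) * k (α - a / q) ≤
      2 * (q : ℝ) ^ (-(101 / 100) : ℝ) * ∫ β, k β := by
    intro q hq
    have hq1 : (1:ℝ) ≤ q := by exact_mod_cast (mem_Icc.1 hq).1
    rw [intervalIntegral.integral_finsetSum fun a _ => (H _).1.const_mul _]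
    have hterm : ∀ r ∈ range (q + 1), ∫ α in a..b,
        (q : ℝ) ^ (-(201 / 100) : ℝ) * k (α - r / q) ≤
        (q : ℝ) ^ (-(201 / 100) : ℝ) * ∫ β, k β := by
      intro r _
      rw [intervalIntegral.integral_const_mul]
      exact mul_le_mul_of_nonneg_left (H _).2 (by positivity)
    refine (sum_le_sum hterm).trans ?_
    rw [sum_const, nsmul_eq_mul, card_range, ← mul_assoc]
    refine mul_le_mul_of_nonneg_right ?_ hJ
    have e : (q : ℝ) ^ (-(101 / 100) : ℝ) = q * (q : ℝ) ^ (-(201 / 100) : ℝ) := by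
      rw [show (-(101 / 100) : ℝ) = 1 + -(201 / 100) by norm_num, Real.rpow_add (by linarith),
        Real.rpow_one]
    rw [e, ← mul_assoc]
    refine mul_le_mul_of_nonneg_right ?_ (by positivity)
    push_cast; linarith
  refine (sum_le_sum hstep).trans ?_
  rw [← sum_mul, ← mul_sum]
  refine mul_le_mul_of_nonneg_right (mul_le_mul_of_nonneg_left ?_ two_pos.le) hJ
  exact Summable.sum_le_tsum _ (fun _ _ => by positivity)
    (Real.summable_nat_rpow.2 (by norm_num))

lemma integrable_integral_decay {x : ℝ} (hx : 0 < x) :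
    Integrable (fun β : ℝ => (1 + x * |β|) ^ (-(3 / 2) : ℝ)) ∧
    ∫ β : ℝ, (1 + x * |β|) ^ (-(3 / 2) : ℝ) =
      (∫ β : ℝ, (1 + |β|) ^ (-(3 / 2) : ℝ)) / x := by
  have h0 : Integrable fun β : ℝ => (1 + |β|) ^ (-(3 / 2) : ℝ) := by
    have := integrable_one_add_norm (μ := (volume : Measure ℝ)) (r := 3 / 2)
      (by rw [Module.finrank_self]; norm_num)
    simpa only [Real.norm_eq_abs] using this
  have e : (fun β : ℝ => (1 + x * |β|) ^ (-(3 / 2) : ℝ)) =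
      fun β : ℝ => (fun y : ℝ => (1 + |y|) ^ (-(3 / 2) : ℝ)) (x * β) := by
    ext β
    simp only [abs_mul, abs_of_pos hx]
  constructor
  · rw [e]
    exact h0.comp_mul_left' hx.ne'
  · rw [e, Measure.integral_comp_mul_left (fun y : ℝ => (1 + |y|) ^ (-(3 / 2) : ℝ)) x, smul_eq_mul,
      abs_of_pos (inv_pos.2 hx)]
    ring

variable {s₁ s₂ : Finset ℕ} {g₁ g₂ : ℕ → ℝ} {Q q₀ Q₂ : ℕ} {x Γ δ₁ δ₂ V₁ V₂ κ : ℝ}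

lemma sum_sq_le_integral_indicator (hg : ∀ n ∈ s₂, 0 ≤ g₂ n) (hx : 0 < x)
    (hxΓ : 1 ≤ 100 * (x * Γ)) (hsupp : ∀ n ∈ s₂, g₂ n ≠ 0 → (n : ℝ) ≤ 3 * x) :
    (∑ n ∈ s₂, g₂ n) ^ 2 / (200 * x) ≤
      ∫ β, (Set.Icc (-Γ) Γ).indicator (fun β => ‖trigSum s₂ g₂ β‖ ^ 2) β := by
  set r := 1 / (100 * x) with hr
  have hr0 : 0 < r := by positivity
  have hrΓ : r ≤ Γ := by
    rw [hr, div_le_iff₀ (by positivity)]; linarith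
  have hcont : Continuous fun β => ‖trigSum s₂ g₂ β‖ ^ 2 := by
    have := continuous_trigSum (s := s₂) (g := g₂); fun_prop
  rw [integral_indicator measurableSet_Icc]
  have h1 : ∀ β ∈ Set.Icc (-r) r, (∑ n ∈ s₂, g₂ n) ^ 2 / 4 ≤ ‖trigSum s₂ g₂ β‖ ^ 2 := by
    intro β hβ
    have hb : |β| ≤ r := abs_le.2 hβ
    have h2 := le_re_trigSum (s := s₂) (α := β) (κ := 1 / 2) hg fun n hn hn0 => by
      have : |β * n| ≤ 3 / 100 := by
        rw [abs_mul, Nat.abs_cast]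
        calc |β| * n ≤ r * (3 * x) := by gcongr; exact hsupp n hn hn0
          _ = 3 / 100 := by rw [hr]; field_simp
      have := sq_le_sq' (abs_le.1 this).1 (abs_le.1 this).2
      linarith
    have h3 := h2.trans (re_le_norm _)
    have h4 : 0 ≤ ∑ n ∈ s₂, g₂ n := sum_nonneg hg
    nlinarith
  have h2 : ∫ β in Set.Icc (-r) r, (∑ n ∈ s₂, g₂ n) ^ 2 / 4 ≤
      ∫ β in Set.Icc (-r) r, ‖trigSum s₂ g₂ β‖ ^ 2 :=
    setIntegral_mono_on (integrableOn_const (by simp)) hcont.integrableOn_Icc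
      measurableSet_Icc h1
  have h3 : ∫ β in Set.Icc (-r) r, ‖trigSum s₂ g₂ β‖ ^ 2 ≤
      ∫ β in Set.Icc (-Γ) Γ, ‖trigSum s₂ g₂ β‖ ^ 2 :=
    setIntegral_mono_set hcont.integrableOn_Icc
      (Filter.Eventually.of_forall fun _ => by positivity)
      (Set.Icc_subset_Icc (by linarith) hrΓ).eventuallyLE
  refine le_trans (le_of_eq ?_) (h2.trans h3)
  rw [setIntegral_const, Real.volume_real_Icc_of_le (by linarith), smul_eq_mul, hr]
  field_simp
  ring

set_option maxHeartbeats 1000000 in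
/-- The circle method: if `2 a + b = c` is not solvable with `a ∈ s₁` and `b, c ∈ s₂`, then the
main term is dominated by the error terms. -/
theorem exists_circle_method_bound : ∃ C : ℝ, 0 < C ∧
    ∀ {s₁ s₂ : Finset ℕ} {g₁ g₂ : ℕ → ℝ} {Q q₀ Q₂ : ℕ} {x x₁ Γ δ₁ δ₂ V₁ V₂ κ : ℝ},
    ArcBound (trigSum s₁ g₁) Q q₀ x₁ Γ δ₁ V₁ → ArcBound (trigSum s₂ g₂) Q q₀ x Γ δ₂ V₂ →
    (∀ n ∈ s₁, 0 ≤ g₁ n) → (∀ n ∈ s₂, 0 ≤ g₂ n) → (∀ n ∈ s₂, Odd n) →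
    (∀ n ∈ s₁, g₁ n ≠ 0 → Γ * n ≤ 1 / 100) → (∀ n ∈ s₂, g₂ n ≠ 0 → (n : ℝ) ≤ 3 * x) →
    δ₂ ≤ ∑ n ∈ s₂, g₂ n → 0 ≤ x₁ → 0 < x → 1 ≤ 100 * (x * Γ) → 0 ≤ V₁ → 0 ≤ V₂ → 0 ≤ δ₁ → 0 ≤ δ₂ →
    1 ≤ Q → 1 ≤ q₀ → V₂ ≤ δ₂ * (Q₂ : ℝ) ^ (4 / 5 : ℝ) →
    (q₀ : ℝ) ^ (-(39 / 100) : ℝ) ≤ κ → (1 + x * Γ) ^ (-(1 / 2) : ℝ) ≤ κ → Γ * Q ≤ 1 / 8 →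
    (∀ n₁ ∈ s₁, ∀ n₂ ∈ s₂, ∀ n₃ ∈ s₂, 2 * n₁ + n₂ ≠ n₃) →
    (∑ n ∈ s₁, g₁ n) * (∑ n ∈ s₂, g₂ n) ^ 2 ≤
      C * (x * (Γ * q₀ ^ 2 * ((∑ n ∈ s₁, g₁ n) * (∑ n ∈ s₂, g₂ n) * δ₂ +
        δ₁ * (∑ n ∈ s₂, g₂ n) ^ 2) + δ₂ * (∑ n ∈ s₁, g₁ n ^ 2 + ∑ n ∈ s₂, g₂ n ^ 2)) +
        V₂ ^ 2 * (δ₁ * (Q₂ : ℝ) ^ (41 / 100 : ℝ) + V₁ * κ)) := by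
  set C₀ := ∫ β : ℝ, (1 + |β|) ^ (-(3 / 2) : ℝ) with hC₀
  set C₁ := ∑' n : ℕ, (n : ℝ) ^ (-(101 / 100) : ℝ) with hC₁
  have hC₀0 : 0 ≤ C₀ := integral_nonneg fun _ => by positivity
  have hC₁0 : 0 ≤ C₁ := tsum_nonneg fun _ => by positivity
  refine ⟨3200 + 6400 * C₁ * C₀, by positivity, ?_⟩
  intro s₁ s₂ g₁ g₂ Q q₀ Q₂ x x₁ Γ δ₁ δ₂ V₁ V₂ κ hE₁ hE₂ hg₁ hg₂ hodd hsupp₁ hsupp₂ hδN hx₁ hx hxΓ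
    hV₁ hV₂ hδ₁ hδ₂ hQ hq₀ hQ₂ hκ₁ hκ₂ hΓQ hno
  have hΓ : 0 ≤ Γ := by
    by_contra! h
    nlinarith [mul_neg_of_pos_of_neg hx h]
  have hκ0 : 0 ≤ κ := le_trans (by positivity) hκ₁
  set N₁ := ∑ n ∈ s₁, g₁ n with hN₁
  set N₂ := ∑ n ∈ s₂, g₂ n with hN₂
  have hN₁0 : 0 ≤ N₁ := sum_nonneg hg₁
  have hN₂0 : 0 ≤ N₂ := sum_nonneg hg₂
  set k := (Set.Icc (-Γ) Γ).indicator fun β => ‖trigSum s₂ g₂ β‖ ^ 2 with hk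
  set k' : ℝ → ℝ := (Set.Icc (-Γ) Γ).indicator fun _ => 1 with hk'
  set d : ℝ → ℝ := fun β => (1 + x * |β|) ^ (-(3 / 2) : ℝ) with hd
  have hc₁ := continuous_trigSum (s := s₁) (g := g₁)
  have hc₂ := continuous_trigSum (s := s₂) (g := g₂)
  have hkn : ∀ β, 0 ≤ k β := fun β => Set.indicator_nonneg (fun _ _ => by positivity) _
  have hkn' : ∀ β, 0 ≤ k' β := fun β => Set.indicator_nonneg (fun _ _ => by positivity) _
  have hdn : ∀ β, 0 ≤ d β := fun β => by rw [hd]; positivity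
  have hki : Integrable k := by
    refine IntegrableOn.integrable_indicator ?_ measurableSet_Icc
    exact Continuous.integrableOn_Icc (by fun_prop)
  have hki' : Integrable k' := by
    refine IntegrableOn.integrable_indicator ?_ measurableSet_Icc
    exact Continuous.integrableOn_Icc (by fun_prop)
  have hdi := integrable_integral_decay hx
  have hmain : ∀ γ, |γ| ≤ Γ → 9 / 10 * N₁ ≤ (trigSum s₁ g₁ (2 * γ)).re := by
    intro γ hγ
    have := le_re_trigSum (s := s₁) (α := 2 * γ) (κ := 1 / 10) hg₁ fun n hn hn0 => by
      have h1 : |2 * γ * n| ≤ 2 / 100 := by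
        rw [abs_mul, abs_mul, Nat.abs_cast, abs_two]
        have := mul_le_mul_of_nonneg_right hγ n.cast_nonneg (α := ℝ)
        have := hsupp₁ n hn hn0
        linarith
      have := sq_le_sq' (abs_le.1 h1).1 (abs_le.1 h1).2
      linarith
    linarith
  have hpt := fun {α : ℝ} => hE₁.le_integrand hE₂ (norm_trigSum_le hg₁) (norm_trigSum_le hg₂) hδN
    hx₁ hx.le hΓ hV₁ hV₂ hδ₁ hδ₂ hQ hq₀ hQ₂ hκ₁ hκ₂ hΓQ hmain
    (fun γ => by have := trigSum_add_intCast (s := s₁) (g := g₁) γ 1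
                 rw [← this]; congr 1; push_cast; ring)
    (norm_trigSum_half_add hodd) hk hk' hd (α := α)
  have hQ1 : (1:ℝ) ≤ Q := by exact_mod_cast hQ
  have hΓ8 : Γ ≤ 1 / 8 := by nlinarith only [hQ1, hΓQ, hΓ]
  have hab : -Γ ≤ 1 - Γ := by linarith
  set R := 3 * N₁ * N₂ * δ₂ + 4 * δ₁ * N₂ ^ 2 with hR
  have hR0 : 0 ≤ R := by positivity
  set L := 4 * V₂ ^ 2 * (δ₁ * (Q₂ : ℝ) ^ (41 / 100 : ℝ) + 2 * V₁ * κ) with hL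
  have hL0 : 0 ≤ L := by positivity
  obtain ⟨iM, bM⟩ := majorSum_integral_le (q₀ := q₀) hN₁0 hR0 hkn hkn' hki hki' hab
  obtain ⟨im, bm⟩ := minorSum_integral_le (Q₂ := Q₂) hdn hdi.1 hab
  have iE₁ : IntervalIntegrable (fun α => ‖trigSum s₁ g₁ (2 * α)‖ ^ 2) volume (-Γ) (1 - Γ) :=
    Continuous.intervalIntegrable (by fun_prop) _ _
  have iE₂ : IntervalIntegrable (fun α => ‖trigSum s₂ g₂ α‖ ^ 2) volume (-Γ) (1 - Γ) :=
    Continuous.intervalIntegrable (by fun_prop) _ _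
  have e₁ : ∫ α in (-Γ)..(1 - Γ), ‖trigSum s₁ g₁ (2 * α)‖ ^ 2 = ∑ n ∈ s₁, g₁ n ^ 2 := by
    have := integral_norm_trigSum_sq (s := s₁) (g := g₁) (-Γ) 2 two_pos
    rw [show 1 - Γ = -Γ + 1 by ring]
    exact_mod_cast this
  have e₂ : ∫ α in (-Γ)..(1 - Γ), ‖trigSum s₂ g₂ α‖ ^ 2 = ∑ n ∈ s₂, g₂ n ^ 2 := by
    have := integral_norm_trigSum_sq (s := s₂) (g := g₂) (-Γ) 1 one_pos
    rw [show 1 - Γ = -Γ + 1 by ring]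
    simpa using this
  set F : ℝ → ℂ := fun α => trigSum s₁ g₁ (2 * α) *
    (trigSum s₂ g₂ α * (starRingEnd ℂ) (trigSum s₂ g₂ α)) with hF
  have hFc : Continuous F := by fun_prop
  have eF : ∫ α in (-Γ)..(1 - Γ), (F α).re = 0 := by
    have h0 := integral_trigSum_eq_zero (g₁ := g₁) (g₂ := g₂) (-Γ) hno
    have h1 := intervalIntegral.intervalIntegral_re (𝕜 := ℂ) (f := F) (a := -Γ) (b := 1 - Γ)
      (μ := volume) (hFc.intervalIntegrable _ _)
    rw [show 1 - Γ = -Γ + 1 by ring] at h1 ⊢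
    simp only [hF] at h1 ⊢
    rw [h0] at h1
    simpa using h1
  have hJ : ∀ c, 0 ≤ c → c ≤ 1 / 2 →
      IntervalIntegrable (fun α => k (α - c)) volume (-Γ) (1 - Γ) ∧
      ∫ α in (-Γ)..(1 - Γ), k (α - c) = ∫ β, k β := by
    intro c hc0 hc1
    refine ⟨(intervalIntegral_sub_right_le hki hkn hab c).1, ?_⟩
    rw [intervalIntegral.integral_comp_sub_right (fun α => k α),
      intervalIntegral.integral_of_le (by linarith), ← integral_Icc_eq_integral_Ioc]
    refine setIntegral_eq_integral_of_forall_compl_eq_zero fun β hβ => ?_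
    rw [hk, Set.indicator_of_notMem]
    rw [Set.mem_Icc] at hβ ⊢
    intro h
    exact hβ ⟨by linarith, by linarith⟩
  have hJ0 := hJ 0 le_rfl (by norm_num)
  simp only [sub_zero] at hJ0
  have hJ2 := hJ (1 / 2) (by norm_num) le_rfl
  have hJlow := sum_sq_le_integral_indicator hg₂ hx hxΓ hsupp₂
  rw [← hk, ← hN₂] at hJlow
  have hfi := intervalIntegral.integral_mono_on hab
    (f := fun α => 9 / 10 * N₁ * (k α + k (α - 1 / 2)) -
      (majorSum q₀ N₁ R k k' α + δ₂ * (‖trigSum s₁ g₁ (2 * α)‖ ^ 2 + ‖trigSum s₂ g₂ α‖ ^ 2) +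
        L * minorSum Q₂ d α)) (g := fun α => (F α).re) (μ := volume)
    (((hJ0.1.add hJ2.1).const_mul _).sub ((iM.add ((iE₁.add iE₂).const_mul _)).add
      (im.const_mul _))) (Continuous.intervalIntegrable (by fun_prop) _ _)
    fun α hα => hpt hα.1 hα.2
  rw [eF, intervalIntegral.integral_sub ((hJ0.1.add hJ2.1).const_mul _)
      ((iM.add ((iE₁.add iE₂).const_mul _)).add (im.const_mul _)),
    intervalIntegral.integral_const_mul, intervalIntegral.integral_add hJ0.1 hJ2.1, hJ0.2, hJ2.2,
    intervalIntegral.integral_add (iM.add ((iE₁.add iE₂).const_mul _)) (im.const_mul _),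
    intervalIntegral.integral_add iM ((iE₁.add iE₂).const_mul _),
    intervalIntegral.integral_const_mul, intervalIntegral.integral_const_mul,
    intervalIntegral.integral_add iE₁ iE₂, e₁, e₂] at hfi
  have hk'int : ∫ β, k' β = 2 * Γ := by
    rw [hk', integral_indicator measurableSet_Icc, setIntegral_const,
      Real.volume_real_Icc_of_le (by linarith), smul_eq_mul]
    ring
  rw [hk'int] at bM
  rw [hdi.2, ← hC₀, ← hC₁] at bm
  set J := ∫ β, k β
  have hfin : N₁ * J ≤ 2 * (q₀ ^ 2 * R * (2 * Γ)) +
      2 * (δ₂ * (∑ n ∈ s₁, g₁ n ^ 2 + ∑ n ∈ s₂, g₂ n ^ 2)) + 2 * (L * (2 * C₁ * (C₀ / x))) := by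
    have := mul_le_mul_of_nonneg_left bm hL0
    linarith
  have h1 : N₁ * N₂ ^ 2 ≤ 200 * x * (N₁ * J) := by
    rw [div_le_iff₀ (by positivity)] at hJlow
    have := mul_le_mul_of_nonneg_left hJlow hN₁0
    linarith
  have h2 := h1.trans (mul_le_mul_of_nonneg_left hfin (by positivity))
  have h3 : 200 * x * (2 * (q₀ ^ 2 * R * (2 * Γ)) +
      2 * (δ₂ * (∑ n ∈ s₁, g₁ n ^ 2 + ∑ n ∈ s₂, g₂ n ^ 2)) + 2 * (L * (2 * C₁ * (C₀ / x)))) =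
      800 * (x * (Γ * q₀ ^ 2 * R)) +
      400 * (x * (δ₂ * (∑ n ∈ s₁, g₁ n ^ 2 + ∑ n ∈ s₂, g₂ n ^ 2))) + 800 * C₁ * C₀ * L := by
    field_simp
    ring
  rw [h3] at h2
  refine h2.trans ?_
  set W := ∑ n ∈ s₁, g₁ n ^ 2 + ∑ n ∈ s₂, g₂ n ^ 2 with hW
  have hW0 : 0 ≤ W := by positivity
  have hRle : R ≤ 4 * (N₁ * N₂ * δ₂ + δ₁ * N₂ ^ 2) := by
    have : 0 ≤ N₁ * N₂ * δ₂ := by positivity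
    rw [hR]; linarith
  have hLle : L ≤ 8 * (V₂ ^ 2 * (δ₁ * (Q₂ : ℝ) ^ (41 / 100 : ℝ) + V₁ * κ)) := by
    have : 0 ≤ V₂ ^ 2 * (δ₁ * (Q₂ : ℝ) ^ (41 / 100 : ℝ)) := by positivity
    rw [hL]; linarith
  set R' := N₁ * N₂ * δ₂ + δ₁ * N₂ ^ 2 with hR'
  set L' := V₂ ^ 2 * (δ₁ * (Q₂ : ℝ) ^ (41 / 100 : ℝ) + V₁ * κ) with hL'
  have hR'0 : 0 ≤ R' := by positivity
  have hL'0 : 0 ≤ L' := by positivity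
  have hCC : 0 ≤ C₁ * C₀ := by positivity
  have a1 : 800 * (x * (Γ * q₀ ^ 2 * R)) ≤ 3200 * (x * (Γ * q₀ ^ 2 * R')) := by
    have := mul_le_mul_of_nonneg_left hRle (show 0 ≤ x * (Γ * q₀ ^ 2) by positivity)
    linarith
  have a2 : 800 * C₁ * C₀ * L ≤ 6400 * C₁ * C₀ * L' := by
    have := mul_le_mul_of_nonneg_left hLle (show 0 ≤ 800 * C₁ * C₀ by positivity)
    linarith
  have a3 : 0 ≤ x * (Γ * q₀ ^ 2 * R') := by positivity
  have a4 : 0 ≤ x * (δ₂ * W) := by positivity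
  have a5 := mul_nonneg hCC a3
  have a6 := mul_nonneg hCC a4
  linarith only [a1, a2, a3, a4, a5, a6, hL'0, mul_nonneg hCC hL'0]

end CircleMethodIntegral

section WeightedPrimes
open Complex Finset Filter

lemma sum_log_le_log {P : Finset ℕ} (hP : ∀ p ∈ P, p.Prime) {q : ℕ} (hq : 1 ≤ q) :
    ∑ p ∈ P with p ∣ q, Real.log p ≤ Real.log q := by
  have h1 : ∏ p ∈ P with p ∣ q, p ∣ q :=
    Finset.prod_primes_dvd q (fun p hp => (hP p (mem_filter.1 hp).1).prime)
      fun p hp => (mem_filter.1 hp).2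
  have h2 : ((∏ p ∈ P with p ∣ q, p : ℕ) : ℝ) ≤ q := by exact_mod_cast Nat.le_of_dvd hq h1
  rw [← Real.log_prod fun p hp => by
    exact_mod_cast (hP p (mem_filter.1 hp).1).ne_zero]
  push_cast at h2
  refine Real.log_le_log (prod_pos fun p hp => ?_) h2
  exact_mod_cast (hP p (mem_filter.1 hp).1).pos

lemma mangoldtWeight_le {K : ℕ} (hK : 1 ≤ K) (m : ℕ) {p : ℕ} (hp : p.Prime) :
    mangoldtWeight K (K * m) p ≤ K * Real.log p / p := by
  rw [mangoldtWeight, ArithmeticFunction.vonMangoldt_apply_prime hp]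
  have h1 := gammaDens_le_self hK m (Real.log_natCast_nonneg p)
  have h2 := Real.log_natCast_nonneg p
  gcongr

lemma sum_dvd_weight_le {K : ℕ} (hK : 1 ≤ K) (m : ℕ) {P : Finset ℕ} (hP : ∀ p ∈ P, p.Prime)
    {c s : ℝ} (hc : ∀ p ∈ P, c ≤ Real.log p) (hs : s ≤ 1) {q : ℕ} (hq : 1 ≤ q) :
    ∑ p ∈ P with p ∣ q, mangoldtWeight K (K * m) p * (p : ℝ) ^ s ≤
      K * Real.exp (-(1 - s) * c) * Real.log q := by
  have h : ∀ p ∈ P.filter (· ∣ q), mangoldtWeight K (K * m) p * (p : ℝ) ^ s ≤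
      K * Real.exp (-(1 - s) * c) * Real.log p := by
    intro p hp
    have hpp := hP p (mem_filter.1 hp).1
    have hp0 : (0:ℝ) < p := by exact_mod_cast hpp.pos
    have h2 := Real.log_natCast_nonneg p
    have h3 : (p : ℝ) ^ (s - 1) ≤ Real.exp (-(1 - s) * c) := by
      rw [Real.rpow_def_of_pos hp0, Real.exp_le_exp]
      nlinarith [hc p (mem_filter.1 hp).1]
    calc mangoldtWeight K (K * m) p * (p : ℝ) ^ s
        ≤ K * Real.log p / p * (p : ℝ) ^ s := by
          gcongr; exact mangoldtWeight_le hK m hpp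
      _ = K * (p : ℝ) ^ (s - 1) * Real.log p := by
          rw [Real.rpow_sub_one hp0.ne']; ring
      _ ≤ _ := by gcongr
  refine (sum_le_sum h).trans ?_
  rw [← mul_sum]
  exact mul_le_mul_of_nonneg_left (sum_log_le_log hP hq) (by positivity)

lemma growthLog_le {K q : ℕ} {t Λ : ℝ} (hΛ : 0 ≤ Λ) (hq : 1 ≤ q) (hqΛ : Real.log q ≤ Λ)
    (ht : |t| ≤ 7 * Real.exp (10 * Λ)) :
    growthLog K q t ≤ 22 * Λ + 2 * Real.log (12 * (2 * K + 10)) := by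
  have hq0 : (0:ℝ) < q := by exact_mod_cast hq
  have h1 : (q:ℝ) ≤ Real.exp Λ := (Real.log_le_iff_le_exp hq0).1 hqΛ
  have h2 : 1 ≤ Real.exp (10 * Λ) := Real.one_le_exp (by positivity)
  have h3 : 12 * q * (2 * K + 3 + |t|) ≤ 12 * (2 * K + 10) * Real.exp (11 * Λ) := by
    rw [show 11 * Λ = Λ + 10 * Λ by ring, Real.exp_add]
    calc 12 * q * (2 * K + 3 + |t|) ≤ 12 * Real.exp Λ * ((2 * K + 3) * Real.exp (10 * Λ) +
          7 * Real.exp (10 * Λ)) := by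
          gcongr
          exact le_mul_of_one_le_right (by positivity) h2
      _ = _ := by ring
  have h4 := Real.log_le_log (by positivity) h3
  rw [Real.log_mul (by positivity) (Real.exp_pos _).ne', Real.log_exp] at h4
  rw [growthLog]
  linarith

/-- Properties of the weights `ω` on the primes near `e ^ m` used in the circle method. -/
structure WeightedPrimes (P : Finset ℕ) (ω : ℕ → ℝ) (K : ℕ) (θ β m : ℝ) : Prop where
  half_le : 1 / 2 ≤ ∑ p ∈ P, ω p
  le_two : ∑ p ∈ P, ω p ≤ 2
  twist : ∀ q : ℕ, 1 ≤ q → Real.log q ≤ m * Real.exp (θ * m) → ∃ B,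
    TwistBound P ω q (K + 1) (7 * Real.exp (10 * (m * Real.exp (θ * m)))) B ∧
    B + ∑ p ∈ P with p ∣ q, ω p ≤ Real.exp (-(β * m))
  dvd : ∀ q : ℕ, 1 ≤ q → ∑ p ∈ P with p ∣ q, ω p * (p : ℝ) ^ (17 / 20 : ℝ) ≤
    Real.exp (-(θ * m)) / 80 * Real.log q

lemma eventually_weightedPrimes_arith {σ η θ : ℝ} (K : ℕ) (C : ℝ) (hσ : 0 < σ)
    (hη1 : η ≤ 1 / 20) (hθ0 : 0 ≤ θ) (hθ1 : θ ≤ 1 / 8) :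
    ∀ᶠ m : ℕ in atTop,
      Real.exp (-(1 / 2 - 3 * (σ / 4)) * m) * (22 * (m * Real.exp (θ * m)) + C) +
        2 * (K * Real.exp (-(1 - 0) * ((1 - η) * m)) * (m * Real.exp (θ * m))) ≤
        Real.exp (-((1 / 2 - θ - σ) * m)) ∧
      K * Real.exp (-(1 - 17 / 20) * ((1 - η) * m)) ≤ Real.exp (-(θ * m)) / 80 := by
  filter_upwards [eventually_error_le (A := 22 + 2 * K) (B := |C|) (show 0 < σ / 4 by linarith),
    eventually_error_le (A := 0) (B := 80 * K) (show (0:ℝ) < 1 / 100 by norm_num)] with m h1 h2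
  have hm : (0:ℝ) ≤ m := m.cast_nonneg
  constructor
  · have e1 : Real.exp (-((1 / 2 - θ - σ) * m)) =
        Real.exp ((-(1 / 2) + θ + 3 * (σ / 4)) * m) * Real.exp (σ / 4 * m) := by
      rw [← Real.exp_add]; congr 1; ring
    have e2 : Real.exp (-(1 / 2 - 3 * (σ / 4)) * m) * Real.exp (θ * m) =
        Real.exp ((-(1 / 2) + θ + 3 * (σ / 4)) * m) := by
      rw [← Real.exp_add]; congr 1; ring
    have e3 : Real.exp (-(1 - 0) * ((1 - η) * m)) * Real.exp (θ * m) ≤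
        Real.exp ((-(1 / 2) + θ + 3 * (σ / 4)) * m) := by
      rw [← Real.exp_add, Real.exp_le_exp]
      nlinarith [mul_nonneg hσ.le hm, mul_le_mul_of_nonneg_right hη1 hm]
    have e4 : 1 ≤ Real.exp (θ * m) := Real.one_le_exp (by positivity)
    set X := Real.exp ((-(1 / 2) + θ + 3 * (σ / 4)) * m) with hX
    have hX0 : 0 < X := Real.exp_pos _
    calc Real.exp (-(1 / 2 - 3 * (σ / 4)) * m) * (22 * (m * Real.exp (θ * m)) + C) +
        2 * (K * Real.exp (-(1 - 0) * ((1 - η) * m)) * (m * Real.exp (θ * m)))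
        ≤ Real.exp (-(1 / 2 - 3 * (σ / 4)) * m) *
            (22 * (m * Real.exp (θ * m)) + |C| * Real.exp (θ * m)) +
          2 * (K * Real.exp (-(1 - 0) * ((1 - η) * m)) * (m * Real.exp (θ * m))) := by
          gcongr
          exact (le_abs_self C).trans (le_mul_of_one_le_right (abs_nonneg C) e4)
      _ = (22 * m + |C|) * (Real.exp (-(1 / 2 - 3 * (σ / 4)) * m) * Real.exp (θ * m)) +
          2 * K * m * (Real.exp (-(1 - 0) * ((1 - η) * m)) * Real.exp (θ * m)) := by ring
      _ ≤ (22 * m + |C|) * X + 2 * K * m * X := by rw [e2]; gcongr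
      _ = X * ((22 + 2 * K) * m + |C|) := by ring
      _ ≤ X * Real.exp (σ / 4 * m) := by gcongr
      _ = _ := e1.symm
  · rw [le_div_iff₀ (by norm_num)]
    have h2' : 80 * K ≤ Real.exp (1 / 100 * m) := by linarith
    calc K * Real.exp (-(1 - 17 / 20) * ((1 - η) * m)) * 80
        = 80 * K * Real.exp (-(1 - 17 / 20) * ((1 - η) * m)) := by ring
      _ ≤ Real.exp (1 / 100 * m) * Real.exp (-(1 - 17 / 20) * ((1 - η) * m)) := by gcongr
      _ ≤ Real.exp (-(θ * m)) := by
          rw [← Real.exp_add, Real.exp_le_exp]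
          nlinarith [mul_le_mul_of_nonneg_right hη1 hm, mul_le_mul_of_nonneg_right hθ1 hm]

theorem exists_weightedPrimes (hGRH : GRH) {σ η θ : ℝ} (hσ : 0 < σ) (hσ1 : σ ≤ 1 / 8)
    (hη : 0 < η) (hη1 : η ≤ 1 / 20) (hθ0 : 0 ≤ θ) (hθ1 : θ ≤ 1 / 8) :
    ∃ K₀ : ℕ, ∀ K : ℕ, K₀ ≤ K → ∀ᶠ m : ℕ in atTop,
      WeightedPrimes (primeWindow ((1 - η) * m) ((1 + η) * m)) (mangoldtWeight K (K * m)) K θ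
        (1 / 2 - θ - σ) m := by
  obtain ⟨K₀, hK₀⟩ := exists_primeWindow_bounds hGRH (ε := σ / 4) (by linarith) (by linarith) hη
    (by linarith)
  refine ⟨max K₀ 1, fun K hK => ?_⟩
  have hK1 : 1 ≤ K := (le_max_right _ _).trans hK
  filter_upwards [hK₀ K ((le_max_left _ _).trans hK),
    eventually_weightedPrimes_arith K (2 * Real.log (12 * (2 * K + 10))) hσ hη1 hθ0 hθ1]
    with m ⟨hsum, hchar, hprin⟩ ⟨har1, har2⟩
  set P := primeWindow ((1 - η) * m) ((1 + η) * m) with hPdef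
  set ω := mangoldtWeight K (K * m) with hω
  have hω0 : ∀ p, 0 ≤ ω p := mangoldtWeight_nonneg K _
  have hP : ∀ p ∈ P, p.Prime := fun p hp => (mem_primeWindow.1 hp).1
  have hPl : ∀ p ∈ P, (1 - η) * m ≤ Real.log p := fun p hp => (mem_primeWindow.1 hp).2.1.le
  set Λ := m * Real.exp (θ * m) with hΛ
  have hΛ0 : 0 ≤ Λ := by positivity
  rw [abs_le] at hsum
  refine ⟨by linarith, by linarith, fun q hq hqΛ => ?_, fun q hq => ?_⟩
  · set Y := Real.exp (-(1 / 2 - 3 * (σ / 4)) * m) with hY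
    have hY0 : 0 < Y := Real.exp_pos _
    have hb0 := sum_dvd_weight_le hK1 m hP hPl (s := 0) (by norm_num) hq
    simp only [Real.rpow_zero, mul_one] at hb0
    set b := ∑ p ∈ P with p ∣ q, ω p with hb
    have hbn : 0 ≤ b := sum_nonneg fun p _ => hω0 p
    have hbΛ : b ≤ K * Real.exp (-(1 - 0) * ((1 - η) * m)) * Λ :=
      hb0.trans (mul_le_mul_of_nonneg_left hqΛ (by positivity))
    set C := 2 * Real.log (12 * (2 * K + 10)) with hC
    have hC0 : 0 ≤ C := by
      have : 0 ≤ Real.log (12 * (2 * K + 10)) := Real.log_nonneg (by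
        have : (0:ℝ) ≤ K := K.cast_nonneg
        linarith)
      linarith
    have hremove : ∀ f : ℕ → ℂ, (∀ p ∈ P, ‖f p‖ ≤ ω p) → ∀ U, ‖∑ p ∈ P, f p‖ ≤ U →
        ‖∑ p ∈ P with ¬ p ∣ q, f p‖ ≤ U + b := by
      intro f hf U hU
      have h1 := sum_filter_add_sum_filter_not P (· ∣ q) f
      have h2 : ‖∑ p ∈ P with p ∣ q, f p‖ ≤ b :=
        (norm_sum_le _ _).trans (sum_le_sum fun p hp => hf p (mem_filter.1 hp).1)
      rw [show ∑ p ∈ P with ¬ p ∣ q, f p = ∑ p ∈ P, f p - ∑ p ∈ P with p ∣ q, f p by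
        rw [← h1]; ring]
      exact (norm_sub_le _ _).trans (add_le_add hU h2)
    have htotal : Y * (22 * Λ + C) + b + b ≤ Real.exp (-((1 / 2 - θ - σ) * m)) := by
      refine le_trans ?_ har1
      rw [add_assoc, ← two_mul]
      gcongr
    refine ⟨Y * (22 * Λ + C) + b, ⟨by positivity, ?_, ?_⟩, htotal⟩
    · intro r hr χ hχ t ht
      have hr1 : 1 ≤ r := Nat.pos_of_dvd_of_pos hr hq
      have : NeZero r := ⟨by omega⟩
      refine hremove _ (fun p hp => ?_) _ ?_
      · rw [norm_mul, norm_mul, norm_real, Real.norm_of_nonneg (hω0 p),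
          norm_natCast_cpow_mul_I (hP p hp).pos, mul_one]
        exact mul_le_of_le_one_right (hω0 p) (χ.norm_le_one _)
      · have h := hchar r χ hχ (-t)
        have hrΛ : Real.log r ≤ Λ := le_trans (Real.log_le_log (by exact_mod_cast hr1)
          (by exact_mod_cast Nat.le_of_dvd hq hr)) hqΛ
        have hg := growthLog_le (K := K) (t := -t) hΛ0 hr1 hrΛ (by rwa [abs_neg])
        refine le_trans (le_of_eq ?_) (h.trans (mul_le_mul_of_nonneg_left hg hY0.le))
        congr 1
        refine sum_congr rfl fun p _ => ?_
        push_cast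
        rw [mul_assoc]
        congr 3; ring
    · intro t ht1 ht
      refine hremove _ (fun p hp => ?_) _ ?_
      · rw [norm_mul, norm_real, Real.norm_of_nonneg (hω0 p),
          norm_natCast_cpow_mul_I (hP p hp).pos, mul_one]
      · have h := hprin (-t) (by rwa [abs_neg])
        have hg := growthLog_le (K := K) (t := -t) hΛ0 le_rfl (by simpa using hΛ0)
          (by rwa [abs_neg])
        refine le_trans (le_of_eq ?_) (h.trans (mul_le_mul_of_nonneg_left hg hY0.le))
        congr 1
        refine sum_congr rfl fun p _ => ?_
        push_cast
        congr 3; ring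
  · refine (sum_dvd_weight_le hK1 m hP hPl (by norm_num) hq).trans ?_
    exact mul_le_mul_of_nonneg_right har2 (Real.log_natCast_nonneg q)

end WeightedPrimes

section SmoothedProducts
open Complex Finset Filter

variable {P : Finset ℕ} {ω : ℕ → ℝ} {k K : ℕ} {a c d m θ β : ℝ}

/-- The product weight restricted smoothly to the integers `n` with `log n ∈ [a, a + 1]`. -/
def windowWeight (P : Finset ℕ) (ω : ℕ → ℝ) (k : ℕ) (a : ℝ) (n : ℕ) : ℝ :=
  productWeight P ω k n * bump (Real.log n - a)

lemma trigSum_windowWeight (α : ℝ) :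
    trigSum (kProducts P k) (windowWeight P ω k a) α = windowSum P ω k a α := rfl

lemma windowWeight_nonneg (hω : ∀ p ∈ P, 0 ≤ ω p) (n : ℕ) : 0 ≤ windowWeight P ω k a n :=
  mul_nonneg (productWeight_nonneg hω k n) (bump_nonneg _)

lemma windowWeight_le (hω : ∀ p ∈ P, 0 ≤ ω p) (n : ℕ) :
    windowWeight P ω k a n ≤ productWeight P ω k n :=
  mul_le_of_le_one_right (productWeight_nonneg hω k n) (bump_le_one _)

lemma sum_windowWeight_le (hω : ∀ p ∈ P, 0 ≤ ω p) (hP : ∀ p ∈ P, p.Prime) :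
    ∑ n ∈ kProducts P k, windowWeight P ω k a n ≤ (∑ p ∈ P, ω p) ^ k := by
  rw [← sum_productWeight fun p hp => (hP p hp).pos]
  exact sum_le_sum fun n _ => windowWeight_le hω n

lemma log_mem_of_windowWeight_ne_zero {n : ℕ} (h : windowWeight P ω k a n ≠ 0) :
    a ≤ Real.log n ∧ Real.log n ≤ a + 1 := by
  have hb : bump (Real.log n - a) ≠ 0 := right_ne_zero_of_mul h
  constructor
  · by_contra! h1
    exact hb (bump_of_nonpos (by linarith))
  · by_contra! h1
    exact hb (bump_of_one_le (by linarith))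

lemma le_exp_of_windowWeight_ne_zero {n : ℕ} (h : windowWeight P ω k a n ≠ 0) :
    (n : ℝ) ≤ Real.exp (a + 1) := by
  rcases Nat.eq_zero_or_pos n with rfl | hn
  · simpa using (Real.exp_pos _).le
  · exact (Real.log_le_iff_le_exp (by exact_mod_cast hn)).1 (log_mem_of_windowWeight_ne_zero h).2

lemma exists_window (hω : ∀ p ∈ P, 0 ≤ ω p) (hP : ∀ p ∈ P, p.Prime)
    (hlog : ∀ p ∈ P, c ≤ Real.log p ∧ Real.log p ≤ d) (hcd : c ≤ d) :
    ∃ a, k * c - 1 ≤ a ∧ a ≤ k * d ∧ (∑ p ∈ P, ω p) ^ k ≤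
      (2 * (k * (d - c)) + 3) * ∑ n ∈ kProducts P k, windowWeight P ω k a n := by
  have hP0 : ∀ p ∈ P, 0 < p := fun p hp => (hP p hp).pos
  set J : Finset ℤ := Icc (⌊2 * (k * c)⌋ - 1) ⌊2 * (k * d)⌋ with hJ
  have hk : (0:ℝ) ≤ k := k.cast_nonneg
  have hcd' : (k:ℝ) * c ≤ k * d := by gcongr
  have hfl : ⌊2 * (k * c)⌋ ≤ ⌊2 * (k * d)⌋ := Int.floor_le_floor (by linarith)
  have hJne : J.Nonempty := ⟨⌊2 * (k * d)⌋, by rw [hJ, mem_Icc]; omega⟩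
  have hcard : (#J : ℝ) ≤ 2 * (k * (d - c)) + 3 := by
    have h1 : (#J : ℤ) = ⌊2 * (k * d)⌋ + 1 - (⌊2 * (k * c)⌋ - 1) := by
      rw [hJ, Int.card_Icc]; omega
    have h2 : (#J : ℝ) = ⌊2 * (k * d)⌋ + 1 - (⌊2 * (k * c)⌋ - 1) := by exact_mod_cast h1
    rw [h2]
    have h3 := Int.floor_le (2 * (k * d))
    have h4 := Int.lt_floor_add_one (2 * (k * c))
    linarith
  have hcover : ∀ n ∈ kProducts P k, productWeight P ω k n ≤
      ∑ j ∈ J, windowWeight P ω k (j / 2) n := by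
    intro n hn
    obtain ⟨hn1, hn2⟩ := log_mem_of_mem_kProducts hP0 hlog hn
    set j := ⌊2 * Real.log n⌋ with hj
    have hj1 : ⌊2 * (k * c)⌋ ≤ j := Int.floor_le_floor (by linarith)
    have hj2 : j ≤ ⌊2 * (k * d)⌋ := Int.floor_le_floor (by linarith)
    have h3 := Int.floor_le (2 * Real.log n)
    have h4 := Int.lt_floor_add_one (2 * Real.log n)
    have h5 := bump_add_bump (x := Real.log n - j / 2) (by linarith) (by linarith)
    have hsub : ({j, j - 1} : Finset ℤ) ⊆ J := by
      intro i hi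
      rw [mem_insert, mem_singleton] at hi
      rw [hJ, mem_Icc]
      omega
    refine le_trans (le_of_eq ?_) (sum_le_sum_of_subset_of_nonneg hsub
      fun i _ _ => windowWeight_nonneg hω n)
    rw [sum_pair (by omega), windowWeight, windowWeight, ← mul_add]
    rw [show Real.log n - ((j - 1 : ℤ) : ℝ) / 2 = Real.log n - j / 2 + 1 / 2 by
      push_cast; ring, h5, mul_one]
  have htot : (∑ p ∈ P, ω p) ^ k ≤
      ∑ j ∈ J, ∑ n ∈ kProducts P k, windowWeight P ω k (j / 2) n := by
    rw [sum_comm, ← sum_productWeight hP0]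
    exact sum_le_sum hcover
  obtain ⟨j, hj, hmax⟩ := exists_max_image J
    (fun j : ℤ => ∑ n ∈ kProducts P k, windowWeight P ω k (j / 2) n) hJne
  rw [hJ, mem_Icc] at hj
  have hj1 : ((⌊2 * (k * c)⌋ : ℝ)) - 1 ≤ j := by exact_mod_cast hj.1
  have hj2 : (j : ℝ) ≤ ⌊2 * (k * d)⌋ := by exact_mod_cast hj.2
  have h3 := Int.floor_le (2 * (k * d))
  have h4 := Int.lt_floor_add_one (2 * (k * c))
  refine ⟨j / 2, by linarith, by linarith, htot.trans ?_⟩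
  refine (sum_le_card_nsmul J _ _ hmax).trans ?_
  rw [nsmul_eq_mul]
  exact mul_le_mul_of_nonneg_right hcard (sum_nonneg fun n _ => windowWeight_nonneg hω n)

lemma sum_windowWeight_sq_le (hω : ∀ p ∈ P, 0 ≤ ω p) (hP : ∀ p ∈ P, p.Prime) {M : ℝ}
    (hM : 0 ≤ M) (hωM : ∀ p ∈ P, p * ω p ≤ M) :
    ∑ n ∈ kProducts P k, windowWeight P ω k a n ^ 2 ≤
      (k * M) ^ k * Real.exp (-a) * (∑ p ∈ P, ω p) ^ k := by
  have hP0 : ∀ p ∈ P, 0 < p := fun p hp => (hP p hp).pos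
  have h : ∀ n ∈ kProducts P k, windowWeight P ω k a n ≤ (k * M) ^ k * Real.exp (-a) := by
    intro n hn
    by_cases h0 : windowWeight P ω k a n = 0
    · rw [h0]; positivity
    have hn0 : (0:ℝ) < n := by exact_mod_cast pos_of_mem_kProducts hP0 hn
    have h1 : Real.exp a ≤ n :=
      (Real.le_log_iff_exp_le hn0).1 (log_mem_of_windowWeight_ne_zero h0).1
    have h2 := mul_productWeight_le hω hP hM hωM k n
    have h3 : (k.factorial : ℝ) ≤ (k : ℝ) ^ k := by exact_mod_cast Nat.factorial_le_pow k
    rw [Real.exp_neg, ← div_eq_mul_inv, le_div_iff₀ (Real.exp_pos a), mul_pow]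
    calc windowWeight P ω k a n * Real.exp a
        ≤ productWeight P ω k n * n := mul_le_mul (windowWeight_le hω n) h1
          (Real.exp_pos a).le (productWeight_nonneg hω k n)
      _ = n * productWeight P ω k n := mul_comm _ _
      _ ≤ _ := h2.trans (by gcongr)
  calc ∑ n ∈ kProducts P k, windowWeight P ω k a n ^ 2
      ≤ ∑ n ∈ kProducts P k, (k * M) ^ k * Real.exp (-a) * windowWeight P ω k a n := by
        refine sum_le_sum fun n hn => ?_
        rw [sq]
        exact mul_le_mul_of_nonneg_right (h n hn) (windowWeight_nonneg hω n)
    _ ≤ _ := by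
        rw [← mul_sum]
        exact mul_le_mul_of_nonneg_left (sum_windowWeight_le hω hP) (by positivity)

lemma WeightedPrimes.add_pow_le (W : WeightedPrimes P ω K θ β m) (hω : ∀ p ∈ P, 0 ≤ ω p)
    (hk : (k : ℝ) ≤ Real.exp (θ * m)) {q : ℕ} (hq : 1 ≤ q) :
    (q : ℝ) ^ (-(17 / 20) : ℝ) *
      (∑ p ∈ P, ω p + ∑ p ∈ P with p ∣ q, ω p * (p:ℝ) ^ (17 / 20 : ℝ)) ^ k ≤
      (∑ p ∈ P, ω p) ^ k * (q : ℝ) ^ (-(4 / 5) : ℝ) := by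
  set S := ∑ p ∈ P, ω p with hS
  set b := ∑ p ∈ P with p ∣ q, ω p * (p:ℝ) ^ (17 / 20 : ℝ) with hb
  have hb0 : 0 ≤ b := sum_nonneg fun p hp => mul_nonneg (hω p (mem_filter.1 hp).1) (by positivity)
  have hS0 : 1 / 2 ≤ S := W.half_le
  have hq0 : (0:ℝ) < q := by exact_mod_cast hq
  have hl : 0 ≤ Real.log q := Real.log_natCast_nonneg q
  have h1 : S + b ≤ S * Real.exp (2 * b) := by
    have := Real.add_one_le_exp (2 * b)
    nlinarith only [this, hS0, hb0]
  have h2 : k * (2 * b) ≤ Real.log q * (1 / 40) := by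
    have h3 := W.dvd q hq
    rw [Real.exp_neg] at h3
    calc k * (2 * b) ≤ Real.exp (θ * m) * (2 * ((Real.exp (θ * m))⁻¹ / 80 * Real.log q)) := by
          gcongr
      _ = _ := by field_simp; ring
  have h4 : (S + b) ^ k ≤ S ^ k * (q:ℝ) ^ (1 / 40 : ℝ) := by
    calc (S + b) ^ k ≤ (S * Real.exp (2 * b)) ^ k := by gcongr
      _ = S ^ k * Real.exp (k * (2 * b)) := by rw [mul_pow, ← Real.exp_nat_mul]
      _ ≤ S ^ k * (q:ℝ) ^ (1 / 40 : ℝ) := by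
        rw [Real.rpow_def_of_pos hq0]
        gcongr
  calc (q : ℝ) ^ (-(17 / 20) : ℝ) * (S + b) ^ k
      ≤ (q : ℝ) ^ (-(17 / 20) : ℝ) * (S ^ k * (q:ℝ) ^ (1 / 40 : ℝ)) := by gcongr
    _ = S ^ k * (q : ℝ) ^ (-(17 / 20) + 1 / 40 : ℝ) := by rw [Real.rpow_add hq0]; ring
    _ ≤ _ := by
        gcongr
        · exact_mod_cast hq
        · norm_num

lemma two_mul_sqrt_le_of_mul_le {q y z : ℝ} (hq : 0 ≤ q) (hz : 0 ≤ z) (h : q * y ≤ 9 * √z) :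
    √q * √y ≤ 3 * z ^ (1 / 4 : ℝ) := by
  rw [← Real.sqrt_mul hq]
  refine (Real.sqrt_le_sqrt h).trans (le_of_eq ?_)
  rw [Real.sqrt_mul (by norm_num), Real.sqrt_eq_rpow √z, Real.sqrt_eq_rpow z, ← Real.rpow_mul hz,
    show (9:ℝ) = 3 ^ 2 by norm_num, Real.sqrt_sq (by norm_num)]
  norm_num

set_option maxHeartbeats 1000000 in
lemma WeightedPrimes.arcBound (W : WeightedPrimes P ω K θ β m) (hω : ∀ p ∈ P, 0 ≤ ω p)
    (hP : ∀ p ∈ P, p.Prime) (hlog : ∀ p ∈ P, c ≤ Real.log p ∧ Real.log p ≤ d) (hcd : c ≤ d)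
    (hm : 0 ≤ m) (hk : (k : ℝ) ≤ Real.exp (θ * m)) (ha1 : k * c - 1 ≤ a) (ha2 : a ≤ k * d)
    {x Γ δ : ℝ} {Q q₀ : ℕ} (hx : Real.exp a ≤ x) (hxΛ : Real.log x ≤ 2 * (m * Real.exp (θ * m)))
    (hQ1 : √x ≤ 2 * Q) (hQ2 : (Q : ℝ) ≤ √x) (hq₀P : ∀ p ∈ P, q₀ < p) (hq₀Q : q₀ ≤ Q)
    (hq₀x : q₀ * (1 + 2 * Γ * Real.exp a) ≤ 9 * √x)
    (hδ : 66 * Real.exp (-(β * m)) ^ k * x ^ (1 / 4 : ℝ) +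
      252 * (2 ^ k * ((k * (d - c) + 3) * √x * Real.exp (-(5 * (m * Real.exp (θ * m)))))) ≤ δ) :
    ArcBound (trigSum (kProducts P k) (windowWeight P ω k a)) Q q₀ (Real.exp a) Γ δ
      (24 * (K + 1) ^ 2 * (∑ p ∈ P, ω p) ^ k) := by
  set S := ∑ p ∈ P, ω p with hS
  have hS0 : 0 ≤ S := sum_nonneg hω
  have hS2 : S ≤ 2 := W.le_two
  set Λ := m * Real.exp (θ * m) with hΛ
  have hΛ0 : 0 ≤ Λ := by positivity
  have hx0 : 0 < x := (Real.exp_pos a).trans_le hx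
  have hkd : (0:ℝ) ≤ k * (d - c) := mul_nonneg k.cast_nonneg (by linarith)
  have hqΛ : ∀ q : ℕ, 1 ≤ q → q ≤ Q → Real.log q ≤ Λ := by
    intro q hq hqQ
    have h1 : (q:ℝ) ≤ √x := le_trans (by exact_mod_cast hqQ) hQ2
    have h2 := Real.log_le_log (by exact_mod_cast hq) h1
    rw [Real.log_sqrt hx0.le] at h2
    linarith
  have hsqM : √(Real.exp (10 * Λ)) = Real.exp (5 * Λ) := by
    rw [show 10 * Λ = 5 * Λ + 5 * Λ by ring, Real.exp_add, Real.sqrt_mul_self (Real.exp_pos _).le]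
  have hM1 : 1 ≤ Real.exp (10 * Λ) := Real.one_le_exp (by positivity)
  have hτ : (1:ℝ) ≤ K + 1 := by
    have : (0:ℝ) ≤ K := K.cast_nonneg
    linarith
  set Dw := k * (d - c) + 3 with hDw
  have hDw1 : 1 ≤ Dw := by linarith
  have hDeq : (k * c - 1) + Dw = k * d + 2 := by rw [hDw]; ring
  have htail : ∀ y, 0 ≤ y → y ≤ 9 * √x → S ^ k * (14 * Dw * y / √(Real.exp (10 * Λ))) ≤
      126 * (2 ^ k * (Dw * √x * Real.exp (-(5 * Λ)))) := by
    intro y hy0 hy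
    rw [hsqM, div_eq_mul_inv, ← Real.exp_neg]
    calc S ^ k * (14 * Dw * y * Real.exp (-(5 * Λ)))
        ≤ 2 ^ k * (14 * Dw * (9 * √x) * Real.exp (-(5 * Λ))) := by gcongr
      _ = _ := by ring
  set R₁ := Real.exp (-(β * m)) ^ k * x ^ (1 / 4 : ℝ) with hR₁
  set R₂ := 2 ^ k * (Dw * √x * Real.exp (-(5 * Λ))) with hR₂
  have hR₁0 : 0 ≤ R₁ := by positivity
  have hR₂0 : 0 ≤ R₂ := by positivity
  have hδ' : 66 * R₁ + 252 * R₂ ≤ δ := by rw [hR₁, ← mul_assoc]; exact hδ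
  constructor
  · intro q r γ hq hqQ hr hγ
    have hq1 : (1:ℝ) ≤ q := by exact_mod_cast hq
    have hq0 : (0:ℝ) < q := by linarith
    have hQ0 : (0:ℝ) < Q := lt_of_lt_of_le hq0 (by exact_mod_cast hqQ)
    obtain ⟨B, hB, hBb⟩ := W.twist q hq (hqΛ q hq hqQ)
    have h := norm_windowSum_le (k := k) (a := a) (γ := γ) hω hP hlog (A := k * c - 1) (D := Dw)
      (by linarith) (by linarith) hDw1 ha1 (by linarith) hτ hM1 hq hr hB
    rw [trigSum_windowWeight]
    set T := |γ| * Real.exp a with hT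
    have hT0 : 0 ≤ T := by positivity
    have hqT : q * (1 + T) ≤ 9 * √x := by
      have h1 : q * T ≤ 4 * √x := by
        have h2 : q * |γ| ≤ 2 / Q := by
          calc q * |γ| ≤ q * (2 / (q * Q)) := by gcongr
            _ = 2 / Q := by field_simp
        have h3 : 2 / (Q:ℝ) * x ≤ 4 * √x := by
          rw [div_mul_eq_mul_div, div_le_iff₀ hQ0]
          nlinarith only [Real.mul_self_sqrt hx0.le, Real.sqrt_nonneg x, hQ1]
        calc q * T = q * |γ| * Real.exp a := by rw [hT]; ring
          _ ≤ 2 / Q * x := by gcongr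
          _ ≤ _ := h3
      have h4 : (q:ℝ) ≤ √x := le_trans (by exact_mod_cast hqQ) hQ2
      have h5 := Real.sqrt_nonneg x
      linarith
    have h1T : 1 + T ≤ 9 * √x := le_trans (le_mul_of_one_le_left (by positivity) hq1) hqT
    have e1 : 2 * √q * (B + ∑ p ∈ P with p ∣ q, ω p) ^ k * (11 * √(1 + T)) ≤ 66 * R₁ := by
      have h5 := two_mul_sqrt_le_of_mul_le hq0.le hx0.le hqT
      have h6 : (B + ∑ p ∈ P with p ∣ q, ω p) ^ k ≤ Real.exp (-(β * m)) ^ k := by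
        have hb0 : 0 ≤ ∑ p ∈ P with p ∣ q, ω p := sum_nonneg fun p hp => hω p (mem_filter.1 hp).1
        have := hB.nonneg
        gcongr
      calc _ = 22 * ((B + ∑ p ∈ P with p ∣ q, ω p) ^ k * (√q * √(1 + T))) := by ring
        _ ≤ 22 * (Real.exp (-(β * m)) ^ k * (3 * x ^ (1 / 4 : ℝ))) := by gcongr
        _ = _ := by rw [hR₁]; ring
    have e2 : 4 * (q : ℝ) ^ (-(17 / 20) : ℝ) *
        (S + ∑ p ∈ P with p ∣ q, ω p * (p:ℝ) ^ (17 / 20 : ℝ)) ^ k *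
        (6 * ((K:ℝ) + 1) ^ 2 / (1 + T)) ≤
        24 * (K + 1) ^ 2 * S ^ k * (q : ℝ) ^ (-(4 / 5) : ℝ) / (1 + Real.exp a * |γ|) := by
      rw [mul_comm (Real.exp a) |γ|, ← hT]
      calc _ = 24 * ((K:ℝ) + 1) ^ 2 * ((q : ℝ) ^ (-(17 / 20) : ℝ) *
            (S + ∑ p ∈ P with p ∣ q, ω p * (p:ℝ) ^ (17 / 20 : ℝ)) ^ k) / (1 + T) := by ring
        _ ≤ 24 * ((K:ℝ) + 1) ^ 2 * (S ^ k * (q : ℝ) ^ (-(4 / 5) : ℝ)) / (1 + T) := by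
            have := W.add_pow_le hω hk hq
            gcongr ?_ / _
            exact mul_le_mul_of_nonneg_left this (by positivity)
        _ = _ := by ring
    have e3 := htail _ (by positivity) h1T
    linarith
  · intro q r γ hq hqq₀ hr hγ
    have hq1 : (1:ℝ) ≤ q := by exact_mod_cast hq
    have hq0 : (0:ℝ) < q := by linarith
    obtain ⟨B, hB, hBb⟩ := W.twist q hq (hqΛ q hq (hqq₀.trans hq₀Q))
    have hPq : ∀ p ∈ P, ¬ p ∣ q := fun p hp hd => by
      have := Nat.le_of_dvd hq hd
      have := hq₀P p hp
      omega
    have h := norm_windowSum_sub_le (k := k) (a := a) (γ := γ) hω hP hlog (A := k * c - 1)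
      (D := Dw) (by linarith) (by linarith) hDw1 ha1 (by linarith) hM1 hq hr hPq hB
    rw [trigSum_windowWeight, trigSum_windowWeight]
    set T := |γ| * Real.exp a with hT
    have hT0 : 0 ≤ T := by positivity
    have hqT : q * (1 + T) ≤ 9 * √x := by
      refine le_trans ?_ hq₀x
      have : (q:ℝ) ≤ q₀ := by exact_mod_cast hqq₀
      rw [hT]
      gcongr
    have h1T : 1 + T ≤ 9 * √x := le_trans (le_mul_of_one_le_left (by positivity) hq1) hqT
    have e1 : √q * B ^ k * (11 * √(1 + T)) ≤ 33 * R₁ := by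
      have h5 := two_mul_sqrt_le_of_mul_le hq0.le hx0.le hqT
      have h6 : B ^ k ≤ Real.exp (-(β * m)) ^ k := by
        have hb0 : 0 ≤ ∑ p ∈ P with p ∣ q, ω p := sum_nonneg fun p hp => hω p (mem_filter.1 hp).1
        have := hB.nonneg
        gcongr
        linarith
      calc _ = 11 * (B ^ k * (√q * √(1 + T))) := by ring
        _ ≤ 11 * (Real.exp (-(β * m)) ^ k * (3 * x ^ (1 / 4 : ℝ))) := by gcongr
        _ = _ := by rw [hR₁]; ring
    have e3 := htail _ (by positivity) h1T
    linarith

end SmoothedProducts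

section SmoothSequences
open Complex Finset Filter

/-- Quantitative properties of the smooth weighted integers with `k` prime factors in `P`,
relative to the size parameter `G`. -/
structure SmoothSequence (P : Finset ℕ) (ω : ℕ → ℝ) (k K : ℕ) (a σ θ G : ℝ) : Prop where
  exp_le_sum : Real.exp (-(2 * σ * G)) ≤ ∑ n ∈ kProducts P k, windowWeight P ω k a n
  sum_le_exp : ∑ n ∈ kProducts P k, windowWeight P ω k a n ≤ Real.exp (σ * G)
  peak_le_exp : 24 * ((K : ℝ) + 1) ^ 2 * (∑ p ∈ P, ω p) ^ k ≤ Real.exp (2 * σ * G)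
  peak_le_sum : 24 * ((K : ℝ) + 1) ^ 2 * (∑ p ∈ P, ω p) ^ k ≤
    24 * ((K : ℝ) + 1) ^ 2 * (4 * G + 3) * ∑ n ∈ kProducts P k, windowWeight P ω k a n
  sum_sq_le : ∑ n ∈ kProducts P k, windowWeight P ω k a n ^ 2 ≤ Real.exp ((θ - 1 + 5 * σ) * G)
  arcBound : ∀ {x Γ : ℝ} {Q q₀ : ℕ}, Real.exp a ≤ x → x ≤ Real.exp ((1 + σ) * G) → √x ≤ 2 * Q →
    (Q : ℝ) ≤ √x → (∀ p ∈ P, q₀ < p) → q₀ ≤ Q → q₀ * (1 + 2 * Γ * Real.exp a) ≤ 9 * √x →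
    ArcBound (trigSum (kProducts P k) (windowWeight P ω k a)) Q q₀ (Real.exp a) Γ
      (Real.exp (-((1 / 4 - θ - 3 * σ) * G))) (24 * ((K : ℝ) + 1) ^ 2 * (∑ p ∈ P, ω p) ^ k)

lemma arc_error_le {σ θ η m G x : ℝ} {k : ℕ} (hσ : 0 < σ) (hσ1 : σ ≤ 1 / 1000)
    (hη : 0 < η) (hη1 : η ≤ σ) (hθ0 : 0 ≤ θ) (hθ1 : θ ≤ 1 / 8) (hm : 0 ≤ m) (hG : 0 ≤ G)
    (hk : (k : ℝ) ≤ Real.exp (θ * m)) (hG1 : (1 - σ) * G ≤ k * m) (hG2 : k * m ≤ G)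
    (h2k : (2:ℝ) ^ k ≤ Real.exp (σ * G)) (hpoly : 4000 * (G + 3) ≤ Real.exp (σ * G))
    (hx0 : 0 < x) (hx : x ≤ Real.exp ((1 + σ) * G)) :
    66 * Real.exp (-((1 / 2 - θ - σ) * m)) ^ k * x ^ (1 / 4 : ℝ) +
      252 * (2 ^ k * ((k * ((1 + η) * m - (1 - η) * m) + 3) * √x *
        Real.exp (-(5 * (m * Real.exp (θ * m)))))) ≤ Real.exp (-((1 / 4 - θ - 3 * σ) * G)) := by
  have hΛ : (1 - σ) * G ≤ m * Real.exp (θ * m) := by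
    calc (1 - σ) * G ≤ k * m := hG1
      _ ≤ _ := by rw [mul_comm]; gcongr
  have hx4 : x ^ (1 / 4 : ℝ) ≤ Real.exp ((1 + σ) / 4 * G) := by
    calc x ^ (1 / 4 : ℝ) ≤ Real.exp ((1 + σ) * G) ^ (1 / 4 : ℝ) := by gcongr
      _ = _ := by rw [← Real.exp_mul]; congr 1; ring
  have hx2 : √x ≤ Real.exp ((1 + σ) / 2 * G) := by
    rw [Real.sqrt_eq_rpow]
    calc x ^ (1 / 2 : ℝ) ≤ Real.exp ((1 + σ) * G) ^ (1 / 2 : ℝ) := by gcongr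
      _ = _ := by rw [← Real.exp_mul]; congr 1; ring
  have e1 : Real.exp (-((1 / 2 - θ - σ) * m)) ^ k ≤ Real.exp (-((1 / 2 - θ - 3 / 2 * σ) * G)) := by
    rw [← Real.exp_nat_mul, Real.exp_le_exp]
    have h1 : (1 / 2 - θ - σ) * ((1 - σ) * G) ≤ (1 / 2 - θ - σ) * (k * m) := by
      apply mul_le_mul_of_nonneg_left hG1; linarith
    nlinarith [mul_nonneg (mul_nonneg hσ.le hG) (by linarith : 0 ≤ θ + σ)]
  have h1 : 66 * Real.exp (-((1 / 2 - θ - σ) * m)) ^ k * x ^ (1 / 4 : ℝ) ≤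
      Real.exp (-((1 / 4 - θ - 3 * σ) * G)) / 2 := by
    have h66 : 132 ≤ Real.exp (σ * G) := by linarith
    rw [le_div_iff₀ two_pos]
    calc 66 * Real.exp (-((1 / 2 - θ - σ) * m)) ^ k * x ^ (1 / 4 : ℝ) * 2
        = 132 * Real.exp (-((1 / 2 - θ - σ) * m)) ^ k * x ^ (1 / 4 : ℝ) := by ring
      _ ≤ Real.exp (σ * G) * Real.exp (-((1 / 2 - θ - 3 / 2 * σ) * G)) *
          Real.exp ((1 + σ) / 4 * G) := by gcongr
      _ ≤ _ := by
          rw [← Real.exp_add, ← Real.exp_add, Real.exp_le_exp]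
          nlinarith [mul_nonneg hσ.le hG]
  have h2 : 252 * (2 ^ k * ((k * ((1 + η) * m - (1 - η) * m) + 3) * √x *
        Real.exp (-(5 * (m * Real.exp (θ * m)))))) ≤
      Real.exp (-((1 / 4 - θ - 3 * σ) * G)) / 2 := by
    have hD : 504 * (k * ((1 + η) * m - (1 - η) * m) + 3) ≤ Real.exp (σ * G) := by
      have : η * (k * m) ≤ 1 * G := by
        apply mul_le_mul (by linarith) hG2 (by positivity) zero_le_one
      nlinarith
    have hΛ2 : Real.exp (-(5 * (m * Real.exp (θ * m)))) ≤ Real.exp (-(5 * ((1 - σ) * G))) := by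
      rw [Real.exp_le_exp]; linarith
    have hD0 : 0 ≤ 504 * (k * ((1 + η) * m - (1 - η) * m) + 3) := by
      have : 0 ≤ η * (k * m) := by positivity
      nlinarith
    rw [le_div_iff₀ two_pos]
    calc _ = 2 ^ k * (504 * (k * ((1 + η) * m - (1 - η) * m) + 3)) * √x *
          Real.exp (-(5 * (m * Real.exp (θ * m)))) := by ring
      _ ≤ Real.exp (σ * G) * Real.exp (σ * G) * Real.exp ((1 + σ) / 2 * G) *
          Real.exp (-(5 * ((1 - σ) * G))) := by gcongr
      _ ≤ _ := by
          rw [← Real.exp_add, ← Real.exp_add, ← Real.exp_add, Real.exp_le_exp]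
          nlinarith [mul_le_mul_of_nonneg_right hσ1 hG, mul_nonneg hθ0 hG]
  linarith

set_option maxHeartbeats 1000000 in
lemma exists_smoothSequence {P : Finset ℕ} {σ θ η G : ℝ} {k K m : ℕ} (hσ : 0 < σ)
    (hσ1 : σ ≤ 1 / 1000) (hη : 0 < η) (hη1 : η ≤ σ) (hθ0 : 0 ≤ θ) (hθ1 : θ ≤ 1 / 8) (hK : 1 ≤ K)
    (hm : 1 ≤ m) (hP : P = primeWindow ((1 - η) * m) ((1 + η) * m))
    (W : WeightedPrimes P (mangoldtWeight K (K * m)) K θ (1 / 2 - θ - σ) m) (hG : 0 ≤ G)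
    (hk : (k : ℝ) ≤ Real.exp (θ * m)) (hG1 : (1 - σ) * G ≤ k * m) (hG2 : k * m ≤ G)
    (hKm : 4 * K * m ≤ Real.exp (σ * m)) (hpoly : 1000 * (K + 1) ^ 2 * (G + 3) ≤ Real.exp (σ * G)) :
    ∃ a, k * ((1 - η) * m) - 1 ≤ a ∧ a ≤ k * ((1 + η) * m) ∧
      SmoothSequence P (mangoldtWeight K (K * m)) k K a σ θ G := by
  set ω := mangoldtWeight K (K * m) with hωdef
  have hω : ∀ p ∈ P, 0 ≤ ω p := fun p _ => mangoldtWeight_nonneg K _ p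
  have hPp : ∀ p ∈ P, p.Prime := fun p hp => by
    rw [hP] at hp; exact (mem_primeWindow.1 hp).1
  have hlog : ∀ p ∈ P, (1 - η) * m ≤ Real.log p ∧ Real.log p ≤ (1 + η) * m := fun p hp => by
    rw [hP] at hp
    exact ⟨(mem_primeWindow.1 hp).2.1.le, (mem_primeWindow.1 hp).2.2⟩
  have hK1 : (1:ℝ) ≤ K := by exact_mod_cast hK
  have hm1 : (1:ℝ) ≤ m := by exact_mod_cast hm
  have hcd : (1 - η) * m ≤ (1 + η) * m := by nlinarith
  have hkm : 0 ≤ (k:ℝ) * m := by positivity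
  obtain ⟨a, ha1, ha2, hN⟩ := exists_window (k := k) hω hPp hlog hcd
  refine ⟨a, ha1, ha2, ?_⟩
  set S := ∑ p ∈ P, ω p with hS
  set N := ∑ n ∈ kProducts P k, windowWeight P ω k a n with hNdef
  have hN0 : 0 ≤ N := sum_nonneg fun n _ => windowWeight_nonneg hω n
  have hS2 : S ≤ 2 := W.le_two
  have hS1 : 1 / 2 ≤ S := W.half_le
  have hKmk : (4 * K * m : ℝ) ^ k ≤ Real.exp (σ * G) := by
    calc (4 * K * m : ℝ) ^ k ≤ Real.exp (σ * m) ^ k := by gcongr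
      _ = Real.exp (σ * (k * m)) := by rw [← Real.exp_nat_mul]; congr 1; ring
      _ ≤ _ := by gcongr
  have h2k : (2:ℝ) ^ k ≤ Real.exp (σ * G) :=
    le_trans (pow_le_pow_left₀ (by norm_num) (by nlinarith) k) hKmk
  have hSk : S ^ k ≤ Real.exp (σ * G) := le_trans (by gcongr) h2k
  have hK4 : (4:ℝ) ≤ (K + 1) ^ 2 := by nlinarith
  have hpoly1 : 4000 * (G + 3) ≤ Real.exp (σ * G) := by nlinarith
  have hpoly2 : 24 * ((K:ℝ) + 1) ^ 2 ≤ Real.exp (σ * G) := by nlinarith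
  have hσG : 1 ≤ σ * G := by
    have h1 : Real.exp 1 ≤ Real.exp (σ * G) := by
      have := Real.exp_one_lt_d9
      linarith
    exact Real.exp_le_exp.1 h1
  have hN' : S ^ k ≤ (4 * G + 3) * N := by
    refine hN.trans (mul_le_mul_of_nonneg_right ?_ hN0)
    have : η * (k * m) ≤ 1 * G := mul_le_mul (by linarith) hG2 (by positivity) zero_le_one
    nlinarith
  refine ⟨?_, (sum_windowWeight_le hω hPp).trans hSk, ?_, ?_, ?_, ?_⟩
  · have h1 : Real.exp (-(σ * G)) ≤ S ^ k := by
      rw [Real.exp_neg]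
      calc (Real.exp (σ * G))⁻¹ ≤ ((2:ℝ) ^ k)⁻¹ := by gcongr
        _ = (1 / 2) ^ k := by rw [one_div, inv_pow]
        _ ≤ S ^ k := by gcongr
    have h2 : Real.exp (-(σ * G)) ≤ Real.exp (σ * G) * N :=
      (h1.trans hN').trans (mul_le_mul_of_nonneg_right (by linarith) hN0)
    calc Real.exp (-(2 * σ * G)) = Real.exp (-(σ * G)) * Real.exp (-(σ * G)) := by
          rw [← Real.exp_add]; congr 1; ring
      _ ≤ Real.exp (-(σ * G)) * (Real.exp (σ * G) * N) := by gcongr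
      _ = N := by rw [← mul_assoc, ← Real.exp_add]; simp
  · calc 24 * ((K : ℝ) + 1) ^ 2 * S ^ k ≤ Real.exp (σ * G) * Real.exp (σ * G) := by gcongr
      _ = _ := by rw [← Real.exp_add]; congr 1; ring
  · rw [mul_assoc _ (4 * G + 3)]
    gcongr
  · have hM : ∀ p ∈ P, p * ω p ≤ 2 * K * m := by
      intro p hp
      have hp0 : (0:ℝ) < p := by exact_mod_cast (hPp p hp).pos
      calc p * ω p ≤ p * (K * Real.log p / p) := by
            gcongr; exact mangoldtWeight_le hK m (hPp p hp)
        _ = K * Real.log p := by field_simp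
        _ ≤ K * (2 * m) := by
            have := (hlog p hp).2
            gcongr
            nlinarith
        _ = _ := by ring
    refine (sum_windowWeight_sq_le hω hPp (by positivity) hM).trans ?_
    have h1 : (k * (2 * K * m) : ℝ) ^ k * S ^ k ≤ Real.exp (θ * G) * Real.exp (σ * G) := by
      calc (k * (2 * K * m) : ℝ) ^ k * S ^ k ≤ (k * (2 * K * m) : ℝ) ^ k * 2 ^ k := by gcongr
        _ = (k : ℝ) ^ k * (4 * K * m) ^ k := by rw [← mul_pow, ← mul_pow]; congr 1; ring
        _ ≤ Real.exp (θ * G) * Real.exp (σ * G) := by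
            gcongr
            calc (k : ℝ) ^ k ≤ Real.exp (θ * m) ^ k := by gcongr
              _ = Real.exp (θ * (k * m)) := by rw [← Real.exp_nat_mul]; congr 1; ring
              _ ≤ _ := by gcongr
    calc _ = (k * (2 * K * m) : ℝ) ^ k * S ^ k * Real.exp (-a) := by ring
      _ ≤ Real.exp (θ * G) * Real.exp (σ * G) * Real.exp (-a) := by gcongr
      _ ≤ _ := by
        rw [← Real.exp_add, ← Real.exp_add, Real.exp_le_exp]
        have h3 : (1 - σ) * ((1 - σ) * G) ≤ (1 - η) * (k * m) :=
          mul_le_mul (by linarith) hG1 (mul_nonneg (by linarith) hG) (by linarith)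
        nlinarith [mul_nonneg (mul_nonneg hσ.le hσ.le) hG]
  · intro x Γ Q q₀ hx hxG hQ1 hQ2 hq₀P hq₀Q hq₀x
    have hx0 : 0 < x := (Real.exp_pos a).trans_le hx
    refine W.arcBound hω hPp hlog hcd (by positivity) hk ha1 ha2 hx ?_ hQ1 hQ2 hq₀P hq₀Q hq₀x
      (arc_error_le hσ hσ1 hη hη1 hθ0 hθ1 (by positivity) hG hk hG1 hG2 h2k hpoly1 hx0 hxG)
    have h1 := (Real.log_le_iff_le_exp hx0).2 hxG
    have hΛ : (1 - σ) * G ≤ m * Real.exp (θ * m) := by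
      calc (1 - σ) * G ≤ k * m := hG1
        _ ≤ _ := by rw [mul_comm]; gcongr
    nlinarith
end SmoothSequences

section Solvability
open Complex Finset Filter

lemma rpow_floor_exp_le {L : ℝ} (hL : 0 ≤ L) :
    (⌊Real.exp L⌋₊ : ℝ) ^ (-(39 / 100) : ℝ) ≤ 2 * Real.exp (-(39 / 100 * L)) := by
  have h1 : 1 ≤ Real.exp L := Real.one_le_exp hL
  have h2 : Real.exp L / 2 ≤ ⌊Real.exp L⌋₊ := by
    have := Nat.lt_floor_add_one (Real.exp L)
    have h3 : (1:ℝ) ≤ ⌊Real.exp L⌋₊ := by exact_mod_cast Nat.le_floor (by simpa using h1)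
    linarith
  calc (⌊Real.exp L⌋₊ : ℝ) ^ (-(39 / 100) : ℝ) ≤ (Real.exp L / 2) ^ (-(39 / 100) : ℝ) :=
        Real.rpow_le_rpow_of_nonpos (by positivity) h2 (by norm_num)
    _ = 2 ^ (39 / 100 : ℝ) * Real.exp (-(39 / 100 * L)) := by
        rw [Real.div_rpow (Real.exp_pos _).le two_pos.le, ← Real.exp_mul,
          Real.rpow_neg two_pos.le, div_inv_eq_mul, mul_comm]
        congr 2; ring
    _ ≤ _ := by
        gcongr
        calc (2:ℝ) ^ (39 / 100 : ℝ) ≤ 2 ^ (1:ℝ) :=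
              Real.rpow_le_rpow_of_exponent_le (by norm_num) (by norm_num)
          _ = 2 := Real.rpow_one 2

set_option maxHeartbeats 2000000 in
lemma exists_solution_of_smoothSequence : ∃ C : ℝ, 0 < C ∧
    ∀ {P₁ P₂ : Finset ℕ} {ω₁ ω₂ : ℕ → ℝ} {k₁ k₂ K : ℕ} {a₁ a₂ σ θ G L : ℝ},
    0 < σ → σ ≤ 1 / 1000 → θ = 1 / 8 - 20 * σ → 0 ≤ G → 0 ≤ L →
    SmoothSequence P₁ ω₁ k₁ K a₁ σ θ G → SmoothSequence P₂ ω₂ k₂ K a₂ σ θ G →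
    (∀ p ∈ P₁, 0 ≤ ω₁ p) → (∀ p ∈ P₂, 0 ≤ ω₂ p) →
    (∀ n ∈ kProducts P₂ k₂, Odd n) →
    (∀ p ∈ P₁, 0 < p ∧ L < Real.log p) → (∀ p ∈ P₂, 0 < p ∧ L < Real.log p) →
    a₁ + 1 + L ≤ a₂ - 5 → a₂ ≤ (1 + σ) * G → 2 * L + 3 ≤ a₂ / 2 → 3 * L ≤ σ * G →
    12 * C ≤ Real.exp (σ * G) →
    C * ((24 * ((K : ℝ) + 1) ^ 2 * (4 * G + 3)) ^ 3 * (2 * Real.exp (-(39 / 100 * L)))) ≤ 1 / 2 →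
    ∃ n₁ ∈ kProducts P₁ k₁, ∃ n₂ ∈ kProducts P₂ k₂, ∃ n₃ ∈ kProducts P₂ k₂,
      2 * n₁ + n₂ = n₃ := by
  obtain ⟨C, hC0, hC⟩ := exists_circle_method_bound
  refine ⟨C, hC0, ?_⟩
  intro P₁ P₂ ω₁ ω₂ k₁ k₂ K a₁ a₂ σ θ G L hσ hσ1 hθ hG hL F₁ F₂ hω₁ hω₂ hodd hL₁ hL₂ ha hx hLx
    hLG hCG hκ
  by_contra! hno
  set x := Real.exp a₂ with hxdef
  set Γ := Real.exp (L - a₂) with hΓ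
  set Q := ⌊√x⌋₊ with hQ
  set q₀ := ⌊Real.exp L⌋₊ with hq₀
  set Q₂ := ⌈Real.exp (G / 4)⌉₊ with hQ₂
  set N₁ := ∑ n ∈ kProducts P₁ k₁, windowWeight P₁ ω₁ k₁ a₁ n with hN₁
  set N₂ := ∑ n ∈ kProducts P₂ k₂, windowWeight P₂ ω₂ k₂ a₂ n with hN₂
  set W₁ := ∑ n ∈ kProducts P₁ k₁, windowWeight P₁ ω₁ k₁ a₁ n ^ 2 with hW₁
  set W₂ := ∑ n ∈ kProducts P₂ k₂, windowWeight P₂ ω₂ k₂ a₂ n ^ 2 with hW₂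
  set V₁ := 24 * ((K : ℝ) + 1) ^ 2 * (∑ p ∈ P₁, ω₁ p) ^ k₁ with hV₁
  set V₂ := 24 * ((K : ℝ) + 1) ^ 2 * (∑ p ∈ P₂, ω₂ p) ^ k₂ with hV₂
  set δ := Real.exp (-((1 / 4 - θ - 3 * σ) * G)) with hδ
  set κ := 2 * Real.exp (-(39 / 100 * L)) with hκdef
  have hσG : 0 ≤ σ * G := by positivity
  have hs : σ * G ≤ 1 / 1000 * G := mul_le_mul_of_nonneg_right hσ1 hG
  have hx0 : 0 < x := Real.exp_pos _
  have hΓ0 : 0 < Γ := Real.exp_pos _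
  have hδ0 : 0 < δ := Real.exp_pos _
  have hsx : √x = Real.exp (a₂ / 2) := by
    rw [hxdef, show a₂ = a₂ / 2 + a₂ / 2 by ring, Real.exp_add,
      Real.sqrt_mul_self (Real.exp_pos _).le]
    congr 1; ring
  have hsx1 : 1 ≤ √x := by rw [hsx]; exact Real.one_le_exp (by linarith)
  have hQle : (Q:ℝ) ≤ √x := Nat.floor_le (Real.sqrt_nonneg x)
  have hQ1 : 1 ≤ Q := Nat.le_floor (by simpa using hsx1)
  have hQge : √x ≤ 2 * Q := by
    have h1 := Nat.lt_floor_add_one (√x)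
    have h2 : (1:ℝ) ≤ Q := by exact_mod_cast hQ1
    linarith
  have hq₀le : (q₀:ℝ) ≤ Real.exp L := Nat.floor_le (Real.exp_pos _).le
  have hq₀1 : 1 ≤ q₀ := Nat.le_floor (by simpa using Real.one_le_exp hL)
  have hq₀Q : q₀ ≤ Q := Nat.floor_le_floor (by
    rw [hsx, Real.exp_le_exp]; linarith)
  have hprime : ∀ P : Finset ℕ, (∀ p ∈ P, 0 < p ∧ L < Real.log p) → ∀ p ∈ P, q₀ < p := by
    intro P hP p hp
    have h1 := (Real.lt_log_iff_exp_lt (by exact_mod_cast (hP p hp).1)).1 (hP p hp).2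
    exact_mod_cast hq₀le.trans_lt h1
  have hΓx : Γ * x = Real.exp L := by rw [hΓ, hxdef, ← Real.exp_add]; congr 1; ring
  have hq₀x : ∀ a, a ≤ a₂ → q₀ * (1 + 2 * Γ * Real.exp a) ≤ 9 * √x := by
    intro a ha
    have h1 : Γ * Real.exp a ≤ Real.exp L := by
      rw [← hΓx]; exact mul_le_mul_of_nonneg_left (Real.exp_le_exp.2 ha) hΓ0.le
    have h2 := Real.one_le_exp hL
    calc q₀ * (1 + 2 * Γ * Real.exp a) ≤ Real.exp L * (3 * Real.exp L) := by
          have : 0 ≤ Γ * Real.exp a := by positivity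
          exact mul_le_mul hq₀le (by linarith only [h1, h2]) (by linarith only [this])
            (Real.exp_pos _).le
      _ = 3 * Real.exp (2 * L) := by rw [two_mul L, Real.exp_add]; ring
      _ ≤ 9 * Real.exp (a₂ / 2) := by
          have : Real.exp (2 * L) ≤ Real.exp (a₂ / 2) := Real.exp_le_exp.2 (by linarith)
          have h0 := Real.exp_pos (a₂ / 2)
          linarith
      _ = _ := by rw [hsx]
  have hxG : x ≤ Real.exp ((1 + σ) * G) := Real.exp_le_exp.2 hx
  have A₁ := F₁.arcBound (Γ := Γ) (Real.exp_le_exp.2 (by linarith : a₁ ≤ a₂)) hxG hQge hQle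
    (hprime P₁ hL₁) hq₀Q (hq₀x a₁ (by linarith))
  have A₂ := F₂.arcBound (Γ := Γ) le_rfl hxG hQge hQle (hprime P₂ hL₂) hq₀Q (hq₀x a₂ le_rfl)
  rw [← hδ, ← hV₁] at A₁
  rw [← hδ, ← hV₂, ← hxdef] at A₂
  have hN₁l : Real.exp (-(2 * σ * G)) ≤ N₁ := F₁.exp_le_sum
  have hN₂l : Real.exp (-(2 * σ * G)) ≤ N₂ := F₂.exp_le_sum
  have hN₁0 : 0 < N₁ := (Real.exp_pos _).trans_le hN₁l
  have hN₂0 : 0 < N₂ := (Real.exp_pos _).trans_le hN₂l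
  have hV₁G : V₁ ≤ Real.exp (2 * σ * G) := F₁.peak_le_exp
  have hV₂G : V₂ ≤ Real.exp (2 * σ * G) := F₂.peak_le_exp
  have hV₁0 : 0 ≤ V₁ := mul_nonneg (by positivity) (pow_nonneg (sum_nonneg hω₁) _)
  have hV₂0 : 0 ≤ V₂ := mul_nonneg (by positivity) (pow_nonneg (sum_nonneg hω₂) _)
  have hρ : 1 / 4 - θ - 3 * σ = 1 / 8 + 17 * σ := by rw [hθ]; ring
  have hQ₂l : Real.exp (G / 4) ≤ Q₂ := Nat.le_ceil _
  have hQ₂u : (Q₂:ℝ) ≤ 2 * Real.exp (G / 4) := by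
    have h1 := Nat.ceil_lt_add_one (Real.exp_pos (G / 4)).le
    have h2 : 1 ≤ Real.exp (G / 4) := Real.one_le_exp (by positivity)
    linarith
  have hV₂Q : V₂ ≤ δ * (Q₂ : ℝ) ^ (4 / 5 : ℝ) := by
    calc V₂ ≤ Real.exp (2 * σ * G) := hV₂G
      _ ≤ δ * Real.exp (G / 4) ^ (4 / 5 : ℝ) := by
          rw [hδ, hρ, ← Real.exp_mul, ← Real.exp_add, Real.exp_le_exp]
          linarith only [hs, hσG, hG, hLG]
      _ ≤ _ := by gcongr
  have hQ₂p : (Q₂ : ℝ) ^ (41 / 100 : ℝ) ≤ 2 * Real.exp (41 / 400 * G) := by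
    calc (Q₂ : ℝ) ^ (41 / 100 : ℝ) ≤ (2 * Real.exp (G / 4)) ^ (41 / 100 : ℝ) := by gcongr
      _ = 2 ^ (41 / 100 : ℝ) * Real.exp (41 / 400 * G) := by
          rw [Real.mul_rpow two_pos.le (Real.exp_pos _).le, ← Real.exp_mul]
          congr 2; ring
      _ ≤ _ := by
          gcongr
          calc (2:ℝ) ^ (41 / 100 : ℝ) ≤ 2 ^ (1:ℝ) :=
                Real.rpow_le_rpow_of_exponent_le (by norm_num) (by norm_num)
            _ = 2 := Real.rpow_one 2
  have hκ2 : (1 + x * Γ) ^ (-(1 / 2) : ℝ) ≤ κ := by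
    rw [mul_comm, hΓx]
    calc (1 + Real.exp L) ^ (-(1 / 2) : ℝ) ≤ Real.exp L ^ (-(1 / 2) : ℝ) :=
          Real.rpow_le_rpow_of_nonpos (Real.exp_pos _) (by linarith) (by norm_num)
      _ = Real.exp (L * (-(1 / 2))) := (Real.exp_mul _ _).symm
      _ ≤ Real.exp (-(39 / 100 * L)) := Real.exp_le_exp.2 (by linarith)
      _ ≤ κ := by rw [hκdef]; linarith [Real.exp_pos (-(39 / 100 * L))]
  have he5 : Real.exp (-5) ≤ 1 / 100 := by
    have h1 := Real.exp_one_gt_d9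
    rw [Real.exp_neg, show (5:ℝ) = (5:ℕ) * 1 by norm_num, Real.exp_nat_mul,
      inv_le_comm₀ (by positivity) (by norm_num)]
    calc (1 / 100 : ℝ)⁻¹ ≤ (2.7:ℝ) ^ 5 := by norm_num
      _ ≤ Real.exp 1 ^ 5 := by gcongr; linarith
  have he3 : Real.exp (-3) ≤ 1 / 8 := by
    have h1 := Real.exp_one_gt_d9
    rw [Real.exp_neg, show (3:ℝ) = (3:ℕ) * 1 by norm_num, Real.exp_nat_mul,
      inv_le_comm₀ (by positivity) (by norm_num)]
    calc (1 / 8 : ℝ)⁻¹ ≤ (2:ℝ) ^ 3 := by norm_num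
      _ ≤ Real.exp 1 ^ 3 := by gcongr; linarith
  have main := hC (Q₂ := Q₂) (κ := κ) A₁ A₂ (fun n _ => windowWeight_nonneg hω₁ n)
    (fun n _ => windowWeight_nonneg hω₂ n) hodd
    (fun n _ h0 => by
      calc Γ * n ≤ Γ * Real.exp (a₁ + 1) := by
            gcongr; exact le_exp_of_windowWeight_ne_zero h0
        _ ≤ Real.exp (-5) := by rw [hΓ, ← Real.exp_add, Real.exp_le_exp]; linarith
        _ ≤ _ := he5)
    (fun n _ h0 => by
      have h1 := le_exp_of_windowWeight_ne_zero h0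
      rw [Real.exp_add] at h1
      have h2 : Real.exp 1 ≤ 3 := by linarith only [Real.exp_one_lt_d9]
      have h3 := mul_le_mul_of_nonneg_left h2 hx0.le
      linarith only [h1, h3])
    (le_trans (by rw [hδ, hρ, Real.exp_le_exp]; linarith only [hs, hσG, hG]) hN₂l)
    (Real.exp_pos _).le hx0 (by rw [mul_comm x, hΓx]; linarith [Real.one_le_exp hL]) hV₁0 hV₂0
    hδ0.le hδ0.le hQ1 hq₀1 hV₂Q (rpow_floor_exp_le hL) hκ2
    (by
      calc Γ * Q ≤ Γ * √x := by gcongr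
        _ ≤ Real.exp (-3) := by rw [hΓ, hsx, ← Real.exp_add, Real.exp_le_exp]; linarith
        _ ≤ _ := he3)
    hno
  rw [← hN₁, ← hN₂, ← hW₁, ← hW₂] at main
  have hN₁u : N₁ ≤ Real.exp (σ * G) := F₁.sum_le_exp
  have hN₂u : N₂ ≤ Real.exp (σ * G) := F₂.sum_le_exp
  have hW₁u : W₁ ≤ Real.exp ((θ - 1 + 5 * σ) * G) := F₁.sum_sq_le
  have hW₂u : W₂ ≤ Real.exp ((θ - 1 + 5 * σ) * G) := F₂.sum_sq_le
  have hε := Real.exp_pos (-(20 * σ * G))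
  have t1 : x * (Γ * q₀ ^ 2 * (N₁ * N₂ * δ + δ * N₂ ^ 2)) ≤ 2 * Real.exp (-(20 * σ * G)) := by
    calc x * (Γ * q₀ ^ 2 * (N₁ * N₂ * δ + δ * N₂ ^ 2))
        = Γ * x * q₀ ^ 2 * (N₁ * N₂ + N₂ ^ 2) * δ := by ring
      _ ≤ Real.exp L * Real.exp L ^ 2 *
          (Real.exp (σ * G) * Real.exp (σ * G) + Real.exp (σ * G) ^ 2) * δ := by
          rw [hΓx]; gcongr
      _ = 2 * (Real.exp (3 * L) * Real.exp (2 * (σ * G)) * δ) := by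
          rw [show 3 * L = L + L + L by ring, show 2 * (σ * G) = σ * G + σ * G by ring]
          simp only [Real.exp_add]; ring
      _ ≤ _ := by
          rw [hδ, hρ, ← Real.exp_add, ← Real.exp_add]
          have : Real.exp (3 * L + 2 * (σ * G) + -((1 / 8 + 17 * σ) * G)) ≤
              Real.exp (-(20 * σ * G)) := by
            rw [Real.exp_le_exp]
            linarith only [hs, hσG, hG, hLG]
          linarith
  have t2 : x * (δ * (W₁ + W₂)) ≤ 2 * Real.exp (-(20 * σ * G)) := by
    calc x * (δ * (W₁ + W₂)) ≤ Real.exp ((1 + σ) * G) * (δ * (Real.exp ((θ - 1 + 5 * σ) * G) +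
          Real.exp ((θ - 1 + 5 * σ) * G))) := by gcongr
      _ = 2 * (Real.exp ((1 + σ) * G) * δ * Real.exp ((θ - 1 + 5 * σ) * G)) := by ring
      _ ≤ _ := by
          rw [hδ, hρ, ← Real.exp_add, ← Real.exp_add]
          have : Real.exp ((1 + σ) * G + -((1 / 8 + 17 * σ) * G) + (θ - 1 + 5 * σ) * G) ≤
              Real.exp (-(20 * σ * G)) := by
            rw [Real.exp_le_exp, hθ]
            linarith only [hs, hσG, hG, hLG]
          linarith
  have t3 : V₂ ^ 2 * (δ * (Q₂ : ℝ) ^ (41 / 100 : ℝ)) ≤ 2 * Real.exp (-(20 * σ * G)) := by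
    calc V₂ ^ 2 * (δ * (Q₂ : ℝ) ^ (41 / 100 : ℝ))
        ≤ Real.exp (2 * σ * G) ^ 2 * (δ * (2 * Real.exp (41 / 400 * G))) := by gcongr
      _ = 2 * (Real.exp (2 * σ * G + 2 * σ * G) * δ * Real.exp (41 / 400 * G)) := by
          rw [Real.exp_add]; ring
      _ ≤ _ := by
          rw [hδ, hρ, ← Real.exp_add, ← Real.exp_add]
          have : Real.exp (2 * σ * G + 2 * σ * G + -((1 / 8 + 17 * σ) * G) + 41 / 400 * G) ≤
              Real.exp (-(20 * σ * G)) := by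
            rw [Real.exp_le_exp]
            linarith only [hs, hσG, hG, hLG]
          linarith
  have t4 : C * (V₂ ^ 2 * (V₁ * κ)) ≤ 1 / 2 * (N₁ * N₂ ^ 2) := by
    have hκ0 : 0 ≤ κ := by positivity
    set Y := 24 * ((K : ℝ) + 1) ^ 2 * (4 * G + 3) with hY
    have hY0 : 0 ≤ Y := by positivity
    have hV₁N : V₁ ≤ Y * N₁ := F₁.peak_le_sum
    have hV₂N : V₂ ≤ Y * N₂ := F₂.peak_le_sum
    calc C * (V₂ ^ 2 * (V₁ * κ)) ≤ C * ((Y * N₂) ^ 2 * (Y * N₁ * κ)) := by gcongr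
      _ = C * (Y ^ 3 * κ) * (N₁ * N₂ ^ 2) := by ring
      _ ≤ _ := mul_le_mul_of_nonneg_right hκ (by positivity)
  have t5 : C * (6 * Real.exp (-(20 * σ * G))) < 1 / 2 * (N₁ * N₂ ^ 2) := by
    have hσGpos : 0 < σ * G := by
      by_contra! h
      have h0 : σ * G = 0 := le_antisymm h hσG
      have hL0 : L = 0 := by linarith
      have hG0 : G = 0 := by
        rcases mul_eq_zero.1 h0 with h' | h' <;> linarith
      rw [hG0] at hx
      linarith
    have h1 : C * (6 * Real.exp (-(20 * σ * G))) ≤ 1 / 2 * Real.exp (-(19 * σ * G)) := by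
      rw [show -(19 * σ * G) = σ * G + -(20 * σ * G) by ring, Real.exp_add]
      have := mul_le_mul_of_nonneg_right hCG hε.le
      linarith only [this]
    have h2 : Real.exp (-(19 * σ * G)) < Real.exp (-(6 * σ * G)) := by
      rw [Real.exp_lt_exp]; linarith only [hσGpos]
    have h3 : Real.exp (-(6 * σ * G)) ≤ N₁ * N₂ ^ 2 := by
      calc Real.exp (-(6 * σ * G)) =
          Real.exp (-(2 * σ * G)) * Real.exp (-(2 * σ * G)) ^ 2 := by
            rw [sq, ← Real.exp_add, ← Real.exp_add]; congr 1; ring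
        _ ≤ _ := by gcongr
    linarith
  have t6 : C * (x * (Γ * q₀ ^ 2 * (N₁ * N₂ * δ + δ * N₂ ^ 2) + δ * (W₁ + W₂)) +
      V₂ ^ 2 * (δ * (Q₂ : ℝ) ^ (41 / 100 : ℝ) + V₁ * κ)) ≤
      C * (6 * Real.exp (-(20 * σ * G))) + C * (V₂ ^ 2 * (V₁ * κ)) := by
    rw [← mul_add]
    apply mul_le_mul_of_nonneg_left _ hC0.le
    linarith
  linarith

end Solvability

section Parameters
open Finset Filter

lemma eventually_parameters {σ : ℝ} (hσ : 0 < σ) (hσ1 : σ ≤ 1 / 1000) {h : ℕ}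
    (hh : 4 ≤ σ * h) (K : ℕ) (C : ℝ) :
    ∀ᶠ u : ℕ in atTop, ∀ k : ℕ, k = ⌊Real.exp ((1 / 8 - 20 * σ) * ((h * u : ℕ) : ℝ))⌋₊ →
      1 ≤ u ∧ h + 20 ≤ k ∧ 4 * K * ((h * u : ℕ) : ℝ) ≤ Real.exp (σ * ((h * u : ℕ) : ℝ)) ∧
      4 * K * (((h + 3) * u : ℕ) : ℝ) ≤ Real.exp (σ * (((h + 3) * u : ℕ) : ℝ)) ∧
      1000 * ((K : ℝ) + 1) ^ 2 * ((k : ℝ) * (h * u : ℕ) + 3) ≤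
        Real.exp (σ * ((k : ℝ) * (h * u : ℕ))) ∧
      12 * C ≤ Real.exp (σ * ((k : ℝ) * (h * u : ℕ))) ∧
      C * ((24 * ((K : ℝ) + 1) ^ 2 * (4 * ((k : ℝ) * (h * u : ℕ)) + 3)) ^ 3 *
        (2 * Real.exp (-(39 / 100 * ((h - 1) * u))))) ≤ 1 / 2 := by
  have hh0 : (0:ℝ) < h := by
    by_contra! h0
    nlinarith [mul_nonneg hσ.le (sub_nonneg.2 h0)]
  have hh4 : 4000 ≤ (h:ℝ) := by nlinarith
  have hh1 : 1 ≤ h := by exact_mod_cast hh0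
  have hlin : ∀ j : ℕ, 1 ≤ j → Tendsto (fun u : ℕ => j * u) atTop atTop := fun j hj =>
    tendsto_atTop_mono (fun u => Nat.le_mul_of_pos_left u hj) tendsto_id
  have hlarge : ∀ {A B : ℝ}, ∀ᶠ m : ℕ in atTop, A * m + B ≤ Real.exp (σ * m) :=
    eventually_error_le hσ
  have hG : ∀ {p : ℕ → Prop}, (∀ᶠ m in atTop, p m) →
      ∀ᶠ u : ℕ in atTop, ∀ k : ℕ, 1 ≤ k → p (k * (h * u)) := by
    intro p hp
    obtain ⟨m₀, hm₀⟩ := eventually_atTop.1 hp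
    filter_upwards [eventually_ge_atTop m₀] with u hu k hk
    refine hm₀ _ (hu.trans ?_)
    exact (Nat.le_mul_of_pos_left u hh1).trans (Nat.le_mul_of_pos_left _ hk)
  filter_upwards [eventually_ge_atTop 1,
    (hlin h hh1).eventually (hlarge (A := 0) (B := 0) |>.and
      (eventually_error_le (A := 0) (B := h + 21) (show (0:ℝ) < 1 / 10 by norm_num))),
    (hlin h hh1).eventually (hlarge (A := 4 * K) (B := 0)),
    (hlin (h + 3) (by omega)).eventually (hlarge (A := 4 * K) (B := 0)),
    hG (hlarge (A := 1000 * ((K : ℝ) + 1) ^ 2) (B := 1000 * ((K : ℝ) + 1) ^ 2 * 3)),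
    hG (hlarge (A := 0) (B := 12 * C)),
    (hlin h hh1).eventually (hlarge (A := 168 * ((K : ℝ) + 1) ^ 2) (B := 0)),
    eventually_error_le (A := 0) (B := 4 * |C|) (show (0:ℝ) < 1 by norm_num)]
    with u hu1 hu2 hu3 hu4 hu5 hu6 hu7 hu8 k hk
  have hθ : 1 / 10 ≤ 1 / 8 - 20 * σ := by linarith
  have hu : (1:ℝ) ≤ u := by exact_mod_cast hu1
  have hm : (1:ℝ) ≤ (h * u : ℕ) := by exact_mod_cast Nat.mul_pos hh1 hu1
  have hkle : (k:ℝ) ≤ Real.exp ((1 / 8 - 20 * σ) * ((h * u : ℕ) : ℝ)) := by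
    rw [hk]; exact Nat.floor_le (Real.exp_pos _).le
  have hkge : h + 20 ≤ k := by
    rw [hk]
    refine Nat.le_floor ?_
    have h1 : Real.exp (1 / 10 * (h * u : ℕ)) ≤
        Real.exp ((1 / 8 - 20 * σ) * ((h * u : ℕ) : ℝ)) := by
      rw [Real.exp_le_exp]; gcongr
    have h2 := hu2.2
    push_cast at h1 h2 ⊢
    linarith
  refine ⟨hu1, hkge, by linarith, by linarith, ?_, ?_, ?_⟩
  · have := hu5 k (by omega)
    push_cast at this ⊢
    linarith
  · have := hu6 k (by omega)
    push_cast at this ⊢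
    linarith
  · set m : ℝ := ((h * u : ℕ) : ℝ) with hmdef
    set E := Real.exp ((1 / 8 - 20 * σ) * m) with hE
    have hE1 : 1 ≤ E := Real.one_le_exp (by positivity)
    have hmE : 1 ≤ m * E := one_le_mul_of_one_le_of_one_le hm hE1
    have hY : 24 * ((K : ℝ) + 1) ^ 2 * (4 * (k * m) + 3) ≤ Real.exp (σ * m) * E := by
      have h1 : (k:ℝ) * m ≤ m * E := by rw [mul_comm]; gcongr
      calc 24 * ((K : ℝ) + 1) ^ 2 * (4 * (k * m) + 3)
          ≤ 24 * ((K : ℝ) + 1) ^ 2 * (7 * (m * E)) := by gcongr; linarith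
        _ = (168 * ((K : ℝ) + 1) ^ 2 * m + 0) * E := by ring
        _ ≤ _ := by gcongr
    have hm' : m = h * u := by rw [hmdef]; push_cast; ring
    calc C * ((24 * ((K : ℝ) + 1) ^ 2 * (4 * (k * m) + 3)) ^ 3 *
          (2 * Real.exp (-(39 / 100 * ((h - 1) * u)))))
        ≤ |C| * ((Real.exp (σ * m) * E) ^ 3 *
          (2 * Real.exp (-(39 / 100 * ((h - 1) * u))))) := by
          gcongr
          exact le_abs_self C
      _ = 1 / 2 * (4 * |C| * ((Real.exp (σ * m) * E) ^ 3 *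
          Real.exp (-(39 / 100 * ((h - 1) * u))))) := by ring
      _ ≤ 1 / 2 * (Real.exp (1 * u) * ((Real.exp (σ * m) * E) ^ 3 *
          Real.exp (-(39 / 100 * ((h - 1) * u))))) := by
          gcongr; linarith
      _ ≤ 1 / 2 * 1 := by
          gcongr
          rw [hE, ← Real.exp_add, ← Real.exp_nat_mul, ← Real.exp_add, ← Real.exp_add,
            Real.exp_le_one_iff]
          push_cast
          rw [hm']
          have h1 : 0 ≤ σ * (h * u) := by positivity
          have h2 := mul_le_mul_of_nonneg_right hh4 (by linarith : (0:ℝ) ≤ u)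
          linarith
      _ = 1 / 2 := by ring

lemma log_two_lt_of_one_le {L : ℝ} (hL : 1 ≤ L) : Real.log 2 < L :=
  Real.log_two_lt_d9.trans_le (by linarith)

set_option maxHeartbeats 2000000 in
theorem exists_smooth_solution (hGRH : GRH) {σ : ℝ} (hσ : 0 < σ) (hσ1 : σ ≤ 1 / 1000) {h : ℕ}
    (hh : 4 ≤ σ * h) :
    ∀ᶠ u : ℕ in atTop, ∃ a b c : ℕ, 2 * a + b = c ∧ 0 < a ∧ 0 < b ∧ Nat.Coprime (2 * a) b ∧
      (∀ p : ℕ, p.Prime → p ∣ 2 * a * b * c → Real.log p ≤ (h + 4) * u) ∧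
      Real.exp ((1 / 8 - 20 * σ) * (h * u)) ≤ Real.log b := by
  have hh0 : (0:ℝ) < h := by
    by_contra! h0
    nlinarith [mul_nonneg hσ.le (sub_nonneg.2 h0)]
  have hh4 : 4000 ≤ (h:ℝ) := by nlinarith
  have hh1 : 1 ≤ h := by exact_mod_cast hh0
  set θ := 1 / 8 - 20 * σ with hθ
  have hη₂ : 1 / (h:ℝ) ≤ σ := by rw [div_le_iff₀ hh0]; linarith
  have hη₁ : 1 / ((h:ℝ) + 3) ≤ σ := by
    rw [div_le_iff₀ (by linarith)]; nlinarith
  obtain ⟨K₁, hK₁⟩ := exists_weightedPrimes hGRH hσ (by linarith)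
    (η := 1 / ((h:ℝ) + 3)) (by positivity) (by linarith) (θ := θ) (by linarith) (by linarith)
  obtain ⟨K₂, hK₂⟩ := exists_weightedPrimes hGRH hσ (by linarith)
    (η := 1 / (h:ℝ)) (by positivity) (by linarith) (θ := θ) (by linarith) (by linarith)
  obtain ⟨C, hC0, hC⟩ := exists_solution_of_smoothSequence
  set K := max (max K₁ K₂) 1 with hK
  have hK1 : 1 ≤ K := le_max_right _ _
  have hlin : ∀ j : ℕ, 1 ≤ j → Tendsto (fun u : ℕ => j * u) atTop atTop := fun j hj =>
    tendsto_atTop_mono (fun u => Nat.le_mul_of_pos_left u hj) tendsto_id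
  filter_upwards [(hlin (h + 3) (by omega)).eventually
      (hK₁ K ((le_max_left _ _).trans (le_max_left _ _))),
    (hlin h hh1).eventually (hK₂ K ((le_max_right _ _).trans (le_max_left _ _))),
    eventually_parameters hσ hσ1 hh K C] with u W₁ W₂ hpar
  obtain ⟨hu1, hk, hKm₂, hKm₁, hpoly, hCG, hκ⟩ := hpar _ rfl
  set k := ⌊Real.exp ((1 / 8 - 20 * σ) * ((h * u : ℕ) : ℝ))⌋₊ with hkdef
  set G : ℝ := (k:ℝ) * (h * u : ℕ) with hG
  have hG' : G = k * (h * u) := by rw [hG]; push_cast; ring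
  have hu : (1:ℝ) ≤ u := by exact_mod_cast hu1
  have hkr : (h:ℝ) + 20 ≤ k := by exact_mod_cast hk
  have hkle : (k:ℝ) ≤ Real.exp (θ * (h * u : ℕ)) := Nat.floor_le (Real.exp_pos _).le
  have hklt : Real.exp (θ * (h * u : ℕ)) < k + 1 := Nat.lt_floor_add_one _
  set k₁ := k * (h - 2) / (h + 4) with hk₁
  have hh2 : 2 ≤ h := by
    have : (2:ℝ) ≤ h := by linarith
    exact_mod_cast this
  have hk₁a : (k₁:ℝ) * (h + 4) ≤ k * (h - 2) := by
    have h1 : k₁ * (h + 4) ≤ k * (h - 2) := Nat.div_mul_le_self _ _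
    have h2 : ((k₁ * (h + 4) : ℕ) : ℝ) ≤ (k * (h - 2) : ℕ) := by exact_mod_cast h1
    push_cast [Nat.cast_sub hh2] at h2
    exact h2
  have hk₁b : (k:ℝ) * (h - 2) ≤ (k₁ + 1) * (h + 4) := by
    have h1 : k * (h - 2) < (k₁ + 1) * (h + 4) :=
      Nat.lt_mul_of_div_lt (Nat.lt_succ_self _) (by omega)
    have h2 : ((k * (h - 2) : ℕ) : ℝ) ≤ ((k₁ + 1) * (h + 4) : ℕ) := by exact_mod_cast h1.le
    push_cast [Nat.cast_sub hh2] at h2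
    exact h2
  have hk₁0 : (0:ℝ) ≤ k₁ := k₁.cast_nonneg
  have hk0 : (0:ℝ) ≤ k := k.cast_nonneg
  have hk₁c : (k₁:ℝ) * (h + 3) ≤ k * h := by linarith only [hk₁a, hk₁0, hk0]
  have hk₁d : (k:ℝ) * (h - 4) ≤ k₁ * (h + 3) := by
    have h1 : (k:ℝ) * (h - 4) * (h + 4) ≤ k₁ * (h + 3) * (h + 4) := by
      have h2 := mul_le_mul_of_nonneg_right hk₁b (by linarith only [hh0] : (0:ℝ) ≤ h + 3)
      have h3 := mul_le_mul_of_nonneg_right hkr (by linarith only [hh0] : (0:ℝ) ≤ h + 10)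
      linarith only [h2, h3, hh0]
    exact le_of_mul_le_mul_right h1 (by linarith)
  have hk₁k : (k₁:ℝ) ≤ k := by
    refine le_of_mul_le_mul_right (a := (h:ℝ) + 4) ?_ (by linarith only [hh0])
    linarith only [hk₁a, hk0]
  have hm₁ : (((h + 3) * u : ℕ) : ℝ) = (h + 3) * u := by push_cast; ring
  have hm₂ : ((h * u : ℕ) : ℝ) = h * u := by push_cast; ring
  have hG0 : 0 ≤ G := by positivity
  have hw₁a : (1 - 1 / ((h:ℝ) + 3)) * (((h + 3) * u : ℕ) : ℝ) = (h + 2) * u := by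
    rw [hm₁]; field_simp; ring
  have hw₁b : (1 + 1 / ((h:ℝ) + 3)) * (((h + 3) * u : ℕ) : ℝ) = (h + 4) * u := by
    rw [hm₁]; field_simp; ring
  have hw₂a : (1 - 1 / (h:ℝ)) * ((h * u : ℕ) : ℝ) = (h - 1) * u := by
    rw [hm₂]; field_simp
  have hw₂b : (1 + 1 / (h:ℝ)) * ((h * u : ℕ) : ℝ) = (h + 1) * u := by
    rw [hm₂]; field_simp
  have hσk : (k:ℝ) * 4 ≤ k * (σ * h) := mul_le_mul_of_nonneg_left hh k.cast_nonneg
  obtain ⟨a₁, ha₁l, ha₁u, F₁⟩ := exists_smoothSequence (k := k₁) (G := G) hσ hσ1 (by positivity)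
    hη₁ (by linarith) (by linarith) hK1 (Nat.mul_pos (by omega) hu1) rfl W₁ hG0
    (hk₁k.trans (hkle.trans (by
      rw [Real.exp_le_exp, hm₁, hm₂]
      have : 0 ≤ θ * (3 * u) := mul_nonneg (by linarith) (by positivity)
      linarith)))
    (by
      rw [hm₁, hG']
      have h1 : (1 - σ) * (k * h) ≤ k₁ * (h + 3) := by linarith
      have := mul_le_mul_of_nonneg_right h1 (by linarith : (0:ℝ) ≤ u)
      linarith)
    (by
      rw [hm₁, hG']
      have := mul_le_mul_of_nonneg_right hk₁c (by linarith : (0:ℝ) ≤ u)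
      linarith) hKm₁ hpoly
  obtain ⟨a₂, ha₂l, ha₂u, F₂⟩ := exists_smoothSequence (k := k) (G := G) hσ hσ1 (by positivity)
    hη₂ (by linarith) (by linarith) hK1 (Nat.mul_pos (by omega) hu1) rfl W₂ hG0
    hkle (by rw [← hG]; linarith only [mul_nonneg hσ.le hG0]) le_rfl hKm₂ hpoly
  rw [hw₁a] at ha₁l
  rw [hw₁b] at ha₁u
  rw [hw₂a] at ha₂l
  rw [hw₂b] at ha₂u
  rw [hw₁a, hw₁b] at F₁
  rw [hw₂a, hw₂b] at F₂
  set P₁ := primeWindow ((h + 2) * u) ((h + 4) * u) with hP₁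
  set P₂ := primeWindow ((h - 1) * u) ((h + 1) * u) with hP₂
  set L : ℝ := (h - 1) * u with hL
  have hL1 : 1 ≤ L := by rw [hL]; nlinarith only [hu, hh4]
  have hP₁p : ∀ p ∈ P₁, p.Prime := fun p hp => (mem_primeWindow.1 hp).1
  have hP₂p : ∀ p ∈ P₂, p.Prime := fun p hp => (mem_primeWindow.1 hp).1
  have hL₁ : ∀ p ∈ P₁, 0 < p ∧ L < Real.log p := fun p hp => by
    refine ⟨(hP₁p p hp).pos, lt_of_le_of_lt ?_ (mem_primeWindow.1 hp).2.1⟩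
    rw [hL]; linarith only [hu]
  have hL₂ : ∀ p ∈ P₂, 0 < p ∧ L < Real.log p := fun p hp =>
    ⟨(hP₂p p hp).pos, (mem_primeWindow.1 hp).2.1⟩
  have hcop2 : ∀ p ∈ P₂, Nat.Coprime p 2 := fun p hp => by
    rw [Nat.coprime_primes (hP₂p p hp) Nat.prime_two]
    rintro rfl
    have h1 := (hL₂ 2 hp).2
    have h2 := log_two_lt_of_one_le hL1
    push_cast at h1
    linarith
  have hodd : ∀ n ∈ kProducts P₂ k, Odd n := fun n hn =>
    (Nat.coprime_two_right.1 (coprime_of_mem_kProducts hcop2 hn))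
  have hku : (h + 20) * (u:ℝ) ≤ k * u := mul_le_mul_of_nonneg_right hkr (by linarith)
  have hkhu : (k:ℝ) * u * 4000 ≤ k * u * h := mul_le_mul_of_nonneg_left hh4 (by positivity)
  have hkL : k * L = k * u * h - k * u := by rw [hL]; ring
  have hLe : L = h * u - u := by rw [hL]; ring
  obtain ⟨n₁, hn₁, n₂, hn₂, n₃, hn₃, heq⟩ := hC hσ hσ1 hθ hG0 (by linarith : 0 ≤ L) F₁ F₂
    (fun p _ => mangoldtWeight_nonneg K _ p) (fun p _ => mangoldtWeight_nonneg K _ p) hodd hL₁ hL₂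
    (by
      have h1 := mul_le_mul_of_nonneg_right hk₁a (by linarith : (0:ℝ) ≤ u)
      linarith)
    (by
      have h1 := mul_le_mul_of_nonneg_right hσk (by linarith : (0:ℝ) ≤ u)
      have h2 : (0:ℝ) ≤ k * u := by positivity
      rw [hG']
      linarith)
    (by
      have h1 : (0:ℝ) ≤ (k - 20) * L := mul_nonneg (by linarith) (by linarith)
      linarith)
    (by
      have h1 := mul_le_mul_of_nonneg_right hσk (by linarith : (0:ℝ) ≤ u)
      have h2 : (0:ℝ) ≤ k * u := by positivity
      rw [hG']
      linarith)
    hCG hκ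
  have hpos₁ := pos_of_mem_kProducts (fun p hp => (hP₁p p hp).pos) hn₁
  have hpos₂ := pos_of_mem_kProducts (fun p hp => (hP₂p p hp).pos) hn₂
  refine ⟨n₁, n₂, n₃, heq, hpos₁, hpos₂, ?_, ?_, ?_⟩
  · refine Nat.Coprime.mul_left (coprime_of_mem_kProducts hcop2 hn₂).symm ?_
    refine Nat.Coprime.symm (coprime_of_mem_kProducts (fun p hp => ?_) hn₂)
    refine (coprime_of_mem_kProducts (fun r hr => ?_) hn₁).symm
    rw [Nat.coprime_primes (hP₁p r hr) (hP₂p p hp)]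
    rintro rfl
    have h1 := (mem_primeWindow.1 hr).2.1
    have h2 := (mem_primeWindow.1 hp).2.2
    linarith
  · intro p hp hd
    rcases hp.dvd_mul.1 hd with hd | hd
    · rcases hp.dvd_mul.1 hd with hd | hd
      · rcases hp.dvd_mul.1 hd with hd | hd
        · rw [(Nat.prime_dvd_prime_iff_eq hp Nat.prime_two).1 hd]
          have := log_two_lt_of_one_le hL1
          push_cast
          linarith
        · exact (mem_primeWindow.1 (dvd_mem_of_mem_kProducts hP₁p hn₁ p hp hd)).2.2
      · have := (mem_primeWindow.1 (dvd_mem_of_mem_kProducts hP₂p hn₂ p hp hd)).2.2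
        linarith
    · have := (mem_primeWindow.1 (dvd_mem_of_mem_kProducts hP₂p hn₃ p hp hd)).2.2
      linarith
  · have h1 := (log_mem_of_mem_kProducts (fun p hp => (hP₂p p hp).pos)
      (fun p hp => ⟨(mem_primeWindow.1 hp).2.1.le, (mem_primeWindow.1 hp).2.2⟩) hn₂).1
    rw [← hm₂]
    refine le_trans hklt.le (le_trans ?_ h1)
    have h2 : (2:ℝ) ≤ h * u - u := by nlinarith only [hu, hh4]
    have h3 := mul_le_mul_of_nonneg_left h2 hk0
    linarith only [h3, hkr, hh0]

end Parameters

section Solutions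
open Filter

lemma smoothness_le {X Y Z : ℤ} {B : ℕ}
    (hB : ∀ p : ℕ, p.Prime → (p : ℤ) ∣ X * Y * Z → p ≤ B) : smoothness X Y Z ≤ B :=
  csSup_le' fun p hp => hB p hp.1 hp.2

lemma isPrimitiveSolution_of_coprime {a b c : ℕ} (h : a + b = c) (ha : 0 < a) (hb : 0 < b)
    (hab : Nat.Coprime a b) : IsPrimitiveSolution a b c := by
  refine ⟨by exact_mod_cast h, ?_, ?_⟩
  · have : a * b * c ≠ 0 := by
      have hc : 0 < c := by omega
      positivity
    exact_mod_cast this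
  · rw [Int.gcd_natCast_natCast, Int.gcd_natCast_natCast]
    exact Nat.Coprime.coprime_dvd_right (Nat.gcd_dvd_left b c) hab

lemma natCast_le_height {a b c : ℕ} : ((b : ℤ) : ℝ) ≤ height a b c := by
  have : (b : ℤ) ≤ height a b c := (le_abs_self _).trans ((le_max_left _ _).trans (le_max_right _ _))
  exact_mod_cast this

lemma exponent_lt {ε σ h : ℝ} (hε : 0 < ε) (hσ : 0 < σ) (hσ1 : σ ≤ 1 / 3200)
    (hσ2 : σ ≤ ε / 3200) (hh : 4 ≤ σ * h) : h + 4 < (1 / 8 - 20 * σ) * h * (8 + ε) := by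
  have hh0 : 0 < h := by
    by_contra! h0
    nlinarith [mul_nonneg hσ.le (sub_nonneg.2 h0)]
  have h1 : 1 + σ < (1 / 8 - 20 * σ) * (8 + ε) := by nlinarith
  have h2 := mul_lt_mul_of_pos_right h1 hh0
  linarith

lemma smoothness_lt_of_primeFactors_le {a b c : ℕ} {s t δ : ℝ} (hδ : 0 ≤ δ) (hb : 0 < b)
    (hsmooth : ∀ p : ℕ, p.Prime → p ∣ a * b * c → Real.log p ≤ s)
    (hlog : Real.exp t ≤ Real.log b) (hst : s < t * δ) :
    Real.exp t ≤ Real.log (height a b c) ∧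
      (smoothness a b c : ℝ) < Real.log (height a b c) ^ δ := by
  have hH : Real.exp t ≤ Real.log (height a b c) := by
    have hb' : (0:ℝ) < b := by exact_mod_cast hb
    have := natCast_le_height (a := a) (b := b) (c := c)
    rw [Int.cast_natCast] at this
    exact hlog.trans (Real.log_le_log hb' this)
  refine ⟨hH, ?_⟩
  have hs : smoothness a b c ≤ ⌊Real.exp s⌋₊ := by
    refine smoothness_le fun p hp hd => Nat.le_floor ?_
    have hp0 : (0:ℝ) < p := by exact_mod_cast hp.pos
    exact (Real.log_le_iff_le_exp hp0).1 (hsmooth p hp (by exact_mod_cast hd))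
  have hs' : (smoothness a b c : ℝ) ≤ (⌊Real.exp s⌋₊ : ℝ) := Nat.cast_le.2 hs
  calc (smoothness a b c : ℝ) ≤ Real.exp s := hs'.trans (Nat.floor_le (Real.exp_pos _).le)
    _ < Real.exp (t * δ) := Real.exp_lt_exp.2 hst
    _ = Real.exp t ^ δ := Real.exp_mul _ _
    _ ≤ _ := Real.rpow_le_rpow (Real.exp_pos _).le hH hδ

lemma exists_primitiveSolution_smoothness_lt (hGRH : GRH) {ε : ℝ} (hε : 0 < ε) (B : ℝ) :
    ∃ X Y Z : ℤ, IsPrimitiveSolution X Y Z ∧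
      (smoothness X Y Z : ℝ) < Real.log (height X Y Z) ^ (8 + ε) ∧
      B < Real.log (height X Y Z) := by
  obtain ⟨σ, hσ, hσ1, hσ2⟩ : ∃ σ : ℝ, 0 < σ ∧ σ ≤ 1 / 3200 ∧ σ ≤ ε / 3200 :=
    ⟨min (1 / 3200) (ε / 3200), lt_min (by norm_num) (by positivity), min_le_left _ _,
      min_le_right _ _⟩
  obtain ⟨h, hh⟩ := exists_nat_ge (4 / σ)
  rw [div_le_iff₀' hσ] at hh
  have hexp := exponent_lt hε hσ hσ1 hσ2 hh
  have hθh : 0 < (1 / 8 - 20 * σ) * h := by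
    by_contra! h0
    have hh0 : (0:ℝ) ≤ h := Nat.cast_nonneg h
    nlinarith
  have hgrow : Tendsto (fun u : ℕ => Real.exp ((1 / 8 - 20 * σ) * h * u)) atTop atTop :=
    Real.tendsto_exp_atTop.comp (tendsto_natCast_atTop_atTop.const_mul_atTop hθh)
  obtain ⟨u, ⟨a, b, c, habc, ha, hb, hab, hsmooth, hlog⟩, hu, huB⟩ :=
    ((exists_smooth_solution hGRH hσ (by linarith only [hσ1]) hh).and
      ((eventually_ge_atTop 1).and (hgrow.eventually_gt_atTop B))).exists
  have hu0 : (0:ℝ) < u := Nat.cast_pos.2 hu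
  rw [← mul_assoc] at hlog
  have hst := mul_lt_mul_of_pos_right hexp hu0
  rw [mul_right_comm _ (8 + ε)] at hst
  obtain ⟨hH, hS⟩ := smoothness_lt_of_primeFactors_le (by linarith only [hε]) hb hsmooth hlog hst
  exact ⟨_, _, _, isPrimitiveSolution_of_coprime habc (by omega) hb hab, hS, huB.trans_le hH⟩

end Solutions

theorem grh_implies_xyz_upper_bound (hGRH : GRH) :
    ∀ ε > (0 : ℝ), {T : ℤ × ℤ × ℤ | IsPrimitiveSolution T.1 T.2.1 T.2.2 ∧
      (smoothness T.1 T.2.1 T.2.2 : ℝ) <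
        (Real.log (height T.1 T.2.1 T.2.2)) ^ (8 + ε)}.Infinite := by
  intro ε hε hfin
  obtain ⟨B, hB⟩ := (hfin.image fun T : ℤ × ℤ × ℤ =>
    Real.log (height T.1 T.2.1 T.2.2)).bddAbove
  obtain ⟨X, Y, Z, hP, hS, hBlt⟩ := exists_primitiveSolution_smoothness_lt hGRH hε B
  exact hBlt.not_ge (hB ⟨(X, Y, Z), ⟨hP, hS⟩, rfl⟩)
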